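/- arXiv:2411.09508 — 4 statements merged into one kernel-verified Lean document; each statement's English description precedes it below -/
import Mathlib

section
/- Every linear arrangement in the projective plane is tame and gentle: if f_1,…,f_m ∈ ℂ[x_1,x_2,x_3] are pairwise non-proportional linear forms with m > 3, then the arrangement A they define is tame and satisfies I_0(A) = I(A). -/
open MvPolynomial

noncomputable section

/-- The polynomial ring `R = ℂ[x_1,…,x_n]`. -/
abbrev PolyR (n : ℕ) : Type := MvPolynomial (Fin n) ℂ

/-- The polynomial ring `ℂ[x_1,…,x_n,s_i : i ∈ ι]`. -/
abbrev PolyRS (n : ℕ) (ι : Type) : Type := MvPolynomial (Fin n ⊕ ι) ℂ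

variable {n : ℕ} {ι : Type} [Fintype ι]

/-- The `R`-linear map given by the matrix `Q`, sending `(a, b)` to the vector with
`i`-th entry `a_i f_i + Σ_j b_j ∂f_i/∂x_j`. -/
def Qmap (f : ι → PolyR n) :
    ((ι → PolyR n) × (Fin n → PolyR n)) →ₗ[PolyR n] (ι → PolyR n) where
  toFun ab := fun i => ab.1 i * f i + ∑ j, ab.2 j * pderiv j (f i)
  map_add' x y := by
    funext i
    simp only [Prod.fst_add, Prod.snd_add, Pi.add_apply, add_mul, Finset.sum_add_distrib]
    ring
  map_smul' r x := by
    funext i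
    simp only [Prod.smul_fst, Prod.smul_snd, Pi.smul_apply, smul_eq_mul, RingHom.id_apply,
      mul_assoc, ← Finset.mul_sum]
    ring

/-- The `R`-linear map given by the Jacobian matrix `Jac(F)`. -/
def jacMap (f : ι → PolyR n) : (Fin n → PolyR n) →ₗ[PolyR n] (ι → PolyR n) where
  toFun b := fun i => ∑ j, b j * pderiv j (f i)
  map_add' x y := by
    funext i
    simp only [Pi.add_apply, add_mul, Finset.sum_add_distrib]
  map_smul' r x := by
    funext i
    simp only [Pi.smul_apply, smul_eq_mul, RingHom.id_apply, mul_assoc, ← Finset.mul_sum]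

/-- The log-derivation module `logDer(A) ⊆ R^m`. -/
def logDer (f : ι → PolyR n) : Submodule (PolyR n) (ι → PolyR n) where
  carrier := {a | ∃ b : Fin n → PolyR n, ∀ i, a i * f i + ∑ j, b j * pderiv j (f i) = 0}
  zero_mem' := ⟨0, fun i => by simp⟩
  add_mem' := by
    rintro a a' ⟨b, hb⟩ ⟨b', hb'⟩
    refine ⟨b + b', fun i => ?_⟩
    have h1 := hb i
    have h2 := hb' i
    simp only [Pi.add_apply, add_mul, Finset.sum_add_distrib]
    linear_combination h1 + h2
  smul_mem' := by
    rintro c a ⟨b, hb⟩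
    refine ⟨c • b, fun i => ?_⟩
    have h1 := hb i
    simp only [Pi.smul_apply, smul_eq_mul, mul_assoc, ← Finset.mul_sum]
    linear_combination c * h1

/-- The pre-likelihood ideal `I₀(A) ⊆ ℂ[x,s]`, generated by the polynomials
`Σ_i a_i s_i` for `a ∈ logDer(A)`. -/
def preLikelihoodIdeal (f : ι → PolyR n) : Ideal (PolyRS n ι) :=
  Ideal.span {g | ∃ a ∈ logDer f, g = ∑ i, rename Sum.inl (a i) * X (Sum.inr i)}

/-- The Jacobian matrix of `F = (f_1,…,f_m)` evaluated at a point `x ∈ ℂ^n`. -/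
def jacAt (f : ι → PolyR n) (x : Fin n → ℂ) : Matrix ι (Fin n) ℂ :=
  Matrix.of fun i j => eval x (pderiv j (f i))

/-- The maximal rank of the Jacobian matrix over all points of `ℂ^n`. -/
def jacMaxRank (f : ι → PolyR n) : ℕ :=
  ⨆ x : Fin n → ℂ, (jacAt f x).rank

/-- The critical-point locus of the log-likelihood `ℓ_A = Σ_j s_j log f_j`,
with denominators cleared, together with the maximal-rank regularity condition. -/
def critLocus [DecidableEq ι] (f : ι → PolyR n) : Set ((Fin n → ℂ) × (ι → ℂ)) :=
  {p | (∀ j, eval p.1 (f j) ≠ 0) ∧ (jacAt f p.1).rank = jacMaxRank f ∧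
    ∀ i : Fin n, ∑ j, p.2 j * eval p.1 (pderiv i (f j)) *
      ∏ k ∈ Finset.univ.erase j, eval p.1 (f k) = 0}

/-- The likelihood ideal `I(A)`: all polynomials in `ℂ[x,s]` vanishing on the
critical-point locus. -/
def likelihoodIdeal [DecidableEq ι] (f : ι → PolyR n) : Ideal (PolyRS n ι) where
  carrier := {g | ∀ p ∈ critLocus f, eval (Sum.elim p.1 p.2) g = 0}
  zero_mem' := fun p _ => by simp
  add_mem' := fun {a b} ha hb p hp => by simp [map_add, ha p hp, hb p hp]
  smul_mem' := fun c g hg p hp => by simp [smul_eq_mul, hg p hp]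

/-- An arrangement is gentle if its pre-likelihood ideal equals its likelihood ideal. -/
def IsGentle [DecidableEq ι] (f : ι → PolyR n) : Prop :=
  preLikelihoodIdeal f = likelihoodIdeal f

/-- The module `Der(A)` of `A`-derivations: derivations `θ` with `θ(f) ∈ ⟨f⟩`,
where `f = f_1 ⋯ f_m`. -/
def DerA (f : ι → PolyR n) : Submodule (PolyR n) (Derivation ℂ (PolyR n) (PolyR n)) where
  carrier := {θ | θ (∏ i, f i) ∈ Ideal.span {∏ i, f i}}
  zero_mem' := by simp
  add_mem' := by
    intro a b ha hb
    simpa using Ideal.add_mem _ ha hb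
  smul_mem' := by
    intro c θ hθ
    simpa [smul_eq_mul] using Ideal.mul_mem_left _ c hθ


/-- `ProjDimLE R k M` means the `R`-module `M` has projective dimension at most `k`. -/
def ProjDimLE (R : Type) [CommRing R] : ℕ → ModuleCat R → Prop
  | 0, M => Module.Projective R M
  | k + 1, M => ∃ (κ : Type) (p : (κ →₀ R) →ₗ[R] M), Function.Surjective p ∧
      ProjDimLE R k (ModuleCat.of R ↥(LinearMap.ker p))

/-- `Ω¹(A) = Hom_R(Der(A), R)`, the module of logarithmic differentials. -/
abbrev OmegaOne (f : ι → PolyR n) : Type := Module.Dual (PolyR n) ↥(DerA f)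

/-- `Ω^p(A)`: the double `R`-dual of the `p`-th exterior power of `Ω¹(A)`. -/
abbrev OmegaP (f : ι → PolyR n) (p : ℕ) : Type :=
  Module.Dual (PolyR n) (Module.Dual (PolyR n) ↥(⋀[PolyR n]^p (OmegaOne f)))

/-- `r(A)`: the smallest integer `r` such that `Ω^p(A) = 0` for all `p > r`. -/
def arrRank (f : ι → PolyR n) : ℕ :=
  sInf {r : ℕ | ∀ p : ℕ, r < p → Subsingleton (OmegaP f p)}

/-- The arrangement `A` is tame if `pd_R(Ω^p(A)) ≤ p` for all `0 ≤ p ≤ r(A)`. -/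
def IsTame (f : ι → PolyR n) : Prop :=
  ∀ p : ℕ, p ≤ arrRank f → ProjDimLE (PolyR n) p (ModuleCat.of (PolyR n) (OmegaP f p))

section ProjectiveDimension

open CategoryTheory TensorProduct

variable {R : Type} [CommRing R]

/-- In a short exact sequence of modules, the quotient has projective dimension at most one more
than the sub and the middle term. -/
lemma hasProjectiveDimensionLT_of_exact_right {M₁ M₂ M₃ : Type}
    [AddCommGroup M₁] [Module R M₁] [AddCommGroup M₂] [Module R M₂] [AddCommGroup M₃] [Module R M₃]
    {f : M₁ →ₗ[R] M₂} {g : M₂ →ₗ[R] M₃} (hf : Function.Injective f) (hg : Function.Surjective g)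
    (hfg : Function.Exact f g) (n : ℕ)
    (h₁ : HasProjectiveDimensionLT (ModuleCat.of R M₁) n)
    (h₂ : HasProjectiveDimensionLT (ModuleCat.of R M₂) (n + 1)) :
    HasProjectiveDimensionLT (ModuleCat.of R M₃) (n + 1) :=
  (ModuleCat.shortComplex_shortExact
    (ModuleCat.shortComplexOfCompEqZero f g hfg.linearMap_comp_eq_zero) hfg hf
    hg).hasProjectiveDimensionLT_X₃ n h₁ h₂

/-- In a short exact sequence of modules, the sub has projective dimension at most that of the
middle term, if the quotient has projective dimension at most one more. -/
lemma hasProjectiveDimensionLT_of_exact_left {M₁ M₂ M₃ : Type}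
    [AddCommGroup M₁] [Module R M₁] [AddCommGroup M₂] [Module R M₂] [AddCommGroup M₃] [Module R M₃]
    {f : M₁ →ₗ[R] M₂} {g : M₂ →ₗ[R] M₃} (hf : Function.Injective f) (hg : Function.Surjective g)
    (hfg : Function.Exact f g) (n : ℕ)
    (h₂ : HasProjectiveDimensionLT (ModuleCat.of R M₂) n)
    (h₃ : HasProjectiveDimensionLT (ModuleCat.of R M₃) (n + 1)) :
    HasProjectiveDimensionLT (ModuleCat.of R M₁) n :=
  (ModuleCat.shortComplex_shortExact
    (ModuleCat.shortComplexOfCompEqZero f g hfg.linearMap_comp_eq_zero) hfg hf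
    hg).hasProjectiveDimensionLT_X₁ n h₂ h₃

lemma hasProjectiveDimensionLT_succ_of_projective (M : Type) [AddCommGroup M] [Module R M]
    [Module.Projective R M] (n : ℕ) : HasProjectiveDimensionLT (ModuleCat.of R M) (n + 1) := by
  have : Projective (ModuleCat.of R M) := (IsProjective.iff_projective M).mp inferInstance
  exact hasProjectiveDimensionLT_of_ge _ 1 _ (by omega)

lemma projective_of_hasProjectiveDimensionLT_one (M : Type) [AddCommGroup M] [Module R M]
    (h : HasProjectiveDimensionLT (ModuleCat.of R M) 1) : Module.Projective R M :=
  (IsProjective.iff_projective M).mpr (projective_iff_hasProjectiveDimensionLT_one.mpr h)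

lemma hasProjectiveDimensionLT_baseChange_of_exact (S : Type) [CommRing S] [Algebra R S]
    [Module.Flat R S] {n : ℕ} {M₁ M₂ M₃ : Type} [AddCommGroup M₁] [Module R M₁]
    [AddCommGroup M₂] [Module R M₂] [AddCommGroup M₃] [Module R M₃]
    {f : M₁ →ₗ[R] M₂} {g : M₂ →ₗ[R] M₃} (hf : Function.Injective f) (hg : Function.Surjective g)
    (hfg : Function.Exact f g)
    (h₁ : HasProjectiveDimensionLT (ModuleCat.of S (S ⊗[R] M₁)) n)
    (h₂ : HasProjectiveDimensionLT (ModuleCat.of S (S ⊗[R] M₂)) (n + 1)) :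
    HasProjectiveDimensionLT (ModuleCat.of S (S ⊗[R] M₃)) (n + 1) :=
  hasProjectiveDimensionLT_of_exact_right (f := f.baseChange S) (g := g.baseChange S)
    (Module.Flat.lTensor_preserves_injective_linearMap f hf)
    (LinearMap.lTensor_surjective S hg) (lTensor_exact S hfg hg) n h₁ h₂

/-- Base change along a flat algebra does not increase the projective dimension. -/
lemma hasProjectiveDimensionLT_baseChange (S : Type) [CommRing S] [Algebra R S]
    [Module.Flat R S] (n : ℕ) (M : Type) [AddCommGroup M] [Module R M]
    (h : HasProjectiveDimensionLT (ModuleCat.of R M) (n + 1)) :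
    HasProjectiveDimensionLT (ModuleCat.of S (S ⊗[R] M)) (n + 1) := by
  induction n generalizing M with
  | zero =>
    have := projective_of_hasProjectiveDimensionLT_one M h
    exact hasProjectiveDimensionLT_succ_of_projective (S ⊗[R] M) 0
  | succ n ih =>
    let p := Finsupp.linearCombination R (id : M → M)
    have hp : Function.Surjective p := Finsupp.linearCombination_id_surjective R M
    have hex : Function.Exact (LinearMap.ker p).subtype p := LinearMap.exact_subtype_ker_map p
    have hK := ih (LinearMap.ker p) (hasProjectiveDimensionLT_of_exact_left
      (Submodule.injective_subtype _) hp hex (n + 1)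
      (hasProjectiveDimensionLT_succ_of_projective _ _) h)
    exact hasProjectiveDimensionLT_baseChange_of_exact S (Submodule.injective_subtype _) hp hex hK
      (hasProjectiveDimensionLT_succ_of_projective _ _)

end ProjectiveDimension

section CharacteristicSequence

open Polynomial TensorProduct

variable {R : Type} [CommRing R] (M : Type) [AddCommGroup M] [Module R M] [Module R[X] M]
  [IsScalarTower R R[X] M]

/-- The action map `R[X] ⊗ M → M` of an `R[X]`-module `M`. -/
def polyAction : R[X] ⊗[R] M →ₗ[R[X]] M :=
  TensorProduct.AlgebraTensorModule.lift
    ((LinearMap.lsmul R[X] M).restrictScalars₁₂ R[X] R)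

/-- Multiplication by `X` as an `R`-linear endomorphism of an `R[X]`-module. -/
def mulX : M →ₗ[R] M := (LinearMap.lsmul R[X] M Polynomial.X).restrictScalars R

/-- The map `p ⊗ m ↦ X p ⊗ m - p ⊗ X m` on `R[X] ⊗ M`. -/
def polyChar : R[X] ⊗[R] M →ₗ[R[X]] R[X] ⊗[R] M :=
  LinearMap.lsmul R[X] _ Polynomial.X - (mulX M).baseChange R[X]

variable {M}

lemma polyAction_tmul (p : R[X]) (m : M) : polyAction M (p ⊗ₜ[R] m) = p • m := rfl

lemma polyChar_tmul (p : R[X]) (m : M) :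
    polyChar M (p ⊗ₜ[R] m) = (Polynomial.X * p) ⊗ₜ[R] m - p ⊗ₜ[R] ((Polynomial.X : R[X]) • m) := rfl

lemma polyAction_surjective : Function.Surjective (polyAction (R := R) M) := fun m =>
  ⟨1 ⊗ₜ m, by rw [polyAction_tmul, one_smul]⟩

lemma sub_one_tmul_mem_range_polyChar (t : R[X] ⊗[R] M) :
    t - 1 ⊗ₜ[R] polyAction M t ∈ LinearMap.range (polyChar (R := R) M) := by
  induction t with
  | zero => simp
  | add a b ha hb =>
    rw [map_add, tmul_add]
    convert add_mem ha hb using 1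
    abel
  | tmul p m =>
    rw [polyAction_tmul]
    induction p using Polynomial.induction_on generalizing m with
    | C a =>
      have : (Polynomial.C a : R[X]) ⊗ₜ[R] m = 1 ⊗ₜ[R] ((Polynomial.C a : R[X]) • m) := by
        rw [← mul_one (Polynomial.C a), ← Polynomial.smul_eq_C_mul, smul_tmul, smul_assoc, one_smul]
      rw [this, sub_self]
      exact zero_mem _
    | add p q hp hq =>
      rw [add_smul, add_tmul, tmul_add]
      convert add_mem (hp m) (hq m) using 1
      abel
    | monomial n a h =>
      have h1 := h ((Polynomial.X : R[X]) • m)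
      have h2 : polyChar M ((Polynomial.C a * Polynomial.X ^ n) ⊗ₜ[R] m) ∈ LinearMap.range (polyChar (R := R) M) :=
        ⟨_, rfl⟩
      rw [polyChar_tmul] at h2
      convert add_mem h1 h2 using 1
      rw [smul_smul, pow_succ, mul_assoc, mul_comm Polynomial.X (Polynomial.C a * Polynomial.X ^ n), mul_assoc]
      abel

lemma polyChar_polyAction_exact :
    Function.Exact (polyChar (R := R) M) (polyAction (R := R) M) := by
  intro t
  constructor
  · intro h
    have := sub_one_tmul_mem_range_polyChar t
    rwa [h, tmul_zero, sub_zero] at this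
  · rintro ⟨u, rfl⟩
    induction u with
    | zero => simp
    | add a b ha hb => rw [map_add, map_add, ha, hb, add_zero]
    | tmul p m =>
      rw [polyChar_tmul, map_sub, polyAction_tmul, polyAction_tmul, smul_smul, mul_comm, sub_self]

lemma polyChar_injective : Function.Injective (polyChar (R := R) M) := by
  rw [injective_iff_map_eq_zero]
  intro t ht
  let e : R[X] ⊗[R] M ≃ₗ[R] ℕ →₀ M :=
    TensorProduct.equivFinsuppOfBasisLeft (Polynomial.basisMonomials R)
  have he : ∀ (p : R[X]) (m : M) (n : ℕ), e (p ⊗ₜ m) n = p.coeff n • m := by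
    intro p m n
    simp only [e, TensorProduct.equivFinsuppOfBasisLeft_apply_tmul]
    rfl
  have key : ∀ (u : R[X] ⊗[R] M) (n : ℕ),
      e (polyChar M u) (n + 1) = e u n - (Polynomial.X : R[X]) • e u (n + 1) := by
    intro u n
    induction u with
    | zero => simp
    | add a b ha hb =>
      simp only [map_add, Finsupp.add_apply, ha, hb, smul_add]
      abel
    | tmul p m =>
      rw [polyChar_tmul, map_sub, Finsupp.sub_apply, he, he, he, he, Polynomial.coeff_X_mul, smul_comm]
  have h0 : ∀ n, e t n = (Polynomial.X : R[X]) • e t (n + 1) := by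
    intro n
    have := key t n
    rw [ht, map_zero, Finsupp.zero_apply] at this
    exact sub_eq_zero.mp this.symm
  have h1 : ∀ k n, e t n = (Polynomial.X : R[X]) ^ k • e t (n + k) := by
    intro k
    induction k with
    | zero => intro n; simp
    | succ k ih =>
      intro n
      rw [ih, h0 (n + k), smul_smul, pow_succ, add_assoc]
  obtain ⟨N, hN⟩ := (e t).support.exists_nat_subset_range
  apply e.injective
  rw [map_zero]
  ext n
  rw [h1 N n, Finsupp.notMem_support_iff.mp, smul_zero, Finsupp.zero_apply]
  intro hmem
  have := Finset.mem_range.mp (hN hmem)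
  omega

end CharacteristicSequence

section Syzygy

open CategoryTheory Polynomial TensorProduct

/-- All modules over `R` have projective dimension at most `d`. -/
def GlobalDimLE (R : Type) [CommRing R] (d : ℕ) : Prop :=
  ∀ (M : Type) [AddCommGroup M] [Module R M],
    HasProjectiveDimensionLT (ModuleCat.of R M) (d + 1)

lemma GlobalDimLE.polynomial {R : Type} [CommRing R] {d : ℕ} (h : GlobalDimLE R d) :
    GlobalDimLE R[X] (d + 1) := by
  intro M _ _
  let : Module R M := Module.compHom M (C : R →+* R[X])
  have : IsScalarTower R R[X] M := ⟨fun r p m => by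
    rw [Polynomial.smul_eq_C_mul, mul_smul]; rfl⟩
  have hT := hasProjectiveDimensionLT_baseChange R[X] d M (h M)
  exact hasProjectiveDimensionLT_of_exact_right polyChar_injective polyAction_surjective
    polyChar_polyAction_exact (d + 1) hT (hasProjectiveDimensionLT_of_ge _ (d + 1) _ (by omega))

attribute [local instance] RingHomInvPair.of_ringEquiv in
lemma GlobalDimLE.of_ringEquiv {R S : Type} [CommRing R] [CommRing S] {d : ℕ}
    (h : GlobalDimLE R d) (e : R ≃+* S) : GlobalDimLE S d := by
  intro M _ _
  let : Module R M := Module.compHom M (e : R →+* S)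
  let e' : M ≃ₛₗ[RingHomClass.toRingHom e] M :=
    { AddEquiv.refl M with map_smul' := fun r m => rfl }
  have : HasProjectiveDimensionLE (ModuleCat.of R M) d := h M
  exact ModuleCat.hasProjectiveDimensionLE_of_semiLinearEquiv (M := ModuleCat.of R M)
    (N := ModuleCat.of S M) e e' d

lemma globalDimLE_field (K : Type) [Field K] : GlobalDimLE K 0 := fun M _ _ =>
  hasProjectiveDimensionLT_succ_of_projective M 0

/-- Hilbert's syzygy theorem, as a bound on projective dimensions. -/
lemma globalDimLE_mvPolynomial (K : Type) [Field K] (n : ℕ) :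
    GlobalDimLE (MvPolynomial (Fin n) K) n := by
  induction n with
  | zero => exact (globalDimLE_field K).of_ringEquiv (isEmptyRingEquiv K (Fin 0)).symm
  | succ n ih => exact ih.polynomial.of_ringEquiv (finSuccEquiv K n).symm.toRingEquiv

/-- Over a Noetherian ring of global dimension at most `d + 2`, the dual of a finite module has
projective dimension at most `d`. -/
lemma GlobalDimLE.dual {R : Type} [CommRing R] [IsNoetherianRing R] {d : ℕ}
    (h : GlobalDimLE R (d + 2)) (M : Type) [AddCommGroup M] [Module R M] [Module.Finite R M] :
    HasProjectiveDimensionLT (ModuleCat.of R (Module.Dual R M)) (d + 1) := by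
  obtain ⟨n, π, hπ⟩ := Module.Finite.exists_fin' R M
  obtain ⟨k, ρ, hρ⟩ := Module.Finite.exists_fin' R (LinearMap.ker π)
  let ρ' : (Fin k → R) →ₗ[R] (Fin n → R) := (LinearMap.ker π).subtype ∘ₗ ρ
  let φ : Module.Dual R (Fin n → R) →ₗ[R] Module.Dual R (Fin k → R) := ρ'.dualMap
  have hex : Function.Exact ρ' π := by
    intro x
    constructor
    · intro hx
      obtain ⟨y, hy⟩ := hρ ⟨x, hx⟩
      exact ⟨y, congrArg Subtype.val hy⟩
    · rintro ⟨y, rfl⟩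
      exact (ρ y).2
  have hinj : Function.Injective π.dualMap := LinearMap.dualMap_injective_of_surjective hπ
  have hexd : Function.Exact π.dualMap φ := by
    intro x
    constructor
    · intro hx
      have hle : LinearMap.ker π ≤ LinearMap.ker x := by
        intro y hy
        obtain ⟨z, rfl⟩ := (hex y).mp hy
        exact LinearMap.congr_fun hx z
      refine ⟨(LinearMap.ker π).liftQ x hle ∘ₗ (π.quotKerEquivOfSurjective hπ).symm, ?_⟩
      refine LinearMap.ext fun y => ?_
      have hy : (π.quotKerEquivOfSurjective hπ).symm (π y) = Submodule.Quotient.mk y := by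
        rw [LinearEquiv.symm_apply_eq]; rfl
      exact congrArg ((LinearMap.ker π).liftQ x hle) hy
    · rintro ⟨y, rfl⟩
      ext z
      exact (congrArg y (hex.apply_apply_eq_zero _)).trans (map_zero y)
  have hI : HasProjectiveDimensionLT (ModuleCat.of R (LinearMap.range φ)) (d + 2) :=
    hasProjectiveDimensionLT_of_exact_left (Submodule.injective_subtype _)
      (Submodule.mkQ_surjective _) (LinearMap.exact_subtype_mkQ _) (d + 2)
      (hasProjectiveDimensionLT_succ_of_projective _ _) (h _)
  refine hasProjectiveDimensionLT_of_exact_left (g := φ.rangeRestrict) hinj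
    φ.surjective_rangeRestrict ?_ (d + 1) (hasProjectiveDimensionLT_succ_of_projective _ _) hI
  intro x
  rw [← hexd x, ← LinearMap.mem_ker, ← LinearMap.mem_ker, LinearMap.ker_rangeRestrict]

lemma projDimLE_of_hasProjectiveDimensionLT {R : Type} [CommRing R] (k : ℕ) (M : Type)
    [AddCommGroup M] [Module R M] (h : HasProjectiveDimensionLT (ModuleCat.of R M) (k + 1)) :
    ProjDimLE R k (ModuleCat.of R M) := by
  induction k generalizing M with
  | zero => exact projective_of_hasProjectiveDimensionLT_one M h
  | succ k ih =>
    have hp := Finsupp.linearCombination_id_surjective R M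
    exact ⟨M, _, hp, ih _ (hasProjectiveDimensionLT_of_exact_left (Submodule.injective_subtype _)
      hp (LinearMap.exact_subtype_ker_map _) (k + 1)
      (hasProjectiveDimensionLT_succ_of_projective _ _) h)⟩

end Syzygy

lemma finite_dual {R : Type} [CommRing R] [IsNoetherianRing R] (M : Type) [AddCommGroup M]
    [Module R M] [Module.Finite R M] : Module.Finite R (Module.Dual R M) :=
  Module.IsNoetherian.finite R (M →ₗ[R] R)

lemma finite_DerA (f : ι → PolyR n) : Module.Finite (PolyR n) (DerA f) := by
  let ev : Derivation ℂ (PolyR n) (PolyR n) →ₗ[PolyR n] (Fin n → PolyR n) :=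
    { toFun := fun θ i => θ (X i)
      map_add' := fun _ _ => rfl
      map_smul' := fun _ _ => rfl }
  have hev : Function.Injective ev := fun θ η h =>
    MvPolynomial.derivation_ext fun i => congrFun h i
  have := isNoetherian_of_injective ev hev
  infer_instance

/-- Every arrangement in three-dimensional affine space is tame. -/
lemma isTame_three (f : ι → PolyR 3) : IsTame f := by
  intro p _
  have := finite_DerA f
  match p with
  | 0 =>
    have : Module.Free (PolyR 3) (⋀[PolyR 3]^0 (OmegaOne f)) :=
      Module.Free.of_equiv (exteriorPower.zeroEquiv (PolyR 3) (OmegaOne f)).symm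
    have : Module.Finite (PolyR 3) (⋀[PolyR 3]^0 (OmegaOne f)) :=
      Module.Finite.equiv (exteriorPower.zeroEquiv (PolyR 3) (OmegaOne f)).symm
    exact inferInstanceAs (Module.Projective (PolyR 3) (OmegaP f 0))
  | q + 1 =>
    have : Module.Finite (PolyR 3) (OmegaOne f) := finite_dual (R := PolyR 3) (DerA f)
    have : Module.Finite (PolyR 3) (⋀[PolyR 3]^(q + 1) (OmegaOne f)) := exteriorPower.instFinite
    have : Module.Finite (PolyR 3) (Module.Dual (PolyR 3) (⋀[PolyR 3]^(q + 1) (OmegaOne f))) :=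
      finite_dual _
    have := (globalDimLE_mvPolynomial ℂ 3).dual (d := 1)
      (Module.Dual (PolyR 3) (⋀[PolyR 3]^(q + 1) (OmegaOne f)))
    exact projDimLE_of_hasProjectiveDimensionLT _ _
      (CategoryTheory.hasProjectiveDimensionLT_of_ge _ 2 _ (by omega))

section LinearForms

variable {B B' : Type} [CommRing B] [Algebra ℂ B] [CommRing B'] [Algebra ℂ B']

/-- The combination `Σ_j v_j b_j` of a family `b` with constant coefficients `v`. -/
def cdot (b : Fin n → B) : (Fin n → ℂ) →ₗ[ℂ] B := Fintype.linearCombination ℂ b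

lemma cdot_apply (b : Fin n → B) (v : Fin n → ℂ) : cdot b v = ∑ j, v j • b j :=
  Fintype.linearCombination_apply ℂ b v

lemma cdot_add (b b' : Fin n → B) (v : Fin n → ℂ) :
    cdot (fun j => b j + b' j) v = cdot b v + cdot b' v := by
  simp [cdot_apply, Finset.sum_add_distrib]

lemma cdot_mul (r : B) (b : Fin n → B) (v : Fin n → ℂ) :
    cdot (fun j => r * b j) v = r * cdot b v := by
  simp [cdot_apply, Finset.mul_sum]

lemma cdot_smul_const (w v : Fin n → ℂ) (r : B) :
    cdot (fun j => w j • r) v = (v ⬝ᵥ w) • r := by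
  simp [cdot_apply, dotProduct, smul_smul, Finset.sum_smul]

lemma map_cdot (φ : B →ₐ[ℂ] B') (b : Fin n → B) (v : Fin n → ℂ) :
    φ (cdot b v) = cdot (fun j => φ (b j)) v := by
  simp [cdot_apply]

lemma pderiv_cdot_X (v : Fin n → ℂ) (k : Fin n) :
    pderiv k (cdot (X : Fin n → PolyR n) v) = C (v k) := by
  simp only [cdot_apply, map_sum, Derivation.map_smul]
  rw [Finset.sum_eq_single k]
  · simp [smul_eq_C_mul]
  · intro j _ hj
    simp [hj]
  · simp

lemma exists_eq_cdot_X {f : PolyR n} (hf : f.IsHomogeneous 1) :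
    ∃ c : Fin n → ℂ, f = cdot X c := by
  have h : f ∈ homogeneousSubmodule (Fin n) ℂ 1 := hf
  rw [homogeneousSubmodule_one_eq_span_X, Submodule.mem_span_range_iff_exists_fun] at h
  obtain ⟨c, hc⟩ := h
  exact ⟨c, by rw [cdot_apply, hc]⟩

lemma mem_logDer_cdot {c : ι → Fin n → ℂ} {a : ι → PolyR n} :
    a ∈ logDer (fun i => cdot (X : Fin n → PolyR n) (c i)) ↔
      ∃ b : Fin n → PolyR n, ∀ i, a i * cdot X (c i) = cdot b (c i) := by
  constructor
  · rintro ⟨b, hb⟩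
    refine ⟨fun j => -b j, fun i => ?_⟩
    have h := hb i
    simp only [pderiv_cdot_X] at h
    rw [cdot_apply (fun j => -b j)]
    simp only [smul_neg, smul_eq_C_mul, Finset.sum_neg_distrib]
    rw [eq_neg_iff_add_eq_zero, ← h]
    congr 1
    exact Finset.sum_congr rfl fun j _ => mul_comm _ _
  · rintro ⟨b, hb⟩
    refine ⟨fun j => -b j, fun i => ?_⟩
    simp only [pderiv_cdot_X, hb i]
    rw [cdot_apply, ← Finset.sum_add_distrib]
    refine Finset.sum_eq_zero fun j _ => ?_
    rw [smul_eq_C_mul]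
    ring

/-- The linear form with coefficient vector `v` in `ℂ[x,s]`. -/
def xlin : (Fin n → ℂ) →ₗ[ℂ] PolyRS n ι := cdot fun j => X (Sum.inl j)

lemma rename_cdot_X (v : Fin n → ℂ) :
    rename Sum.inl (cdot (X : Fin n → PolyR n) v) = (xlin v : PolyRS n ι) := by
  rw [map_cdot]
  simp [xlin]

lemma eval_xlin (x : Fin n → ℂ) (s : ι → ℂ) (v : Fin n → ℂ) :
    eval (Sum.elim x s) (xlin v) = v ⬝ᵥ x := by
  simp [xlin, cdot_apply, dotProduct, smul_eval]

lemma eval_cdot_X (x v : Fin n → ℂ) : eval x (cdot X v) = v ⬝ᵥ x := by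
  simp [cdot_apply, dotProduct, smul_eval]

/-- The ideal generated by the forms `Σ_i a_i s_i` for logarithmic derivations with coefficients
in the big ring `ℂ[x,s]`. -/
def logIdeal (c : ι → Fin n → ℂ) : Ideal (PolyRS n ι) where
  carrier := {g | ∃ (a : ι → PolyRS n ι) (b : Fin n → PolyRS n ι),
    (∀ i, a i * xlin (c i) = cdot b (c i)) ∧ g = ∑ i, a i * X (Sum.inr i)}
  zero_mem' := ⟨0, 0, fun i => by simp [cdot_apply], by simp⟩
  add_mem' := by
    rintro _ _ ⟨a, b, h, rfl⟩ ⟨a', b', h', rfl⟩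
    refine ⟨fun i => a i + a' i, fun j => b j + b' j, fun i => ?_, ?_⟩
    · rw [cdot_add, add_mul, h, h']
    · simp [add_mul, Finset.sum_add_distrib]
  smul_mem' := by
    rintro r _ ⟨a, b, h, rfl⟩
    refine ⟨fun i => r * a i, fun j => r * b j, fun i => ?_, ?_⟩
    · rw [cdot_mul, mul_assoc, h]
    · simp [Finset.mul_sum, mul_assoc]

lemma mem_logIdeal {c : ι → Fin n → ℂ} {g : PolyRS n ι} :
    g ∈ logIdeal c ↔ ∃ (a : ι → PolyRS n ι) (b : Fin n → PolyRS n ι),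
      (∀ i, a i * xlin (c i) = cdot b (c i)) ∧ g = ∑ i, a i * X (Sum.inr i) := Iff.rfl

lemma preLikelihoodIdeal_le_logIdeal (c : ι → Fin n → ℂ) :
    preLikelihoodIdeal (fun i => cdot (X : Fin n → PolyR n) (c i)) ≤ logIdeal c := by
  rw [preLikelihoodIdeal, Ideal.span_le]
  rintro _ ⟨a, ha, rfl⟩
  obtain ⟨b, hb⟩ := mem_logDer_cdot.1 ha
  refine ⟨fun i => rename Sum.inl (a i), fun j => rename Sum.inl (b j), fun i => ?_, rfl⟩
  rw [← rename_cdot_X, ← map_mul, hb, map_cdot]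

/-- View a polynomial in `ℂ[x,s]` as a polynomial in `s` with coefficients in `ℂ[x]`. -/
def toIter : PolyRS n ι →+* MvPolynomial ι (PolyR n) :=
  eval₂Hom (C.comp C) (Sum.elim (fun j => C (X j)) X)

lemma toIter_xlin (v : Fin n → ℂ) :
    toIter (xlin v : PolyRS n ι) = C (cdot X v) := by
  simp only [xlin, cdot_apply, map_sum, smul_eq_C_mul, map_mul]
  simp [toIter]

lemma eval₂Hom_toIter (g : PolyRS n ι) :
    eval₂Hom (rename Sum.inl : PolyR n →ₐ[ℂ] PolyRS n ι).toRingHom (fun i => X (Sum.inr i))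
      (toIter g) = g := by
  have h : (eval₂Hom (rename Sum.inl : PolyR n →ₐ[ℂ] PolyRS n ι).toRingHom
      (fun i => X (Sum.inr i))).comp toIter = RingHom.id (PolyRS n ι) := by
    refine ringHom_ext (fun r => ?_) fun k => ?_
    · rw [RingHom.comp_apply, toIter, eval₂Hom_C, RingHom.comp_apply, eval₂Hom_C]
      exact rename_C _ _
    · rw [RingHom.comp_apply, toIter, eval₂Hom_X']
      cases k with
      | inl j =>
        rw [Sum.elim_inl, eval₂Hom_C]
        exact rename_X _ _
      | inr i => rw [Sum.elim_inr, eval₂Hom_X']; rfl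
  exact congrArg (fun φ => φ g) h

lemma logIdeal_le_preLikelihoodIdeal (c : ι → Fin n → ℂ) :
    logIdeal c ≤ preLikelihoodIdeal (fun i => cdot (X : Fin n → PolyR n) (c i)) := by
  classical
  rintro _ ⟨a, b, h, rfl⟩
  set U : Finset (ι →₀ ℕ) := Finset.univ.biUnion fun i => (toIter (a i)).support with hU
  have key : ∀ i, a i = ∑ α ∈ U, rename Sum.inl (coeff α (toIter (a i))) *
      α.prod fun k e => (X (Sum.inr k) : PolyRS n ι) ^ e := by
    intro i
    conv_lhs => rw [← eval₂Hom_toIter (a i)]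
    rw [coe_eval₂Hom, eval₂_eq']
    rw [← Finset.sum_subset (Finset.subset_biUnion_of_mem (fun i => (toIter (a i)).support)
      (Finset.mem_univ i))]
    · refine Finset.sum_congr rfl fun α _ => ?_
      rw [Finsupp.prod_fintype _ _ (by simp)]
      rfl
    · intro α _ hα
      rw [notMem_support_iff.1 hα, map_zero, zero_mul]
  have hs : ∑ i, a i * X (Sum.inr i) = ∑ α ∈ U,
      (α.prod fun k e => (X (Sum.inr k) : PolyRS n ι) ^ e) *
        ∑ i, rename Sum.inl (coeff α (toIter (a i))) * X (Sum.inr i) := by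
    simp_rw [Finset.mul_sum]
    rw [Finset.sum_comm]
    refine Finset.sum_congr rfl fun i _ => ?_
    conv_lhs => rw [key i, Finset.sum_mul]
    exact Finset.sum_congr rfl fun α _ => by ring
  rw [hs]
  refine Ideal.sum_mem _ fun α _ => Ideal.mul_mem_left _ _ (Ideal.subset_span ⟨_, ?_, rfl⟩)
  refine mem_logDer_cdot.2 ⟨fun j => coeff α (toIter (b j)), fun i => ?_⟩
  have h1 := congrArg (fun p => coeff α (toIter p)) (h i)
  simp only [map_mul, toIter_xlin, mul_comm _ (C (cdot X (c i))), coeff_C_mul] at h1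
  rw [mul_comm, h1, cdot_apply, cdot_apply, map_sum, coeff_sum]
  refine Finset.sum_congr rfl fun j _ => ?_
  have h2 : (toIter (C (c i j) : PolyRS n ι)) = C (C (c i j)) := by simp [toIter]
  rw [smul_eq_C_mul, map_mul, h2, coeff_C_mul, smul_eq_C_mul]

lemma preLikelihoodIdeal_eq_logIdeal (c : ι → Fin n → ℂ) :
    preLikelihoodIdeal (fun i => cdot (X : Fin n → PolyR n) (c i)) = logIdeal c :=
  le_antisymm (preLikelihoodIdeal_le_logIdeal c) (logIdeal_le_preLikelihoodIdeal c)

end LinearForms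

section Elimination

/-- A linearly independent family of vectors has a dual family with respect to the dot product. -/
lemma LinearIndependent.exists_dual_vectors {κ : Type} [Fintype κ] [DecidableEq κ]
    {v : κ → Fin n → ℂ} (hv : LinearIndependent ℂ v) :
    ∃ u : κ → Fin n → ℂ, (∀ r r', v r ⬝ᵥ u r' = if r = r' then 1 else 0) ∧
      ∀ x ∈ Submodule.span ℂ (Set.range v), x = ∑ r, (x ⬝ᵥ u r) • v r := by
  obtain ⟨h, hh⟩ := LinearMap.exists_leftInverse_of_injective (Fintype.linearCombination ℂ v)
    (LinearMap.ker_eq_bot.2 (linearIndependent_iff_injective_fintypeLinearCombination.1 hv))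
  have key : ∀ x r, h x r = x ⬝ᵥ fun j => h (fun i => if j = i then 1 else 0) r := by
    intro x r
    rw [LinearMap.pi_apply_eq_sum_univ h x, Finset.sum_apply]
    rfl
  have hl : ∀ w, h (Fintype.linearCombination ℂ v w) = w := fun w => LinearMap.congr_fun hh w
  refine ⟨fun r j => h (fun i => if j = i then 1 else 0) r, fun r r' => ?_, fun x hx => ?_⟩
  · rw [← key]
    have := hl (Pi.single r 1)
    rw [Fintype.linearCombination_apply_single, one_smul] at this
    rw [this, Pi.single_apply]
    simp [eq_comm]
  · rw [Submodule.mem_span_range_iff_exists_fun] at hx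
    obtain ⟨w, rfl⟩ := hx
    have := hl w
    rw [Fintype.linearCombination_apply] at this
    simp_rw [← key, this]

variable [DecidableEq ι] {c : ι → Fin n → ℂ}

lemma mem_critLocus_cdot {p : (Fin n → ℂ) × (ι → ℂ)} :
    p ∈ critLocus (fun i => cdot (X : Fin n → PolyR n) (c i)) ↔ (∀ i, c i ⬝ᵥ p.1 ≠ 0) ∧
      ∀ j, ∑ i, p.2 i * c i j * ∏ k ∈ Finset.univ.erase i, c k ⬝ᵥ p.1 = 0 := by
  have hj : ∀ x, jacAt (fun i => cdot (X : Fin n → PolyR n) (c i)) x = Matrix.of c := by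
    intro x
    ext i j
    simp [jacAt, pderiv_cdot_X]
  simp only [critLocus, jacMaxRank, hj, ciSup_const, true_and, Set.mem_ofPred_eq, eval_cdot_X,
    pderiv_cdot_X, eval_C]

lemma logIdeal_le_likelihoodIdeal :
    logIdeal c ≤ likelihoodIdeal (fun i => cdot (X : Fin n → PolyR n) (c i)) := by
  rintro _ ⟨a, b, h, rfl⟩ ⟨x, s⟩ hp
  obtain ⟨h0, h1⟩ := mem_critLocus_cdot.1 hp
  simp only at h0 h1 ⊢
  have hF : ∏ k, c k ⬝ᵥ x ≠ 0 := Finset.prod_ne_zero_iff.2 fun k _ => h0 k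
  refine (mul_eq_zero.1 ?_).resolve_left hF
  have h2 : ∀ i, eval (Sum.elim x s) (a i) * (c i ⬝ᵥ x) =
      ∑ j, c i j * eval (Sum.elim x s) (b j) := by
    intro i
    rw [← eval_xlin x s, ← map_mul, h, cdot_apply]
    simp [smul_eval]
  simp only [map_sum, map_mul, eval_X, Sum.elim_inr, Finset.mul_sum]
  calc _ = ∑ i, ∑ j, eval (Sum.elim x s) (b j) *
        (s i * c i j * ∏ k ∈ Finset.univ.erase i, c k ⬝ᵥ x) := by
        refine Finset.sum_congr rfl fun i _ => ?_
        rw [← Finset.mul_prod_erase _ _ (Finset.mem_univ i)]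
        calc _ = (eval (Sum.elim x s) (a i) * (c i ⬝ᵥ x)) *
              (s i * ∏ k ∈ Finset.univ.erase i, c k ⬝ᵥ x) := by ring
          _ = _ := by
            rw [h2, Finset.sum_mul]
            exact Finset.sum_congr rfl fun j _ => by ring
    _ = 0 := by
        rw [Finset.sum_comm]
        simp_rw [← Finset.mul_sum, h1]
        simp

/-- The numerator of the derivative of `Σ_i s_i log f_i` in the direction `w`, as an element of
the ideal `logIdeal c`. -/
lemma sum_smul_mul_prod_mem_logIdeal (w : Fin n → ℂ) :
    ∑ i, (c i ⬝ᵥ w) • ((∏ k ∈ Finset.univ.erase i, xlin (c k)) * X (Sum.inr i) :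
      PolyRS n ι) ∈ logIdeal c := by
  refine ⟨fun i => (c i ⬝ᵥ w) • ∏ k ∈ Finset.univ.erase i, xlin (c k),
    fun j => w j • ∏ k, xlin (c k), fun i => ?_, ?_⟩
  · rw [cdot_smul_const, smul_mul_assoc, Finset.prod_erase_mul _ _ (Finset.mem_univ i)]
  · simp

lemma xlin_mem_supported (E : Set (Fin n ⊕ ι)) (hE : Set.range Sum.inl ⊆ E) (v : Fin n → ℂ) :
    xlin v ∈ supported ℂ E := by
  rw [xlin, cdot_apply]
  exact sum_mem fun j _ => Subalgebra.smul_mem _ (X_mem_supported.2 (hE ⟨j, rfl⟩)) _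

lemma eval_congr_of_mem_supported {E : Set (Fin n ⊕ ι)} {p : PolyRS n ι}
    (hp : p ∈ supported ℂ E) {y z : Fin n ⊕ ι → ℂ} (hyz : ∀ v ∈ E, y v = z v) :
    eval y p = eval z p :=
  eval₂Hom_congr' rfl (fun v hv _ => hyz v (mem_supported.1 hp hv)) rfl

/-- Modulo `logIdeal c` and after multiplying with a power of `∏ L_i`, a maximal independent set of
the variables `s_i` can be eliminated. -/
lemma exists_pow_mul_mem_logIdeal {g : PolyRS n ι}
    (hg : g ∈ likelihoodIdeal (fun i => cdot (X : Fin n → PolyR n) (c i)))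
    (hc : ∀ i, c i ≠ 0) :
    ∃ N, (∏ k, xlin (c k)) ^ N * g ∈ logIdeal c := by
  obtain ⟨κ, a, ha, hspan, hli⟩ := exists_linearIndependent' ℂ c
  have : Finite κ := Finite.of_injective a ha
  have := Fintype.ofFinite κ
  classical
  obtain ⟨u, hu, hx⟩ := hli.exists_dual_vectors
  set F : PolyRS n ι := ∏ k, xlin (c k) with hF
  set E : Set (Fin n ⊕ ι) := {v | ∀ r, v ≠ Sum.inr (a r)} with hE
  have hEl : Set.range Sum.inl ⊆ E := by
    rintro _ ⟨j, rfl⟩ r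
    simp
  set T : Finset ι := Finset.univ.filter fun i => ∀ r, i ≠ a r with hT
  set G : κ → PolyRS n ι := fun r => ∑ i, (c i ⬝ᵥ u r) •
    ((∏ k ∈ Finset.univ.erase i, xlin (c k)) * X (Sum.inr i)) with hG
  set N : κ → PolyRS n ι := fun r => -∑ i ∈ T, xlin (c (a r)) * (c i ⬝ᵥ u r) •
    ((∏ k ∈ Finset.univ.erase i, xlin (c k)) * X (Sum.inr i)) with hN
  have hGN : ∀ r, xlin (c (a r)) * G r = F * X (Sum.inr (a r)) - N r := by
    intro r
    rw [hG, hN]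
    simp only [sub_neg_eq_add]
    rw [← Finset.mul_sum, ← Finset.sum_filter_add_sum_filter_not Finset.univ
      (fun i => ∀ r, i ≠ a r), mul_add, add_comm]
    congr 1
    rw [Finset.sum_eq_single (a r)]
    · have := hu r r
      simp only [Function.comp, if_true] at this
      rw [this, one_smul, ← mul_assoc, Finset.mul_prod_erase _ (fun k => xlin (c k))
        (Finset.mem_univ _)]
    · intro i hi hir
      simp only [Finset.mem_filter, Finset.mem_univ, true_and, not_forall, not_not] at hi
      obtain ⟨r', rfl⟩ := hi
      have := hu r' r
      simp only [Function.comp] at this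
      rw [this, if_neg (fun h => hir (congrArg a h)), zero_smul]
    · intro h
      exact absurd (by simp) h
  have hNs : ∀ r, N r ∈ supported ℂ E := by
    intro r
    refine (supported ℂ E).neg_mem ((supported ℂ E).sum_mem fun i hi =>
      (supported ℂ E).mul_mem (xlin_mem_supported _ hEl _) ((supported ℂ E).smul_mem
        ((supported ℂ E).mul_mem ((supported ℂ E).prod_mem fun k _ => xlin_mem_supported _ hEl _)
          (X_mem_supported.2 ?_)) _))
    intro r
    simp only [hT, Finset.mem_filter, Finset.mem_univ, true_and] at hi
    simpa using hi r
  have hFs : F ∈ supported ℂ E := prod_mem fun k _ => xlin_mem_supported _ hEl _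
  have hmem : ∀ r, F * X (Sum.inr (a r)) - N r ∈ logIdeal c := fun r => by
    rw [← hGN]
    exact Ideal.mul_mem_left _ _ (sum_smul_mul_prod_mem_logIdeal _)
  have elim : ∀ g : PolyRS n ι, ∃ N, ∃ h ∈ supported ℂ E, F ^ N * g - h ∈ logIdeal c := by
    intro g
    induction g using MvPolynomial.induction_on with
    | C r => exact ⟨0, C r, Subalgebra.algebraMap_mem _ r, by simp⟩
    | add p q hp hq =>
      obtain ⟨N₁, h₁, hs₁, hm₁⟩ := hp
      obtain ⟨N₂, h₂, hs₂, hm₂⟩ := hq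
      refine ⟨N₁ + N₂, F ^ N₂ * h₁ + F ^ N₁ * h₂, add_mem (mul_mem (pow_mem hFs _) hs₁)
        (mul_mem (pow_mem hFs _) hs₂), ?_⟩
      have := add_mem (Ideal.mul_mem_left _ (F ^ N₂) hm₁) (Ideal.mul_mem_left _ (F ^ N₁) hm₂)
      convert this using 1
      ring
    | mul_X p v hp =>
      obtain ⟨N₁, h₁, hs₁, hm₁⟩ := hp
      by_cases hv : v ∈ E
      · refine ⟨N₁, h₁ * X v, mul_mem hs₁ (X_mem_supported.2 hv), ?_⟩
        have := Ideal.mul_mem_left _ (X v) hm₁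
        convert this using 1
        ring
      · simp only [hE, Set.mem_ofPred_eq, not_forall, not_not] at hv
        obtain ⟨r, rfl⟩ := hv
        refine ⟨N₁ + 1, h₁ * N r, mul_mem hs₁ (hNs r), ?_⟩
        have := add_mem (Ideal.mul_mem_left _ (F * X (Sum.inr (a r))) hm₁)
          (Ideal.mul_mem_left _ h₁ (hmem r))
        convert this using 1
        ring
  obtain ⟨M, h, hs, hm⟩ := elim g
  refine ⟨M, ?_⟩
  have hF0 : F ≠ 0 := by
    refine Finset.prod_ne_zero_iff.2 fun k _ h => hc k ?_
    funext j
    have := congrArg (eval (Sum.elim (Pi.single j 1) 0)) h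
    rwa [eval_xlin, map_zero, dotProduct_single_one] at this
  have h0 : F * h = 0 := by
    refine MvPolynomial.funext fun y => ?_
    obtain ⟨x, s, rfl⟩ : ∃ x s, y = Sum.elim x s := ⟨_, _, (Sum.elim_comp_inl_inr y).symm⟩
    rw [map_mul, map_zero, mul_eq_zero]
    by_cases hFx : eval (Sum.elim x s) F = 0
    · exact Or.inl hFx
    right
    set s' : ι → ℂ := fun i => if hi : ∃ r, a r = i then
      eval (Sum.elim x s) (N hi.choose) / eval (Sum.elim x s) F else s i with hs'
    have hsE : ∀ v ∈ E, Sum.elim x s v = Sum.elim x s' v := by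
      rintro (j | i) hv
      · rfl
      · have : ¬ ∃ r, a r = i := by
          rintro ⟨r, rfl⟩
          exact hv r rfl
        simp [hs', this]
    have hs'a : ∀ r, s' (a r) = eval (Sum.elim x s) (N r) / eval (Sum.elim x s) F := by
      intro r
      have hr : ∃ r', a r' = a r := ⟨r, rfl⟩
      have : hr.choose = r := ha hr.choose_spec
      simp only [hs', hr, dif_pos, this]
    have hFe : eval (Sum.elim x s) F = ∏ k, c k ⬝ᵥ x := by
      simp [hF, map_prod, eval_xlin]
    have hL : ∀ i, c i ⬝ᵥ x ≠ 0 := by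
      rw [hFe] at hFx
      exact fun i => Finset.prod_ne_zero_iff.1 hFx i (Finset.mem_univ i)
    have hcrit : (x, s') ∈ critLocus (fun i => cdot (X : Fin n → PolyR n) (c i)) := by
      refine mem_critLocus_cdot.2 ⟨hL, fun j => ?_⟩
      have hGr : ∀ r, eval (Sum.elim x s') (G r) = 0 := by
        intro r
        have h1 := congrArg (eval (Sum.elim x s')) (hGN r)
        rw [map_mul, map_sub, map_mul, eval_xlin, eval_X, Sum.elim_inr, hs'a,
          ← eval_congr_of_mem_supported hFs hsE, ← eval_congr_of_mem_supported (hNs r) hsE,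
          mul_div_cancel₀ _ hFx, sub_self] at h1
        exact (mul_eq_zero.1 h1).resolve_left (hL _)
      have hci : ∀ i, c i j = ∑ r, (c i ⬝ᵥ u r) * c (a r) j := by
        intro i
        have := congrFun (hx (c i) (hspan ▸ Submodule.subset_span ⟨i, rfl⟩)) j
        simpa using this
      have : ∑ r, c (a r) j * eval (Sum.elim x s') (G r) = 0 := by simp [hGr]
      rw [← this]
      simp only [hG, map_sum, smul_eval, map_mul, eval_X, Sum.elim_inr, Finset.mul_sum, map_prod,
        eval_xlin]
      rw [Finset.sum_comm]
      refine Finset.sum_congr rfl fun i _ => ?_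
      conv_lhs => rw [hci i, Finset.mul_sum, Finset.sum_mul]
      exact Finset.sum_congr rfl fun r _ => by ring
    have h1 := logIdeal_le_likelihoodIdeal hm _ hcrit
    have h2 := hg _ hcrit
    simp only at h1 h2
    rw [map_sub, map_mul, h2, mul_zero, zero_sub, neg_eq_zero] at h1
    rw [eval_congr_of_mem_supported hs hsE, h1]
  rw [(mul_eq_zero.1 h0).resolve_left hF0, sub_zero] at hm
  exact hm

end Elimination

section Substitution

lemma aeval_sub_mem {σ : Type} {I : Ideal (MvPolynomial σ ℂ)} {h : σ → MvPolynomial σ ℂ}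
    (hI : ∀ v, h v - X v ∈ I) (g : MvPolynomial σ ℂ) : aeval h g - g ∈ I := by
  rw [← Ideal.Quotient.eq]
  have : (Ideal.Quotient.mkₐ ℂ I).comp (aeval h) = Ideal.Quotient.mkₐ ℂ I := by
    refine algHom_ext fun v => ?_
    simpa [Ideal.Quotient.mkₐ_eq_mk, Ideal.Quotient.eq] using hI v
  exact congrArg (fun φ => φ g) this

/-- The substitution `x_j ↦ x_j - h_j`. -/
def shift (h : Fin n → PolyRS n ι) : PolyRS n ι →ₐ[ℂ] PolyRS n ι :=
  aeval (Sum.elim (fun j => X (Sum.inl j) - h j) fun i => X (Sum.inr i))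

lemma shift_X_inr (h : Fin n → PolyRS n ι) (i : ι) :
    shift h (X (Sum.inr i)) = X (Sum.inr i) := by
  simp [shift]

lemma shift_xlin (h : Fin n → PolyRS n ι) (v : Fin n → ℂ) :
    shift h (xlin v) = xlin v - cdot h v := by
  rw [xlin, map_cdot]
  simp [shift, cdot_apply, smul_sub]

lemma shift_sub_mem {I : Ideal (PolyRS n ι)} {h : Fin n → PolyRS n ι} (hI : ∀ j, h j ∈ I)
    (g : PolyRS n ι) : shift h g - g ∈ I := by
  refine aeval_sub_mem (fun v => ?_) g
  cases v with
  | inl j => simpa using hI j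
  | inr i => simp

lemma xlin_eq_zero {v : Fin n → ℂ} : (xlin v : PolyRS n ι) = 0 ↔ v = 0 := by
  refine ⟨fun h => funext fun j => ?_, fun h => by rw [h, map_zero]⟩
  have := congrArg (eval (Sum.elim (Pi.single j 1) 0)) h
  rwa [eval_xlin, map_zero, dotProduct_single_one] at this

lemma exists_dotProduct_eq_one {v : Fin n → ℂ} (hv : v ≠ 0) : ∃ u : Fin n → ℂ, v ⬝ᵥ u = 1 := by
  obtain ⟨j, hj⟩ := Function.ne_iff.1 hv
  exact ⟨Pi.single j (v j)⁻¹, by rw [dotProduct_single, mul_inv_cancel₀ hj]⟩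

/-- The projection along `u` onto the hyperplane given by the linear form `v`. -/
def hypProj (v u : Fin n → ℂ) : PolyRS n ι →ₐ[ℂ] PolyRS n ι :=
  shift fun j => u j • xlin v

lemma hypProj_xlin (v u w : Fin n → ℂ) :
    hypProj v u (xlin w : PolyRS n ι) = xlin (w - (w ⬝ᵥ u) • v) := by
  rw [hypProj, shift_xlin, cdot_smul_const, map_sub, map_smul]

lemma dvd_hypProj_sub (v u : Fin n → ℂ) (g : PolyRS n ι) : xlin v ∣ hypProj v u g - g :=
  Ideal.mem_span_singleton.1 (shift_sub_mem (fun j => by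
    rw [smul_eq_C_mul]
    exact Ideal.mul_mem_left _ _ (Ideal.mem_span_singleton_self _)) g)

lemma hypProj_eq_zero_iff {v u : Fin n → ℂ} (h : v ⬝ᵥ u = 1) {g : PolyRS n ι} :
    hypProj v u g = 0 ↔ xlin v ∣ g := by
  constructor
  · intro h0
    have := dvd_hypProj_sub v u g
    rwa [h0, zero_sub, dvd_neg] at this
  · rintro ⟨k, rfl⟩
    rw [map_mul, hypProj_xlin, h, one_smul, sub_self, map_zero, zero_mul]

lemma prime_xlin {v : Fin n → ℂ} (hv : v ≠ 0) : Prime (xlin v : PolyRS n ι) := by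
  obtain ⟨u, hu⟩ := exists_dotProduct_eq_one hv
  refine ⟨xlin_eq_zero.not.2 hv, fun h => ?_, fun a b hab => ?_⟩
  · have := h.map (eval (Sum.elim (0 : Fin n → ℂ) (0 : ι → ℂ)))
    rw [eval_xlin, dotProduct_zero] at this
    exact not_isUnit_zero this
  · rwa [← hypProj_eq_zero_iff hu, ← hypProj_eq_zero_iff hu, ← mul_eq_zero, ← map_mul,
      hypProj_eq_zero_iff hu]

lemma xlin_dvd_xlin {v w : Fin n → ℂ} (hv : v ≠ 0) :
    (xlin v : PolyRS n ι) ∣ xlin w ↔ ∃ r : ℂ, w = r • v := by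
  obtain ⟨u, hu⟩ := exists_dotProduct_eq_one hv
  constructor
  · rw [← hypProj_eq_zero_iff hu, hypProj_xlin, xlin_eq_zero, sub_eq_zero]
    exact fun h => ⟨_, h⟩
  · rintro ⟨r, rfl⟩
    rw [map_smul, smul_eq_C_mul]
    exact dvd_mul_left _ _

end Substitution

section Numerators

variable [DecidableEq ι]

/-- The form `Σ_{i ∈ T} a_i s_i ∏_{k ∈ T, k ≠ i} e_k` for linear forms `e_k`. -/
def numer (T : Finset ι) (e : ι → Fin n → ℂ) (a : ι → ℂ) : PolyRS n ι :=
  ∑ i ∈ T, a i • (X (Sum.inr i) * ∏ k ∈ T.erase i, xlin (e k))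

lemma map_numer (φ : PolyRS n ι →ₐ[ℂ] PolyRS n ι) (hφ : ∀ i, φ (X (Sum.inr i)) = X (Sum.inr i))
    {T : Finset ι} {e e' : ι → Fin n → ℂ} (he : ∀ i ∈ T, φ (xlin (e i)) = xlin (e' i))
    (a : ι → ℂ) : φ (numer T e a) = numer T e' a := by
  rw [numer, numer, map_sum]
  refine Finset.sum_congr rfl fun i _ => ?_
  rw [map_smul, map_mul, hφ, map_prod]
  congr 2
  exact Finset.prod_congr rfl fun k hk => he k (Finset.mem_of_mem_erase hk)

lemma numer_ne_zero {T : Finset ι} {e : ι → Fin n → ℂ} (he : ∀ i ∈ T, e i ≠ 0) {a : ι → ℂ}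
    {r : ι} (hr : r ∈ T) (har : a r ≠ 0) : numer T e a ≠ 0 := by
  intro h
  have h1 := congrArg (aeval (Sum.elim (fun j => (X (Sum.inl j) : PolyRS n ι))
    (fun i => if i = r then 1 else 0))) h
  have hx : ∀ v, aeval (Sum.elim (fun j => (X (Sum.inl j) : PolyRS n ι))
      (fun i => if i = r then 1 else 0)) (xlin v : PolyRS n ι) = xlin v := by
    intro v
    rw [xlin, map_cdot]
    simp
  rw [numer, map_sum, map_zero, Finset.sum_eq_single r] at h1
  · simp only [map_smul, map_mul, aeval_X, Sum.elim_inr, if_true, map_prod, hx, one_mul] at h1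
    rw [smul_eq_zero, Finset.prod_eq_zero_iff] at h1
    rcases h1 with h1 | ⟨k, hk, h1⟩
    · exact har h1
    · exact he k (Finset.mem_of_mem_erase hk) (xlin_eq_zero.1 h1)
  · intro i _ hi
    simp [hi]
  · exact fun h => absurd hr h

lemma numer_filter (T : Finset ι) (e : ι → Fin n → ℂ) (a : ι → ℂ) :
    numer T e a = (∏ i ∈ T.filter (fun i => a i = 0), xlin (e i)) *
      numer (T.filter fun i => a i ≠ 0) e a := by
  rw [numer, numer, Finset.mul_sum, ← Finset.sum_filter_add_sum_filter_not T (fun i => a i ≠ 0)]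
  rw [add_eq_left.2]
  · refine Finset.sum_congr rfl fun i hi => ?_
    have : T.erase i = T.filter (fun i => a i = 0) ∪ (T.filter fun i => a i ≠ 0).erase i := by
      ext k
      have h2 := (Finset.mem_filter.1 hi).2
      simp only [Finset.mem_erase, Finset.mem_union, Finset.mem_filter]
      constructor
      · rintro ⟨h, h'⟩
        by_cases h0 : a k = 0 <;> simp [h, h', h0]
      · rintro (⟨h, h'⟩ | ⟨h, h', _⟩)
        · exact ⟨fun hk => h2 (hk ▸ h'), h⟩
        · exact ⟨h, h'⟩
    rw [this, Finset.prod_union, mul_smul_comm]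
    · congr 1
      ring
    · rw [Finset.disjoint_left]
      intro k hk hk'
      exact (Finset.mem_filter.1 (Finset.mem_of_mem_erase hk')).2 (Finset.mem_filter.1 hk).2
  · refine Finset.sum_eq_zero fun i hi => ?_
    have := (Finset.mem_filter.1 hi).2
    rw [not_not.1 this, zero_smul]

lemma dvd_numer {T : Finset ι} (e : ι → Fin n → ℂ) {a : ι → ℂ} {i : ι} (hi : i ∈ T)
    (ha : a i = 0) : xlin (e i) ∣ numer T e a := by
  rw [numer_filter]
  exact Dvd.dvd.mul_right (Finset.dvd_prod_of_mem (fun i => xlin (e i))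
    (Finset.mem_filter.2 ⟨hi, ha⟩)) _

lemma pderiv_xlin_inr (p : ι) (v : Fin n → ℂ) : pderiv (Sum.inr p) (xlin v : PolyRS n ι) = 0 := by
  simp [xlin, cdot_apply, Derivation.map_smul]

lemma pderiv_prod_xlin (p : ι) (T : Finset ι) (e : ι → Fin n → ℂ) :
    pderiv (Sum.inr p) (∏ k ∈ T, xlin (e k) : PolyRS n ι) = 0 := by
  induction T using Finset.induction_on with
  | empty => simp
  | insert k T hk ih => rw [Finset.prod_insert hk, Derivation.leibniz, ih, pderiv_xlin_inr]; simp

lemma pderiv_numer {T : Finset ι} (e : ι → Fin n → ℂ) (a : ι → ℂ) {p : ι} (hp : p ∈ T) :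
    pderiv (Sum.inr p) (numer T e a) = a p • ∏ k ∈ T.erase p, xlin (e k) := by
  rw [numer, map_sum, Finset.sum_eq_single p]
  · rw [Derivation.map_smul, Derivation.leibniz, pderiv_prod_xlin, pderiv_X_self]
    simp
  · intro i _ hi
    rw [Derivation.map_smul, Derivation.leibniz, pderiv_prod_xlin, pderiv_X_of_ne]
    · simp
    · simpa using hi
  · exact fun h => absurd hp h

lemma degreeOf_eq_zero_of_pderiv_eq_zero {σ : Type} {p : σ} {g : MvPolynomial σ ℂ}
    (h : pderiv p g = 0) : degreeOf p g = 0 := by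
  classical
  rw [← Nat.le_zero, degreeOf_le_iff]
  intro α hα
  by_contra h0
  have h0 : α p ≠ 0 := by omega
  have h1 := congrArg (coeff (α - Finsupp.single p 1)) h
  rw [coeff_pderiv, coeff_zero] at h1
  have : α - Finsupp.single p 1 + Finsupp.single p 1 = α :=
    tsub_add_cancel_of_le (by simpa using Nat.one_le_iff_ne_zero.2 h0)
  rw [this, mul_eq_zero] at h1
  rcases h1 with h1 | h1
  · exact mem_support_iff.1 hα h1
  · exact Nat.cast_add_one_ne_zero _ h1

lemma pderiv_eq_zero_of_dvd {σ : Type} {p : σ} {d g : MvPolynomial σ ℂ}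
    (hg : g ≠ 0) (h : pderiv p g = 0) (hd : d ∣ g) : pderiv p d = 0 := by
  classical
  obtain ⟨e, rfl⟩ := hd
  have h1 := degreeOf_eq_zero_of_pderiv_eq_zero h
  rw [degreeOf_mul_eq (left_ne_zero_of_mul hg) (right_ne_zero_of_mul hg)] at h1
  refine pderiv_eq_zero_of_notMem_vars ?_
  rw [vars_def, Multiset.mem_toFinset, ← Multiset.count_eq_zero, ← degreeOf_def]
  omega

lemma dvd_prod_of_dvd_numer {T : Finset ι} {e : ι → Fin n → ℂ} {a b : ι → ℂ} {p : ι} (hp : p ∈ T)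
    (ha : a p = 1) (hb : b p = 0) (h0 : numer T e b ≠ 0) {d : PolyRS n ι}
    (hda : d ∣ numer T e a) (hdb : d ∣ numer T e b) : d ∣ ∏ k ∈ T.erase p, xlin (e k) := by
  have hd : pderiv (Sum.inr p) d = 0 :=
    pderiv_eq_zero_of_dvd h0 (by rw [pderiv_numer e b hp, hb, zero_smul]) hdb
  obtain ⟨g, hg⟩ := hda
  have := congrArg (pderiv (Sum.inr p)) hg
  rw [pderiv_numer e a hp, ha, one_smul, Derivation.leibniz, hd, smul_zero, add_zero] at this
  exact ⟨_, this⟩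

/-- A relation between two numerators is, up to a product of linear forms, a Koszul relation. -/
lemma exists_koszul_of_numer {T : Finset ι} {e : ι → Fin n → ℂ} {a b : ι → ℂ} {p : ι} (hp : p ∈ T)
    (ha : a p = 1) (hb : b p = 0) (ha0 : numer T e a ≠ 0) (hb0 : numer T e b ≠ 0)
    {x y : PolyRS n ι} (h : numer T e a * x + numer T e b * y = 0) :
    ∃ k, (∏ k ∈ T.erase p, xlin (e k)) * x = -(k * numer T e b) ∧
      (∏ k ∈ T.erase p, xlin (e k)) * y = k * numer T e a := by
  obtain ⟨a', b', d, hrel, hda, hdb⟩ :=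
    UniqueFactorizationMonoid.exists_reduced_factors _ ha0 (numer T e b)
  obtain ⟨g, hg⟩ := dvd_prod_of_dvd_numer hp ha hb hb0 ⟨a', hda.symm⟩ ⟨b', hdb.symm⟩
  have hd0 : d ≠ 0 := by
    rintro rfl
    exact ha0 (by rw [← hda, zero_mul])
  have ha'0 : a' ≠ 0 := by
    rintro rfl
    exact ha0 (by rw [← hda, mul_zero])
  have h1 : a' * x + b' * y = 0 := by
    refine (mul_eq_zero.1 ?_).resolve_left hd0
    rw [← h, ← hda, ← hdb]
    ring
  obtain ⟨k, hk⟩ : a' ∣ y :=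
    hrel.dvd_of_dvd_mul_left ⟨-x, by linear_combination h1⟩
  have hx : x = -(b' * k) := by
    have : a' * (x + b' * k) = 0 := by
      rw [← h1, hk]
      ring
    linear_combination (mul_eq_zero.1 this).resolve_left ha'0
  refine ⟨g * k, ?_, ?_⟩
  · rw [hg, hx, ← hdb]
    ring
  · rw [hg, hk, ← hda]
    ring

end Numerators

section Descent

variable [DecidableEq ι] {c : ι → Fin n → ℂ} {o : ι}

lemma numer_smul_sub_smul (T : Finset ι) (e : ι → Fin n → ℂ) (c : ι → Fin n → ℂ)
    (w₁ w₂ : Fin n → ℂ) (r₁ r₂ : ℂ) :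
    numer T e (fun i => c i ⬝ᵥ (r₁ • w₁ - r₂ • w₂)) =
      r₁ • numer T e (fun i => c i ⬝ᵥ w₁) - r₂ • numer T e (fun i => c i ⬝ᵥ w₂) := by
  simp only [numer, Finset.smul_sum, ← Finset.sum_sub_distrib, dotProduct_sub, dotProduct_smul,
    sub_smul, smul_smul, smul_eq_mul]

lemma ne_zero_of_nonprop [Nontrivial ι] (hprop : ∀ i j, i ≠ j → ∀ r : ℂ, c i ≠ r • c j) (i : ι) :
    c i ≠ 0 := by
  obtain ⟨j, hj⟩ := exists_ne i
  simpa using hprop i j hj.symm 0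

lemma linearIndependent_of_nonprop [Nontrivial ι]
    (hprop : ∀ i j, i ≠ j → ∀ r : ℂ, c i ≠ r • c j) {i j : ι} (hij : i ≠ j) :
    LinearIndependent ℂ ![c i, c j] := by
  rw [LinearIndependent.pair_iff' (ne_zero_of_nonprop hprop i)]
  exact fun r h => hprop j i hij.symm r h.symm

lemma descent_step [Nontrivial ι] (hprop : ∀ i j, i ≠ j → ∀ r : ℂ, c i ≠ r • c j)
    {l r : ι} (hl : l ≠ o)
    {w : Fin n → ℂ} (how : c o ⬝ᵥ w = 0) (hlw : c l ⬝ᵥ w = 0) (hrw : c r ⬝ᵥ w ≠ 0)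
    {z τ : ι → PolyRS n ι} (hτ : τ l = numer (Finset.univ.erase o) c fun i => c i ⬝ᵥ w)
    (hz : ∏ i ∈ (Finset.univ.erase o).filter (fun i => c i ⬝ᵥ w = 0), xlin (c i) ∣ z l)
    {k : PolyRS n ι} (hk : ∀ i, xlin (c o) ∣ xlin (c l) * z i - k * τ i) :
    ∃ k', ∀ i, xlin (c o) ∣ z i - k' * τ i := by
  have hnd : ∀ i, i ≠ o → ¬ (xlin (c o) : PolyRS n ι) ∣ xlin (c i) := by
    intro i hi h
    obtain ⟨a, ha⟩ := (xlin_dvd_xlin (ne_zero_of_nonprop hprop o)).1 h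
    exact hprop i o hi a ha
  have hop : Prime (xlin (c o) : PolyRS n ι) := prime_xlin (ne_zero_of_nonprop hprop o)
  obtain ⟨u, hu, -⟩ := (linearIndependent_of_nonprop hprop hl.symm).exists_dual_vectors
  have huo := hu 0 0
  have huo' := hu 0 1
  have hul := hu 1 0
  have hul' := hu 1 1
  simp only [Matrix.cons_val_zero, Matrix.cons_val_one, if_true, zero_ne_one, one_ne_zero,
    if_false] at huo huo' hul hul'
  set χ : PolyRS n ι →ₐ[ℂ] PolyRS n ι :=
    shift fun j => u 0 j • xlin (c o) + u 1 j • xlin (c l) with hχ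
  have hχx : ∀ v, χ (xlin v) = xlin (v - (v ⬝ᵥ u 0) • c o - (v ⬝ᵥ u 1) • c l) := by
    intro v
    rw [hχ, shift_xlin, cdot_add, cdot_smul_const, cdot_smul_const]
    simp only [map_sub, map_smul]
    ring
  have hχo : χ (xlin (c o)) = 0 := by rw [hχx, huo, huo']; simp
  have hχl : χ (xlin (c l)) = 0 := by rw [hχx, hul, hul']; simp
  set T := (Finset.univ.erase o).filter fun i => c i ⬝ᵥ w ≠ 0 with hT
  obtain ⟨y, hy⟩ := hz
  have h1 := hk l
  rw [hy, hτ, numer_filter] at h1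
  have h2 : xlin (c o) ∣ xlin (c l) * y - k * numer T c fun i => c i ⬝ᵥ w := by
    refine (hop.dvd_or_dvd (a := ∏ i ∈ (Finset.univ.erase o).filter (fun i => c i ⬝ᵥ w = 0),
      xlin (c i)) ?_).resolve_left fun h => ?_
    · convert h1 using 1
      ring
    · obtain ⟨i, hi, hi'⟩ := hop.exists_mem_finset_dvd h
      exact hnd i (Finset.ne_of_mem_erase (Finset.mem_filter.1 hi).1) hi'
  obtain ⟨m, hm⟩ := h2
  have h3 := congrArg χ hm
  have hro : r ≠ o := by
    rintro rfl
    exact hrw how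
  rw [map_sub, map_mul, map_mul, map_mul, hχo, hχl, zero_mul, zero_mul, zero_sub, neg_eq_zero,
    map_numer χ (shift_X_inr _) (fun i _ => hχx (c i)), mul_eq_zero] at h3
  have h4 : χ k = 0 := by
    refine h3.resolve_right (numer_ne_zero (fun i hi h0 => ?_) (r := r) ?_ hrw)
    · refine (Finset.mem_filter.1 hi).2 ?_
      rw [sub_sub, sub_eq_zero] at h0
      rw [h0, add_dotProduct, smul_dotProduct, smul_dotProduct, how, hlw]
      simp
    · simp [hT, hro, hrw]
  have h5 : χ k - k ∈ Ideal.span {xlin (c o), xlin (c l)} := by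
    refine shift_sub_mem (fun j => ?_) k
    rw [smul_eq_C_mul, smul_eq_C_mul]
    exact Ideal.mem_span_pair.2 ⟨_, _, rfl⟩
  rw [h4, zero_sub, neg_mem_iff, Ideal.mem_span_pair] at h5
  obtain ⟨a, b, hab⟩ := h5
  refine ⟨b, fun i => (hop.dvd_or_dvd (a := xlin (c l)) ?_).resolve_left (hnd l hl)⟩
  have h6 : xlin (c l) * (z i - b * τ i) = (xlin (c l) * z i - k * τ i) +
      xlin (c o) * (a * τ i) := by
    rw [← hab]
    ring
  rw [h6]
  exact dvd_add (hk i) (dvd_mul_right _ _)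

lemma descent [Nontrivial ι] (hprop : ∀ i j, i ≠ j → ∀ r : ℂ, c i ≠ r • c j)
    {t τ : ι → PolyRS n ι} (w : ι → Fin n → ℂ) (T : Finset ι)
    (hT : ∀ l ∈ T, l ≠ o ∧ c o ⬝ᵥ w l = 0 ∧ c l ⬝ᵥ w l = 0 ∧ (∃ r, c r ⬝ᵥ w l ≠ 0) ∧
      (τ l = numer (Finset.univ.erase o) c fun i => c i ⬝ᵥ w l) ∧
      ∏ i ∈ (Finset.univ.erase o).filter (fun i => c i ⬝ᵥ w l = 0), xlin (c i) ∣ t l)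
    {k : PolyRS n ι} (hk : ∀ i, xlin (c o) ∣ (∏ l ∈ T, xlin (c l)) * t i - k * τ i) :
    ∃ k', ∀ i, xlin (c o) ∣ t i - k' * τ i := by
  induction T using Finset.induction_on generalizing k with
  | empty => exact ⟨k, by simpa using hk⟩
  | insert l T hlT ih =>
    obtain ⟨hl, how, hlw, ⟨r, hr⟩, hτ, hz⟩ := hT l (Finset.mem_insert_self _ _)
    obtain ⟨k', hk'⟩ := descent_step hprop (z := fun i => (∏ l ∈ T, xlin (c l)) * t i) hl how hlw
      hr hτ (hz.mul_left _) (k := k) (fun i => by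
        have := hk i
        rwa [Finset.prod_insert hlT, mul_assoc] at this)
    exact ih (fun l hl => hT l (Finset.mem_insert_of_mem hl)) hk'

end Descent

section Quotient

variable [DecidableEq ι] {c : ι → Fin n → ℂ} {o : ι}

/-- In rank three, the logarithmic derivations whose contraction with `s` is divisible by `L_o` are,
modulo `L_o`, multiples of a single one. -/
lemma exists_quotient_koszul [Nontrivial ι] (hprop : ∀ i j, i ≠ j → ∀ r : ℂ, c i ≠ r • c j)
    {p q : ι} {w₁ w₂ : Fin n → ℂ} (ho₁ : c o ⬝ᵥ w₁ = 0) (ho₂ : c o ⬝ᵥ w₂ = 0)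
    (hp₁ : c p ⬝ᵥ w₁ = 1) (hp₂ : c p ⬝ᵥ w₂ = 0) (hq₁ : c q ⬝ᵥ w₁ = 0) (hq₂ : c q ⬝ᵥ w₂ = 1)
    (hexp : ∀ i, ∃ γ : ℂ, c i = γ • c o + (c i ⬝ᵥ w₁) • c p + (c i ⬝ᵥ w₂) • c q)
    {t : ι → PolyRS n ι} (ht : ∀ i, t i = (c i ⬝ᵥ w₁) • t p + (c i ⬝ᵥ w₂) • t q)
    (hLt : ∀ i, xlin (c i) ∣ t i)
    (hdvd : xlin (c o) ∣ numer (Finset.univ.erase o) c (fun i => c i ⬝ᵥ w₁) * t p +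
      numer (Finset.univ.erase o) c (fun i => c i ⬝ᵥ w₂) * t q) :
    ∃ k, ∀ i, xlin (c o) ∣ t i - k * numer (Finset.univ.erase o) c
      fun j => c j ⬝ᵥ ((c i ⬝ᵥ w₂) • w₁ - (c i ⬝ᵥ w₁) • w₂) := by
  set T : Finset ι := Finset.univ.erase o with hT
  have hpo : p ≠ o := by
    rintro rfl
    exact one_ne_zero (hp₁.symm.trans ho₁)
  have hqo : q ≠ o := by
    rintro rfl
    exact one_ne_zero (hq₂.symm.trans ho₂)
  have hpT : p ∈ T := Finset.mem_erase.2 ⟨hpo, Finset.mem_univ _⟩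
  have hqT : q ∈ T := Finset.mem_erase.2 ⟨hqo, Finset.mem_univ _⟩
  have hne : ∀ i, i ≠ o → c i ⬝ᵥ w₁ ≠ 0 ∨ c i ⬝ᵥ w₂ ≠ 0 := by
    intro i hi
    by_contra! h
    obtain ⟨γ, hγ⟩ := hexp i
    rw [h.1, h.2, zero_smul, zero_smul, add_zero, add_zero] at hγ
    exact hprop i o hi γ hγ
  obtain ⟨u, hu⟩ := exists_dotProduct_eq_one (ne_zero_of_nonprop hprop o)
  set e : ι → Fin n → ℂ := fun i => c i - (c i ⬝ᵥ u) • c o with he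
  have he0 : ∀ i ∈ T, e i ≠ 0 := by
    intro i hi h
    exact hprop i o (Finset.ne_of_mem_erase hi) _ (sub_eq_zero.1 h)
  set ψ : PolyRS n ι →ₐ[ℂ] PolyRS n ι := hypProj (c o) u with hψ
  have hψn : ∀ a, ψ (numer T c a) = numer T e a :=
    map_numer ψ (shift_X_inr _) fun i _ => hypProj_xlin (c o) u (c i)
  set A := numer T c (fun i => c i ⬝ᵥ w₁) with hA
  set B := numer T c (fun i => c i ⬝ᵥ w₂) with hB
  have h1 := (hypProj_eq_zero_iff hu).2 hdvd
  rw [← hψ, map_add, map_mul, map_mul, hψn, hψn] at h1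
  obtain ⟨k, hk₁, hk₂⟩ := exists_koszul_of_numer hpT hp₁ hp₂
    (numer_ne_zero he0 hpT (hp₁.trans_ne one_ne_zero))
    (numer_ne_zero he0 hqT (hq₂.trans_ne one_ne_zero)) h1
  have hG : ψ (∏ k ∈ T.erase p, xlin (c k)) = ∏ k ∈ T.erase p, xlin (e k) := by
    rw [map_prod]
    exact Finset.prod_congr rfl fun i _ => hypProj_xlin (c o) u (c i)
  rw [← hG, ← map_mul, ← hψn] at hk₁ hk₂
  set F : PolyRS n ι := ∏ k ∈ T.erase p, xlin (c k) with hF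
  have hd := dvd_hypProj_sub (ι := ι) (c o) u
  have hx : xlin (c o) ∣ F * t p + k * B := by
    have : F * t p + k * B = k * -(ψ B - B) - (ψ (F * t p) - F * t p) := by
      rw [hk₁]
      ring
    rw [this]
    exact dvd_sub ((hd B).neg_right.mul_left _) (hd _)
  have hy : xlin (c o) ∣ F * t q - k * A := by
    have : F * t q - k * A = k * (ψ A - A) - (ψ (F * t q) - F * t q) := by
      rw [hk₂]
      ring
    rw [this]
    exact dvd_sub ((hd A).mul_left _) (hd _)
  refine descent hprop (fun l => (c l ⬝ᵥ w₂) • w₁ - (c l ⬝ᵥ w₁) • w₂) (T.erase p)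
    (fun l hl => ?_) (k := k) (fun i => ?_)
  · have hlo : l ≠ o := Finset.ne_of_mem_erase (Finset.mem_of_mem_erase hl)
    refine ⟨hlo, ?_, ?_, ?_, rfl, ?_⟩
    · simp [dotProduct_sub, ho₁, ho₂]
    · simp only [dotProduct_sub, dotProduct_smul, smul_eq_mul]
      ring
    · rcases hne l hlo with h | h
      · refine ⟨q, ?_⟩
        simpa [dotProduct_sub, hq₁, hq₂] using h
      · refine ⟨p, ?_⟩
        simpa [dotProduct_sub, hp₁, hp₂] using h
    · refine Finset.prod_dvd_of_isRelPrime (fun i hi j hj hij => ?_) fun i hi => ?_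
      · refine ((prime_xlin (ne_zero_of_nonprop hprop i)).irreducible.isRelPrime_iff_not_dvd).2
          fun h => ?_
        obtain ⟨r, hr⟩ := (xlin_dvd_xlin (ne_zero_of_nonprop hprop i)).1 h
        exact hprop j i (Ne.symm hij) r hr
      · obtain ⟨hi, hi'⟩ := Finset.mem_filter.1 hi
        have hio : i ≠ o := Finset.ne_of_mem_erase hi
        simp only [dotProduct_sub, dotProduct_smul, smul_eq_mul] at hi'
        have key : ∀ r r' : ℂ, r ≠ 0 → r • t l = r' • t i → xlin (c i) ∣ t l := by
          intro r r' hr h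
          have : t l = C (r⁻¹ * r') * t i := by
            rw [← smul_eq_C_mul, mul_smul, ← h, smul_smul, inv_mul_cancel₀ hr, one_smul]
          rw [this]
          exact (hLt i).mul_left _
        rcases hne i hio with h | h
        · refine key _ (c l ⬝ᵥ w₁) h ?_
          rw [ht l, ht i]
          simp only [smul_add, smul_smul]
          congr 2
          · ring
          · linear_combination hi'
        · refine key _ (c l ⬝ᵥ w₂) h ?_
          rw [ht l, ht i]
          simp only [smul_add, smul_smul]
          congr 2
          · linear_combination -hi'
          · ring
  · rw [numer_smul_sub_smul, ht i]
    have : F * ((c i ⬝ᵥ w₁) • t p + (c i ⬝ᵥ w₂) • t q) - k * ((c i ⬝ᵥ w₂) • A - (c i ⬝ᵥ w₁) • B) =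
        C (c i ⬝ᵥ w₁) * (F * t p + k * B) + C (c i ⬝ᵥ w₂) * (F * t q - k * A) := by
      simp only [smul_eq_C_mul]
      ring
    rw [this]
    exact dvd_add (hx.mul_left _) (hy.mul_left _)

lemma exists_mul_eq_of_dvd [Nontrivial ι] (hprop : ∀ i j, i ≠ j → ∀ r : ℂ, c i ≠ r • c j)
    {w₁ w₂ : Fin n → ℂ} {a : ι → PolyRS n ι} (hao : a o = 0) {x y : PolyRS n ι}
    (ha : ∀ i, a i * xlin (c i) = (c i ⬝ᵥ w₁) • x + (c i ⬝ᵥ w₂) • y)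
    (hx : xlin (c o) ∣ x) (hy : xlin (c o) ∣ y) :
    ∃ g ∈ logIdeal c, ∑ i, a i * X (Sum.inr i) = xlin (c o) * g := by
  obtain ⟨x, rfl⟩ := hx
  obtain ⟨y, rfl⟩ := hy
  have h0 : (xlin (c o) : PolyRS n ι) ≠ 0 := xlin_eq_zero.not.2 (ne_zero_of_nonprop hprop o)
  have ha' : ∀ i, a i * xlin (c i) = xlin (c o) * ((c i ⬝ᵥ w₁) • x + (c i ⬝ᵥ w₂) • y) := by
    intro i
    rw [ha i, mul_add, mul_smul_comm, mul_smul_comm]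
  have hdvd : ∀ i, xlin (c o) ∣ a i := by
    intro i
    by_cases hi : i = o
    · rw [hi, hao]
      exact dvd_zero _
    · refine ((prime_xlin (ne_zero_of_nonprop hprop o)).dvd_or_dvd
        (Dvd.intro _ (ha' i).symm)).resolve_right fun h => ?_
      obtain ⟨r, hr⟩ := (xlin_dvd_xlin (ne_zero_of_nonprop hprop o)).1 h
      exact hprop i o hi r hr
  choose e he using hdvd
  refine ⟨∑ i, e i * X (Sum.inr i), ⟨e, fun j => w₁ j • x + w₂ j • y, fun i => ?_, rfl⟩, ?_⟩
  · rw [cdot_add, cdot_smul_const, cdot_smul_const]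
    refine mul_left_cancel₀ h0 ?_
    rw [← ha' i, he i, mul_assoc]
  · rw [Finset.mul_sum]
    exact Finset.sum_congr rfl fun i _ => by rw [he i, mul_assoc]

lemma prod_mul_sum_eq {a : ι → PolyRS n ι} (hao : a o = 0) :
    (∏ k ∈ Finset.univ.erase o, xlin (c k)) * ∑ i, a i * X (Sum.inr i) =
      ∑ i ∈ Finset.univ.erase o, a i * xlin (c i) *
        (X (Sum.inr i) * ∏ k ∈ (Finset.univ.erase o).erase i, xlin (c k)) := by
  rw [← Finset.add_sum_erase _ _ (Finset.mem_univ o), hao, zero_mul, zero_add, Finset.mul_sum]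
  refine Finset.sum_congr rfl fun i hi => ?_
  rw [← Finset.mul_prod_erase _ _ hi]
  ring

lemma sum_mul_eq_numer (T : Finset ι) (e : ι → Fin n → ℂ) (α β : ι → ℂ) (x y : PolyRS n ι) :
    ∑ i ∈ T, (α i • x + β i • y) * (X (Sum.inr i) * ∏ k ∈ T.erase i, xlin (e k)) =
      numer T e α * x + numer T e β * y := by
  rw [numer, numer, Finset.sum_mul, Finset.sum_mul, ← Finset.sum_add_distrib]
  refine Finset.sum_congr rfl fun i _ => ?_
  simp only [smul_eq_C_mul]
  ring

/-- The non-zero-divisor property for derivations annihilating `f_o`. -/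
lemma exists_mem_logIdeal_of_dvd [Nontrivial ι] (h3 : n = 3)
    (hprop : ∀ i j, i ≠ j → ∀ r : ℂ, c i ≠ r • c j)
    {a : ι → PolyRS n ι} (hao : a o = 0) {b : Fin n → PolyRS n ι}
    (hab : ∀ i, a i * xlin (c i) = cdot b (c i)) {g : PolyRS n ι}
    (hg : ∑ i, a i * X (Sum.inr i) = xlin (c o) * g) : g ∈ logIdeal c := by
  have h0 : (xlin (c o) : PolyRS n ι) ≠ 0 := xlin_eq_zero.not.2 (ne_zero_of_nonprop hprop o)
  have hop : Prime (xlin (c o) : PolyRS n ι) := prime_xlin (ne_zero_of_nonprop hprop o)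
  have hto : cdot b (c o) = 0 := by rw [← hab, hao, zero_mul]
  suffices h : ∃ g' ∈ logIdeal c, ∑ i, a i * X (Sum.inr i) = xlin (c o) * g' by
    obtain ⟨g', hg', h⟩ := h
    rw [mul_left_cancel₀ h0 (hg.symm.trans h)]
    exact hg'
  obtain ⟨p, hpo⟩ := exists_ne o
  have hli := linearIndependent_of_nonprop hprop hpo.symm
  by_cases hq : ∃ q, c q ∉ Submodule.span ℂ (Set.range ![c o, c p])
  · obtain ⟨q, hq⟩ := hq
    have hli3 : LinearIndependent ℂ (Fin.snoc ![c o, c p] (c q) : Fin 3 → Fin n → ℂ) :=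
      linearIndependent_finSnoc.2 ⟨hli, hq⟩
    obtain ⟨u, hu, hexp⟩ := hli3.exists_dual_vectors
    have hspan : Submodule.span ℂ (Set.range (Fin.snoc ![c o, c p] (c q) : Fin 3 → Fin n → ℂ))
        = ⊤ := hli3.span_eq_top_of_card_eq_finrank' (by simp [h3])
    have hs0 : (Fin.snoc ![c o, c p] (c q) : Fin 3 → Fin n → ℂ) 0 = c o := rfl
    have hs1 : (Fin.snoc ![c o, c p] (c q) : Fin 3 → Fin n → ℂ) 1 = c p := rfl
    have hs2 : (Fin.snoc ![c o, c p] (c q) : Fin 3 → Fin n → ℂ) 2 = c q := rfl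
    have ho₁ : c o ⬝ᵥ u 1 = 0 := by rw [← hs0, hu]; simp
    have ho₂ : c o ⬝ᵥ u 2 = 0 := by rw [← hs0, hu]; simp
    have hp₁ : c p ⬝ᵥ u 1 = 1 := by rw [← hs1, hu]; simp
    have hp₂ : c p ⬝ᵥ u 2 = 0 := by rw [← hs1, hu]; simp
    have hq₁ : c q ⬝ᵥ u 1 = 0 := by rw [← hs2, hu]; simp
    have hq₂ : c q ⬝ᵥ u 2 = 1 := by rw [← hs2, hu]; simp
    have hexp' : ∀ i, c i = (c i ⬝ᵥ u 0) • c o + (c i ⬝ᵥ u 1) • c p + (c i ⬝ᵥ u 2) • c q := by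
      intro i
      have := hexp (c i) (hspan ▸ Submodule.mem_top)
      rwa [Fin.sum_univ_three, hs0, hs1, hs2] at this
    have ht : ∀ i, cdot b (c i) = (c i ⬝ᵥ u 1) • cdot b (c p) + (c i ⬝ᵥ u 2) • cdot b (c q) := by
      intro i
      conv_lhs => rw [hexp' i]
      rw [map_add, map_add, map_smul, map_smul, map_smul, hto, smul_zero, zero_add]
    set T : Finset ι := Finset.univ.erase o with hT
    set A := numer T c (fun i => c i ⬝ᵥ u 1) with hA
    set B := numer T c (fun i => c i ⬝ᵥ u 2) with hB
    obtain ⟨k, hk⟩ := exists_quotient_koszul hprop ho₁ ho₂ hp₁ hp₂ hq₁ hq₂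
      (fun i => ⟨_, hexp' i⟩) ht (fun i => ⟨a i, by rw [← hab, mul_comm]⟩) (by
        rw [← sum_mul_eq_numer]
        simp_rw [← ht, ← hab]
        rw [← prod_mul_sum_eq hao, hg]
        exact (dvd_mul_right _ _).mul_left _)
    set τ : ι → PolyRS n ι := fun i =>
      numer T c fun j => c j ⬝ᵥ ((c i ⬝ᵥ u 2) • u 1 - (c i ⬝ᵥ u 1) • u 2) with hτ
    have hτeq : ∀ i, τ i = (c i ⬝ᵥ u 2) • A - (c i ⬝ᵥ u 1) • B := fun i =>
      numer_smul_sub_smul _ _ _ _ _ _ _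
    have hτd : ∀ i, ∃ a', a' * xlin (c i) = τ i ∧ (i = o → a' = 0) := by
      intro i
      by_cases hi : i = o
      · refine ⟨0, ?_, fun _ => rfl⟩
        rw [hτeq, hi, ho₁, ho₂]
        simp
      · have : xlin (c i) ∣ τ i := by
          refine dvd_numer c (Finset.mem_erase.2 ⟨hi, Finset.mem_univ _⟩) ?_
          simp only [dotProduct_sub, dotProduct_smul, smul_eq_mul]
          ring
        obtain ⟨a', ha'⟩ := this
        exact ⟨a', by rw [ha', mul_comm], fun h => absurd h hi⟩
    choose aτ haτ haτo using hτd
    have hsum : ∑ i, aτ i * X (Sum.inr i) = 0 := by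
      have hP : (∏ k ∈ T, xlin (c k) : PolyRS n ι) ≠ 0 :=
        Finset.prod_ne_zero_iff.2 fun k _ => xlin_eq_zero.not.2 (ne_zero_of_nonprop hprop k)
      refine (mul_eq_zero.1 ?_).resolve_left hP
      rw [prod_mul_sum_eq (haτo o rfl)]
      simp_rw [haτ, hτeq]
      have := sum_mul_eq_numer T c (fun i => c i ⬝ᵥ u 1) (fun i => c i ⬝ᵥ u 2) (-B) A
      rw [← hA, ← hB] at this
      rw [show (0 : PolyRS n ι) = A * -B + B * A by ring, ← this]
      refine Finset.sum_congr rfl fun i _ => ?_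
      rw [smul_neg]
      ring
    have hk₁ : xlin (c o) ∣ cdot b (c p) + k * B := by
      have : τ p = -B := by rw [hτeq, hp₁, hp₂]; simp
      have h := hk p
      rwa [show (numer T c fun j => c j ⬝ᵥ ((c p ⬝ᵥ u 2) • u 1 - (c p ⬝ᵥ u 1) • u 2)) = -B
        from this, mul_neg, sub_neg_eq_add] at h
    have hk₂ : xlin (c o) ∣ cdot b (c q) - k * A := by
      have : τ q = A := by rw [hτeq, hq₁, hq₂]; simp
      have h := hk q
      rwa [show (numer T c fun j => c j ⬝ᵥ ((c q ⬝ᵥ u 2) • u 1 - (c q ⬝ᵥ u 1) • u 2)) = A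
        from this] at h
    obtain ⟨g', hg', h⟩ := exists_mul_eq_of_dvd hprop (w₁ := u 1) (w₂ := u 2)
      (a := fun i => a i - k * aτ i)
      (by simp [hao, haτo o rfl]) (fun i => by
        rw [sub_mul, hab, mul_assoc, haτ, hτeq, ht]
        simp only [smul_eq_C_mul]
        ring) hk₁ hk₂
    refine ⟨g', hg', ?_⟩
    rw [← h]
    simp_rw [sub_mul, Finset.sum_sub_distrib, mul_assoc, ← Finset.mul_sum, hsum]
    simp
  · push Not at hq
    obtain ⟨u, hu, hexp⟩ := hli.exists_dual_vectors
    have huo := hu 0 1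
    have hup := hu 1 1
    simp only [Matrix.cons_val_zero, Matrix.cons_val_one, if_true, zero_ne_one,
      if_false] at huo hup
    have ht : ∀ i, cdot b (c i) = (c i ⬝ᵥ u 1) • cdot b (c p) := by
      intro i
      have := hexp (c i) (hq i)
      rw [Fin.sum_univ_two, Matrix.cons_val_zero, Matrix.cons_val_one] at this
      conv_lhs => rw [this]
      rw [map_add, map_smul, map_smul, hto, smul_zero, zero_add]
      rfl
    have hdvd : xlin (c o) ∣ numer (Finset.univ.erase o) c (fun i => c i ⬝ᵥ u 1) *
        cdot b (c p) := by
      have := sum_mul_eq_numer (Finset.univ.erase o) c (fun i => c i ⬝ᵥ u 1) (fun _ => 0)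
        (cdot b (c p)) 0
      rw [mul_zero, add_zero] at this
      rw [← this]
      simp_rw [smul_zero, add_zero, ← ht, ← hab]
      rw [← prod_mul_sum_eq hao, hg]
      exact (dvd_mul_right _ _).mul_left _
    have hA : ¬ xlin (c o) ∣ numer (Finset.univ.erase o) c (fun i => c i ⬝ᵥ u 1) := by
      obtain ⟨v, hv⟩ := exists_dotProduct_eq_one (ne_zero_of_nonprop hprop o)
      rw [← hypProj_eq_zero_iff hv, map_numer (hypProj (c o) v) (shift_X_inr _)
        fun i _ => hypProj_xlin (c o) v (c i)]
      refine numer_ne_zero (fun i hi h => ?_) (r := p) (by simp [hpo])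
        (hup.trans_ne one_ne_zero)
      exact hprop i o (Finset.ne_of_mem_erase hi) _ (sub_eq_zero.1 h)
    exact exists_mul_eq_of_dvd hprop (w₁ := u 1) (w₂ := 0) hao (y := 0)
      (fun i => by rw [hab, ht]; simp) ((hop.dvd_or_dvd hdvd).resolve_left hA) (dvd_zero _)

/-- Every linear form of the arrangement is a non-zero-divisor modulo `logIdeal c`. -/
lemma mem_logIdeal_of_xlin_mul_mem [Nontrivial ι] (h3 : n = 3)
    (hprop : ∀ i j, i ≠ j → ∀ r : ℂ, c i ≠ r • c j) (o : ι) {g : PolyRS n ι}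
    (hg : xlin (c o) * g ∈ logIdeal c) : g ∈ logIdeal c := by
  obtain ⟨a, b, hab, hsum⟩ := hg
  set σ : PolyRS n ι := ∑ i, X (Sum.inr i) with hσ
  have hσm : σ ∈ logIdeal c := by
    refine ⟨fun _ => 1, fun j => X (Sum.inl j), fun i => ?_, by simp [hσ]⟩
    rw [one_mul]
    rfl
  set φ : PolyRS n ι →ₐ[ℂ] PolyRS n ι := aeval (Sum.elim (fun j => X (Sum.inl j))
    fun i => if i = o then X (Sum.inr o) - σ else X (Sum.inr i)) with hφ
  have hφg : φ g - g ∈ logIdeal c := by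
    refine aeval_sub_mem (fun v => ?_) g
    rcases v with j | i
    · simp
    · by_cases hi : i = o
      · subst hi
        simpa using hσm
      · simp [hi]
  have hφx : ∀ v, φ (xlin v) = xlin v := by
    intro v
    rw [xlin, map_cdot]
    simp [hφ]
  have hφs : ∀ i, i ≠ o → φ (X (Sum.inr i)) = X (Sum.inr i) := by
    intro i hi
    simp [hφ, hi]
  have hφσ : φ σ = 0 := by
    rw [hσ, map_sum, ← Finset.add_sum_erase _ _ (Finset.mem_univ o),
      Finset.sum_congr rfl fun i hi => hφs i (Finset.ne_of_mem_erase hi)]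
    simp only [hφ, aeval_X, Sum.elim_inr, if_true, hσ]
    rw [← Finset.add_sum_erase _ _ (Finset.mem_univ o)]
    ring
  have hmem : φ g ∈ logIdeal c := by
    refine exists_mem_logIdeal_of_dvd (o := o) h3 hprop (a := fun i => φ (a i - a o)) (by simp)
      (b := fun j => φ (b j - a o * X (Sum.inl j))) (fun i => ?_) ?_
    · rw [← hφx (c i), ← map_mul, ← map_cdot]
      congr 1
      have := cdot_add b (fun j => -a o * X (Sum.inl j)) (c i)
      rw [cdot_mul, ← hab] at this
      simp only [sub_eq_add_neg, ← neg_mul]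
      rw [this, add_mul]
      rfl
    · have h1 := congrArg φ hsum
      rw [map_mul, hφx] at h1
      have h2 : ∑ i, a i * X (Sum.inr i) = ∑ i, (a i - a o) * X (Sum.inr i) + a o * σ := by
        simp_rw [sub_mul, Finset.sum_sub_distrib, hσ, Finset.mul_sum]
        ring
      rw [h1, h2, map_add, map_mul φ (a o), hφσ, mul_zero, add_zero, map_sum]
      refine Finset.sum_congr rfl fun i _ => ?_
      rw [map_mul]
      by_cases hi : i = o
      · simp [hi]
      · rw [hφs i hi]
  have := sub_mem hmem hφg
  rwa [sub_sub_cancel] at this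

lemma mem_logIdeal_of_prod_mul_mem [Nontrivial ι] (h3 : n = 3)
    (hprop : ∀ i j, i ≠ j → ∀ r : ℂ, c i ≠ r • c j) (T : Finset ι) {g : PolyRS n ι}
    (hg : (∏ k ∈ T, xlin (c k)) * g ∈ logIdeal c) : g ∈ logIdeal c := by
  induction T using Finset.induction_on with
  | empty => simpa using hg
  | insert k T hk ih =>
    rw [Finset.prod_insert hk, mul_assoc] at hg
    exact ih (mem_logIdeal_of_xlin_mul_mem h3 hprop k hg)

lemma mem_logIdeal_of_pow_mul_mem [Nontrivial ι] (h3 : n = 3)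
    (hprop : ∀ i j, i ≠ j → ∀ r : ℂ, c i ≠ r • c j) (N : ℕ) {g : PolyRS n ι}
    (hg : (∏ k, xlin (c k)) ^ N * g ∈ logIdeal c) : g ∈ logIdeal c := by
  induction N with
  | zero => simpa using hg
  | succ N ih =>
    rw [pow_succ', mul_assoc] at hg
    exact ih (mem_logIdeal_of_prod_mul_mem h3 hprop _ hg)

end Quotient

/-- Every arrangement of pairwise non-proportional linear forms in three variables is gentle. -/
lemma isGentle_of_linear [DecidableEq ι] [Nontrivial ι] {f : ι → PolyR 3}
    (hlin : ∀ i, (f i).IsHomogeneous 1) (hprop : ∀ i j, i ≠ j → ∀ c : ℂ, f i ≠ c • f j) :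
    IsGentle f := by
  choose c hc using fun i => exists_eq_cdot_X (hlin i)
  obtain rfl : f = fun i => cdot X (c i) := funext hc
  have hprop' : ∀ i j, i ≠ j → ∀ r : ℂ, c i ≠ r • c j := by
    intro i j hij r h
    refine hprop i j hij r ?_
    simp only [h, map_smul]
  refine (preLikelihoodIdeal_eq_logIdeal c).trans (le_antisymm logIdeal_le_likelihoodIdeal ?_)
  intro g hg
  obtain ⟨N, hN⟩ := exists_pow_mul_mem_logIdeal hg (ne_zero_of_nonprop hprop')
  exact mem_logIdeal_of_pow_mul_mem rfl hprop' N hN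

/-- Every linear arrangement in the projective plane is tame and
gentle: if `f_1,…,f_m ∈ ℂ[x_1,x_2,x_3]` are pairwise non-proportional linear forms with
`m > 3`, then the arrangement `A` they define is tame and satisfies `I₀(A) = I(A)`. -/
theorem statement12 {m : ℕ} (hm : 3 < m) (f : Fin m → PolyR 3)
    (hlin : ∀ i, (f i).IsHomogeneous 1)
    (hne : ∀ i, f i ≠ 0)
    (hprop : ∀ i j, i ≠ j → ∀ c : ℂ, f i ≠ c • f j) :
    IsTame f ∧ IsGentle f := by
  have : Nontrivial (Fin m) := Fin.nontrivial_iff_two_le.2 (by omega)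
  exact ⟨isTame_three f, isGentle_of_linear hlin hprop⟩

end
end

section
/- Let f_1,…,f_m ∈ ℂ[x_1,…,x_n] be nonzero, pairwise coprime homogeneous polynomials of positive degree with m > n, defining a gentle arrangement A of hypersurfaces. Then A is free, i.e., logDer(A) is a free R-module, if and only if the likelihood ideal I(A) is a complete intersection, i.e., I(A) can be generated by c elements where c is the height (codimension) of I(A) in ℂ[x_1,…,x_n,s_1,…,s_m]. -/
open MvPolynomial

noncomputable section

variable {n : ℕ} {ι : Type} [Fintype ι]

/-- The height (codimension) of an ideal: the infimum of the heights of the primes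
containing it. -/
def idealHeight {A : Type} [CommRing A] (I : Ideal A) : ℕ∞ :=
  ⨅ (P : PrimeSpectrum A) (_ : I ≤ P.asIdeal), Order.height P

/-- The linear form `∑ᵢ aᵢ sᵢ` attached to a vector `a ∈ R^m`. -/
def linForm (a : ι → PolyR n) : PolyRS n ι :=
  ∑ i, rename Sum.inl (a i) * X (Sum.inr i)

lemma linForm_zero : linForm (0 : ι → PolyR n) = 0 := by
  simp [linForm]

lemma linForm_add (a b : ι → PolyR n) : linForm (a + b) = linForm a + linForm b := by
  simp [linForm, add_mul, Finset.sum_add_distrib]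

lemma linForm_smul (h : PolyR n) (a : ι → PolyR n) :
    linForm (h • a) = rename Sum.inl h * linForm a := by
  simp [linForm, Finset.mul_sum, mul_assoc]

lemma eval_linForm (a : ι → PolyR n) (x : Fin n → ℂ) (s : ι → ℂ) :
    eval (Sum.elim x s) (linForm a) = ∑ i, eval x (a i) * s i := by
  simp [linForm, eval_rename, Function.comp_def]

lemma linForm_mem_of_mem_span {I : Ideal (PolyRS n ι)} {t : Set (ι → PolyR n)}
    (ht : ∀ b ∈ t, linForm b ∈ I) {a : ι → PolyR n}
    (ha : a ∈ Submodule.span (PolyR n) t) : linForm a ∈ I := by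
  induction ha using Submodule.span_induction with
  | mem b hb => exact ht b hb
  | zero => simp [linForm_zero]
  | add b c _ _ hb hc => rw [linForm_add]; exact I.add_mem hb hc
  | smul h b _ hb => rw [linForm_smul]; exact I.mul_mem_left _ hb

lemma preLikelihoodIdeal_eq (f : ι → PolyR n) :
    preLikelihoodIdeal f = Ideal.span (linForm '' (logDer f : Set (ι → PolyR n))) := by
  unfold preLikelihoodIdeal
  congr 1
  ext g
  simp only [Set.mem_ofPred_eq, Set.mem_image, SetLike.mem_coe, linForm, eq_comm]

lemma linForm_mem_preLikelihoodIdeal {f : ι → PolyR n} {a : ι → PolyR n} (ha : a ∈ logDer f) :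
    linForm a ∈ preLikelihoodIdeal f :=
  Ideal.subset_span ⟨a, ha, rfl⟩

/-- The specialization `ℂ[x,s] → ℂ[x]` at `s = 0`. -/
def specZero (n : ℕ) (ι : Type) : PolyRS n ι →ₐ[ℂ] PolyR n :=
  aeval (Sum.elim X 0)

omit [Fintype ι] in
lemma specZero_rename (h : PolyR n) : specZero n ι (rename Sum.inl h) = h := by
  rw [specZero, aeval_rename, Sum.elim_comp_inl, aeval_X_left_apply]

lemma specZero_linForm (a : ι → PolyR n) : specZero n ι (linForm a) = 0 := by
  simp [linForm, specZero]

lemma exists_smul_mem_span {R M κ : Type*} [CommRing R] [IsDomain R] [AddCommGroup M] [Module R M]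
    [Module.Finite R M] [Fintype κ] {v : κ → M} (hv : LinearIndependent R v)
    (hc : Fintype.card κ = Module.finrank R M) (x : M) :
    ∃ h : R, h ≠ 0 ∧ h • x ∈ Submodule.span R (Set.range v) := by
  have h1 := Submodule.finrank_quotient_add_finrank (Submodule.span R (Set.range v))
  rw [finrank_span_eq_card hv, hc, Nat.add_eq_right, Module.finrank_eq_zero_iff_isTorsion] at h1
  obtain ⟨h, hh⟩ := @h1 (Submodule.Quotient.mk x)
  refine ⟨h, nonZeroDivisors.coe_ne_zero h, ?_⟩
  rw [← Submodule.Quotient.mk_eq_zero, Submodule.Quotient.mk_smul]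
  exact hh

lemma idealHeight_preLikelihoodIdeal_le (f : ι → PolyR n) :
    idealHeight (preLikelihoodIdeal f) ≤ Module.finrank (PolyR n) (logDer f) := by
  obtain ⟨v, hv⟩ := exists_linearIndependent_of_le_finrank
    (le_refl (Module.finrank (PolyR n) (logDer f)))
  set t : Set (PolyRS n ι) := Set.range fun k => linForm (v k).1 with ht
  have htN : Ideal.span t ≤ RingHom.ker (specZero n ι) := by
    rw [Ideal.span_le]
    rintro _ ⟨k, rfl⟩
    exact specZero_linForm _
  have : (RingHom.ker (specZero n ι)).IsPrime := RingHom.ker_isPrime _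
  obtain ⟨Q, hQ, hQN⟩ := Ideal.exists_minimalPrimes_le htN
  have hQp : Q.IsPrime := hQ.1.1
  have hle : preLikelihoodIdeal f ≤ Q := by
    rw [preLikelihoodIdeal_eq, Ideal.span_le]
    rintro _ ⟨a, ha, rfl⟩
    obtain ⟨h, h0, hmem⟩ := exists_smul_mem_span hv (by simp) ⟨a, ha⟩
    have hmem' : h • a ∈ Submodule.span (PolyR n) (Set.range fun k => (v k).1) := by
      have := Submodule.mem_map_of_mem (f := (logDer f).subtype) hmem
      rw [Submodule.map_span, ← Set.range_comp] at this
      exact this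
    have h2 : linForm (h • a) ∈ Q := by
      refine linForm_mem_of_mem_span ?_ hmem'
      rintro _ ⟨k, rfl⟩
      exact hQ.1.2 (Ideal.subset_span ⟨k, rfl⟩)
    rw [linForm_smul] at h2
    refine (hQp.mem_or_mem h2).resolve_left fun h3 => h0 ?_
    have := hQN h3
    rwa [RingHom.mem_ker, specZero_rename] at this
  calc idealHeight (preLikelihoodIdeal f) ≤ Order.height (⟨Q, hQp⟩ : PrimeSpectrum _) :=
        iInf₂_le (f := fun (P : PrimeSpectrum (PolyRS n ι)) (_ : preLikelihoodIdeal f ≤ P.asIdeal) =>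
          Order.height P) ⟨Q, hQp⟩ hle
    _ = Q.height := (PrimeSpectrum.height_eq_orderHeight _).symm
    _ ≤ t.ncard := Ideal.height_le_card_of_mem_minimalPrimes_span (Set.finite_range _) hQ
    _ ≤ _ := by
      rw [Nat.cast_le, ht, ← Set.image_univ]
      refine (Set.ncard_image_le Set.finite_univ).trans ?_
      simp [Set.ncard_univ]

lemma Matrix.exists_mul_mul_eq_one {K α β : Type*} [Field K] [Fintype α] [Fintype β]
    [DecidableEq α] [DecidableEq β] (A : Matrix α β K) {r : ℕ} (hr : A.rank = r) :
    ∃ (C : Matrix (Fin r) α K) (E : Matrix β (Fin r) K), C * A * E = 1 := by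
  set φ := Matrix.toLin' A with hφ
  have hr' : Module.finrank K (LinearMap.range φ) = r := hr
  let e : LinearMap.range φ ≃ₗ[K] (Fin r → K) :=
    (Module.finBasisOfFinrankEq K (LinearMap.range φ) hr').equivFun
  obtain ⟨g, hg⟩ := φ.rangeRestrict.exists_rightInverse_of_surjective
    (LinearMap.range_rangeRestrict φ)
  obtain ⟨p, hp⟩ := (LinearMap.range φ).subtype.exists_leftInverse_of_injective
    (Submodule.ker_subtype _)
  refine ⟨LinearMap.toMatrix' (e.toLinearMap ∘ₗ p),
    LinearMap.toMatrix' (g ∘ₗ e.symm.toLinearMap), ?_⟩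
  have hA : A = LinearMap.toMatrix' φ := by simp [hφ]
  rw [hA, ← LinearMap.toMatrix'_comp, ← LinearMap.toMatrix'_comp, ← LinearMap.toMatrix'_id]
  congr 1
  refine LinearMap.ext fun y => ?_
  have h1 : φ (g (e.symm y)) = (e.symm y : α → K) :=
    congrArg Subtype.val (LinearMap.congr_fun hg (e.symm y))
  have h2 : p (e.symm y : α → K) = e.symm y := LinearMap.congr_fun hp (e.symm y)
  simp [h1, h2]

lemma Matrix.mulVec_eq_zero_of_det_ne_zero {K α β ρ : Type*} [Field K] [Fintype α] [Fintype β]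
    [Fintype ρ] [DecidableEq ρ] {A : Matrix α β K} {C : Matrix ρ α K} {E : Matrix β ρ K}
    (hA : A.rank ≤ Fintype.card ρ) (hdet : (C * A * E).det ≠ 0) {v : β → K}
    (hv : (C * A).mulVec v = 0) : A.mulVec v = 0 := by
  have h1 : (C * A * E).rank = Fintype.card ρ :=
    Matrix.rank_of_isUnit _ ((Matrix.isUnit_iff_isUnit_det _).2 hdet.isUnit)
  have h2 : Fintype.card ρ ≤ (C * A).rank := h1 ▸ Matrix.rank_mul_le_left _ _
  have hker : LinearMap.ker A.mulVecLin ≤ LinearMap.ker (C * A).mulVecLin := by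
    intro w hw
    rw [LinearMap.mem_ker, Matrix.mulVecLin_apply] at hw ⊢
    rw [← Matrix.mulVec_mulVec, hw, Matrix.mulVec_zero]
  have h3 := LinearMap.finrank_range_add_finrank_ker A.mulVecLin
  have h4 := LinearMap.finrank_range_add_finrank_ker (C * A).mulVecLin
  have h5 : LinearMap.ker A.mulVecLin = LinearMap.ker (C * A).mulVecLin := by
    refine Submodule.eq_of_le_of_finrank_le hker ?_
    unfold Matrix.rank at hA h2
    omega
  have h6 : v ∈ LinearMap.ker A.mulVecLin := by
    rw [h5]
    exact hv
  exact h6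

/-- A kernel vector at a point of maximal rank extends to a polynomial syzygy. -/
lemma exists_syzygy_of_rank_eq {α β : Type*} [Fintype α] [Fintype β]
    [DecidableEq α] [DecidableEq β] (N : Matrix α β (PolyR n)) {r : ℕ}
    (hle : ∀ x : Fin n → ℂ, (N.map (eval x)).rank ≤ r) {x₀ : Fin n → ℂ}
    (h₀ : (N.map (eval x₀)).rank = r) {s₀ : β → ℂ} (hs : (N.map (eval x₀)).mulVec s₀ = 0) :
    ∃ σ : β → PolyR n, N.mulVec σ = 0 ∧ ∀ j, eval x₀ (σ j) = s₀ j := by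
  obtain ⟨P, E, hPE⟩ := Matrix.exists_mul_mul_eq_one _ h₀
  set P' : Matrix (Fin r) α (PolyR n) := P.map C with hP'
  set E' : Matrix β (Fin r) (PolyR n) := E.map C with hE'
  set B := P' * N * E' with hB
  set c : β → PolyR n := fun j => C (s₀ j) with hc
  set σ : β → PolyR n := B.det • c - E'.mulVec (B.adjugate.mulVec ((P' * N).mulVec c)) with hσ
  have hBx : ∀ x, B.map (eval x) = P * N.map (eval x) * E := by
    intro x
    rw [hB, Matrix.map_mul, Matrix.map_mul, hP', hE']
    congr <;> (ext; simp)
  have hPN : (P' * N).mulVec σ = 0 := by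
    rw [hσ, Matrix.mulVec_sub, Matrix.mulVec_smul, Matrix.mulVec_mulVec, Matrix.mulVec_mulVec,
      ← hB, Matrix.mul_adjugate, Matrix.smul_mulVec, Matrix.one_mulVec, sub_self]
  have hdet : ∀ x, eval x B.det = (P * N.map (eval x) * E).det := by
    intro x
    rw [RingHom.map_det, RingHom.mapMatrix_apply, hBx]
  have hdet₀ : eval x₀ B.det = 1 := by rw [hdet, hPE, Matrix.det_one]
  refine ⟨σ, ?_, ?_⟩
  · funext i
    have hz : B.det * (N.mulVec σ) i = 0 := by
      refine MvPolynomial.funext fun x => ?_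
      rw [map_mul, map_zero, mul_eq_zero, or_iff_not_imp_left]
      intro hx
      rw [RingHom.map_mulVec]
      rw [hdet] at hx
      refine congrFun (Matrix.mulVec_eq_zero_of_det_ne_zero ((hle x).trans (by simp)) hx ?_) i
      have hPx : P * N.map (eval x) = (P' * N).map (eval x) := by
        rw [Matrix.map_mul, hP']
        congr
        ext
        simp
      funext k
      rw [hPx, ← RingHom.map_mulVec, hPN]
      simp
    refine (mul_eq_zero.1 hz).resolve_left fun h => ?_
    rw [h] at hdet₀
    simp at hdet₀
  · have hv : (fun k => eval x₀ ((P' * N).mulVec c k)) = 0 := by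
      funext k
      rw [RingHom.map_mulVec, Matrix.map_mul, ← Matrix.mulVec_mulVec]
      have : (fun j => eval x₀ (c j)) = s₀ := by funext j; simp [hc]
      simp only [Function.comp_def, this, hs, Matrix.mulVec_zero]
    have hv' : ∀ k, eval x₀ (B.adjugate.mulVec ((P' * N).mulVec c) k) = 0 := by
      intro k
      rw [RingHom.map_mulVec]
      simp only [Function.comp_def, hv]
      simp
    intro j
    rw [hσ, Pi.sub_apply, map_sub, RingHom.map_mulVec]
    simp only [Function.comp_def, hv', Pi.smul_apply, smul_eq_mul, map_mul, hdet₀]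
    have : (fun _ : Fin r => (0 : ℂ)) = 0 := rfl
    simp [hc, this]

/-- The matrix of the cleared-denominator likelihood equations. -/
def critMatrix [DecidableEq ι] (f : ι → PolyR n) : Matrix (Fin n) ι (PolyR n) :=
  Matrix.of fun i j => pderiv i (f j) * ∏ k ∈ Finset.univ.erase j, f k

lemma critMatrix_map_eval [DecidableEq ι] (f : ι → PolyR n) (x : Fin n → ℂ) :
    (critMatrix f).map (eval x) = (jacAt f x).transpose *
      Matrix.diagonal fun j => ∏ k ∈ Finset.univ.erase j, eval x (f k) := by
  ext i j
  simp [critMatrix, jacAt, Matrix.mul_diagonal]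

lemma mem_critLocus_iff [DecidableEq ι] (f : ι → PolyR n) (p : (Fin n → ℂ) × (ι → ℂ)) :
    p ∈ critLocus f ↔ (∀ j, eval p.1 (f j) ≠ 0) ∧ (jacAt f p.1).rank = jacMaxRank f ∧
      ((critMatrix f).map (eval p.1)).mulVec p.2 = 0 := by
  rw [critLocus, Set.mem_ofPred_eq, funext_iff]
  simp only [Matrix.mulVec, dotProduct, critMatrix, Matrix.map_apply, Matrix.of_apply, map_mul,
    map_prod, Pi.zero_apply]
  refine and_congr_right fun _ => and_congr_right fun _ => forall_congr' fun i => ?_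
  exact Eq.congr_left (Finset.sum_congr rfl fun j _ => by ring)

omit [Fintype ι] in
lemma bddAbove_range_rank_jacAt (f : ι → PolyR n) :
    BddAbove (Set.range fun x => (jacAt f x).rank) :=
  ⟨n, by rintro _ ⟨x, rfl⟩; simpa using (jacAt f x).rank_le_card_width⟩

omit [Fintype ι] in
lemma rank_jacAt_le (f : ι → PolyR n) (x : Fin n → ℂ) : (jacAt f x).rank ≤ jacMaxRank f :=
  le_ciSup (bddAbove_range_rank_jacAt f) x

lemma rank_critMatrix_le [DecidableEq ι] (f : ι → PolyR n) (x : Fin n → ℂ) :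
    ((critMatrix f).map (eval x)).rank ≤ jacMaxRank f := by
  rw [critMatrix_map_eval]
  refine (Matrix.rank_mul_le_left _ _).trans ?_
  rw [Matrix.rank_transpose]
  exact rank_jacAt_le f x

lemma rank_critMatrix_eq [DecidableEq ι] (f : ι → PolyR n) {x : Fin n → ℂ}
    (hx : ∀ j, eval x (f j) ≠ 0) : ((critMatrix f).map (eval x)).rank = (jacAt f x).rank := by
  rw [critMatrix_map_eval, Matrix.rank_mul_eq_left_of_isUnit_det, Matrix.rank_transpose]
  rw [Matrix.det_diagonal, isUnit_iff_ne_zero]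
  exact Finset.prod_ne_zero_iff.2 fun j _ => Finset.prod_ne_zero_iff.2 fun k _ => hx k

lemma exists_generic_polynomial (f : ι → PolyR n) (hne : ∀ i, f i ≠ 0) :
    ∃ Δ : PolyR n, Δ ≠ 0 ∧ ∀ x, eval x Δ ≠ 0 →
      (∀ j, eval x (f j) ≠ 0) ∧ (jacAt f x).rank = jacMaxRank f := by
  classical
  obtain ⟨y, hy⟩ : jacMaxRank f ∈ Set.range fun x => (jacAt f x).rank :=
    Nat.sSup_mem (Set.range_nonempty _) (bddAbove_range_rank_jacAt f)
  obtain ⟨P, E, hPE⟩ := Matrix.exists_mul_mul_eq_one _ hy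
  set J : Matrix ι (Fin n) (PolyR n) := Matrix.of fun i j => pderiv j (f i) with hJ
  set P' : Matrix (Fin (jacMaxRank f)) ι (PolyR n) := P.map C with hP'
  set E' : Matrix (Fin n) (Fin (jacMaxRank f)) (PolyR n) := E.map C with hE'
  set B := P' * J * E' with hB
  have hdet : ∀ x, eval x B.det = (P * jacAt f x * E).det := by
    intro x
    rw [RingHom.map_det, RingHom.mapMatrix_apply, hB, Matrix.map_mul, Matrix.map_mul, hP', hE', hJ]
    congr <;> (ext; simp)
  refine ⟨B.det * ∏ j, f j, mul_ne_zero ?_ (Finset.prod_ne_zero_iff.2 fun j _ => hne j), ?_⟩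
  · intro h
    have := hdet y
    rw [hPE, h] at this
    simp at this
  · intro x hx
    rw [map_mul, map_prod, mul_ne_zero_iff, Finset.prod_ne_zero_iff, hdet] at hx
    refine ⟨fun j => hx.2 j (Finset.mem_univ j), (rank_jacAt_le f x).antisymm ?_⟩
    have h1 : (P * jacAt f x * E).rank = jacMaxRank f := by
      simpa using Matrix.rank_of_isUnit _ ((Matrix.isUnit_iff_isUnit_det _).2 hx.1.isUnit)
    rw [← h1]
    exact (Matrix.rank_mul_le_left _ _).trans (Matrix.rank_mul_le_right _ _)

lemma eval_aeval {σ τ : Type*} (x : τ → ℂ) (u : σ → MvPolynomial τ ℂ) (g : MvPolynomial σ ℂ) :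
    eval x (aeval u g) = eval (fun v => eval x (u v)) g := by
  induction g using MvPolynomial.induction_on with
  | C a => simp
  | add p q hp hq => simp only [map_add, hp, hq]
  | mul_X p v hp => simp only [map_mul, hp, aeval_X, eval_X]

/-- The part of the critical locus over a dense open subset of `ℂⁿ` is dense. -/
lemma mem_likelihoodIdeal_of_eval_eq_zero [DecidableEq ι] {f : ι → PolyR n} (hne : ∀ i, f i ≠ 0)
    {h : PolyR n} (h0 : h ≠ 0) {g : PolyRS n ι}
    (hg : ∀ p ∈ critLocus f, eval p.1 h ≠ 0 → eval (Sum.elim p.1 p.2) g = 0) :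
    g ∈ likelihoodIdeal f := by
  intro p hp
  obtain ⟨Δ, hΔ0, hΔ⟩ := exists_generic_polynomial f hne
  rw [mem_critLocus_iff] at hp
  obtain ⟨σ, hσ, hσp⟩ := exists_syzygy_of_rank_eq (critMatrix f) (rank_critMatrix_le f)
    ((rank_critMatrix_eq f hp.1).trans hp.2.1) hp.2.2
  set G : PolyR n := aeval (Sum.elim X σ) g with hG
  have hGx : ∀ x, eval x G = eval (Sum.elim x fun j => eval x (σ j)) g := by
    intro x
    rw [hG, eval_aeval]
    congr 2
    funext v
    cases v <;> simp
  have hz : h * Δ * G = 0 := by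
    refine MvPolynomial.funext fun x => ?_
    rw [map_mul, map_zero, mul_eq_zero, or_iff_not_imp_left, hGx]
    intro hx
    rw [map_mul, ← ne_eq, mul_ne_zero_iff] at hx
    refine hg (x, fun j => eval x (σ j)) ?_ hx.1
    rw [mem_critLocus_iff]
    refine ⟨(hΔ x hx.2).1, (hΔ x hx.2).2, ?_⟩
    funext i
    have := RingHom.map_mulVec (eval x) (critMatrix f) σ i
    rw [hσ] at this
    simpa [Function.comp_def] using this.symm
  have hG0 : G = 0 := (mul_eq_zero.1 hz).resolve_left (mul_ne_zero h0 hΔ0)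
  have := hGx p.1
  rw [hG0, map_zero, funext hσp] at this
  exact this.symm
lemma card_le_height_of_lt_insert {A τ : Type*} [CommRing A] [DecidableEq τ]
    (P : Finset τ → Ideal A) (hP : ∀ u, (P u).IsPrime)
    (hlt : ∀ u, ∀ b ∉ u, P u < P (insert b u)) (u : Finset τ) :
    (u.card : ℕ∞) ≤ (P u).height := by
  induction u using Finset.induction_on with
  | empty => simp
  | insert b u hb ih =>
    have := hP u
    have := hP (insert b u)
    rw [Finset.card_insert_of_notMem hb, Nat.cast_add, Nat.cast_one]
    exact (add_le_add_left ih 1).trans (Ideal.height_add_one_le_of_lt_of_isPrime (hlt u b hb))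

/-- The endomorphism setting the variables `t_β`, `β ∈ u`, to zero. -/
def killVars (n : ℕ) {τ : Type} [DecidableEq τ] (u : Finset τ) : PolyRS n τ →ₐ[ℂ] PolyRS n τ :=
  aeval (Sum.elim (fun i => X (Sum.inl i)) fun β => if β ∈ u then 0 else X (Sum.inr β))

lemma aeval_X_inl {τ : Type} (h : PolyR n) :
    aeval (fun i => (X (Sum.inl i) : PolyRS n τ)) h = rename Sum.inl h :=
  DFunLike.congr_fun (f := aeval fun i => (X (Sum.inl i) : PolyRS n τ))
    (MvPolynomial.algHom_ext fun i => by simp) h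

lemma killVars_rename {τ : Type} [DecidableEq τ] (u : Finset τ) (h : PolyR n) :
    killVars n u (rename Sum.inl h) = rename Sum.inl h := by
  rw [killVars, aeval_rename, Sum.elim_comp_inl, aeval_X_inl]

lemma killVars_comp {τ : Type} [DecidableEq τ] {u w : Finset τ} (huw : u ⊆ w) (g : PolyRS n τ) :
    killVars n w (killVars n u g) = killVars n w g := by
  rw [← AlgHom.comp_apply]
  congr 1
  refine MvPolynomial.algHom_ext fun v => ?_
  rcases v with i | β
  · simp [killVars]
  · by_cases hβ : β ∈ u
    · simp [killVars, hβ, huw hβ]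
    · simp [killVars, hβ]

/-- A change of coordinates adapted to a linearly independent family of maximal size. -/
lemma exists_coordinate_matrix {R ι τ : Type*} [CommRing R] [IsDomain R] [Fintype ι] [DecidableEq ι]
    [Fintype τ] [DecidableEq τ] {b : τ → ι → R} (hb : LinearIndependent R b)
    (hc : Fintype.card τ = Fintype.card ι) :
    ∃ (h : R) (D : Matrix ι τ R), h ≠ 0 ∧
      (∀ i j, ∑ β, D i β * b β j = if i = j then h else 0) ∧
      ∀ β γ, ∑ i, b β i * D i γ = if β = γ then h else 0 := by
  choose k hk0 hk using fun i : ι =>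
    exists_smul_mem_span hb (by simpa using hc) (Pi.single i (1 : R))
  set h := ∏ i, k i with hh
  have hmem : ∀ i, h • (Pi.single i (1 : R) : ι → R) ∈ Submodule.span R (Set.range b) := by
    intro i
    obtain ⟨l, hl⟩ := Finset.dvd_prod_of_mem k (Finset.mem_univ i)
    rw [hh, hl, mul_comm, mul_smul]
    exact Submodule.smul_mem _ _ (hk i)
  simp only [Submodule.mem_span_range_iff_exists_fun] at hmem
  choose D hD using hmem
  have hDB : ∀ i j, ∑ β, D i β * b β j = if i = j then h else 0 := by
    intro i j
    have := congrFun (hD i) j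
    simp only [Finset.sum_apply, Pi.smul_apply, smul_eq_mul, Pi.single_apply, mul_ite, mul_one,
      mul_zero] at this
    rw [this]
    simp only [eq_comm]
  refine ⟨h, Matrix.of D, Finset.prod_ne_zero_iff.2 fun i _ => hk0 i, hDB, fun β => ?_⟩
  refine congrFun (linearIndependent_iff_injective_fintypeLinearCombination.1 hb ?_)
  funext j
  simp only [Fintype.linearCombination_apply, Finset.sum_apply, Pi.smul_apply, smul_eq_mul,
    Matrix.of_apply, Finset.sum_mul, ite_mul, zero_mul, Finset.sum_ite_eq, Finset.mem_univ, if_true]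
  rw [Finset.sum_comm]
  simp only [mul_assoc, ← Finset.mul_sum, hDB]
  simp [mul_comm]

lemma finrank_le_idealHeight [DecidableEq ι] {f : ι → PolyR n} (hne : ∀ i, f i ≠ 0)
    (hf : preLikelihoodIdeal f ≤ likelihoodIdeal f) :
    (Module.finrank (PolyR n) (logDer f) : ℕ∞) ≤ idealHeight (likelihoodIdeal f) := by
  classical
  obtain ⟨v, hv⟩ := exists_linearIndependent_of_le_finrank
    (le_refl (Module.finrank (PolyR n) (logDer f)))
  have hv' : LinearIndependent (PolyR n) fun k => (v k).1 :=
    hv.map' (logDer f).subtype (Submodule.ker_subtype _)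
  obtain ⟨t, hvt, htc, ht⟩ := exists_linearIndepOn_of_lt_rank hv'.linearIndepOn_id
  have htfin : t.Finite := by
    rw [← Cardinal.lt_aleph0_iff_set_finite, htc]
    exact Module.rank_lt_aleph0 _ _
  have := htfin.fintype
  have hcard : Fintype.card t = Fintype.card ι := by
    rw [← Nat.cast_inj (R := Cardinal), ← Cardinal.mk_fintype, htc]
    simp
  obtain ⟨h, D, h0, hDB, hBD⟩ := exists_coordinate_matrix (b := fun β : t => β.1) ht hcard
  let Φ : PolyRS n ι →ₐ[ℂ] PolyRS n t :=
    aeval (Sum.elim (fun i => X (Sum.inl i)) fun i => linForm (D i))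
  have hΦr : ∀ k : PolyR n, Φ (rename Sum.inl k) = rename Sum.inl k := by
    intro k
    simp only [Φ]
    rw [aeval_rename, Sum.elim_comp_inl, aeval_X_inl]
  have hΦ : ∀ β : t, Φ (linForm β.1) = rename Sum.inl h * X (Sum.inr β) := by
    intro β
    have h1 : Φ (linForm β.1) = ∑ i, rename Sum.inl (β.1 i) * linForm (D i) := by
      simp only [linForm, map_sum, map_mul, hΦr]
      simp [Φ, linForm]
    rw [h1]
    simp only [linForm, Finset.mul_sum]
    rw [Finset.sum_comm]
    simp only [← mul_assoc, ← map_mul, ← Finset.sum_mul, ← map_sum, hBD]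
    rw [Finset.sum_eq_single β]
    · simp
    · intro γ _ hγ
      simp [hγ.symm]
    · simp
  let P : Finset t → Ideal (PolyRS n ι) := fun u => RingHom.ker ((killVars n u).comp Φ)
  have hPp : ∀ u, (P u).IsPrime := fun u => RingHom.ker_isPrime _
  have hh : (rename Sum.inl h : PolyRS n t) ≠ 0 := by
    rwa [Ne, map_eq_zero_iff _ (rename_injective _ Sum.inl_injective)]
  have hmem : ∀ u (β : t), linForm β.1 ∈ P u ↔ β ∈ u := by
    intro u β
    rw [RingHom.mem_ker, AlgHom.comp_apply, hΦ, map_mul, killVars_rename, mul_eq_zero,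
      or_iff_right hh, killVars, aeval_X, Sum.elim_inr]
    simp [X_ne_zero]
  have hlt : ∀ u, ∀ β ∉ u, P u < P (insert β u) := by
    intro u β hβ
    refine lt_of_le_of_ne (fun g hg => ?_) fun heq => ?_
    · rw [RingHom.mem_ker, AlgHom.comp_apply] at hg ⊢
      rw [← killVars_comp (Finset.subset_insert β u), hg, map_zero]
    · have := (hmem (insert β u) β).2 (Finset.mem_insert_self _ _)
      rw [← heq, hmem] at this
      exact hβ this
  set u₀ : Finset t := Finset.univ.filter fun β => β.1 ∈ logDer f with hu₀
  have hu₀c : Module.finrank (PolyR n) (logDer f) ≤ u₀.card := by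
    have hinj : Function.Injective fun k => (⟨(v k).1, hvt ⟨k, rfl⟩⟩ : t) := fun k l hkl =>
      hv'.injective (congrArg (fun β : t => β.1) hkl)
    calc Module.finrank (PolyR n) (logDer f)
        = (Finset.univ.image fun k => (⟨(v k).1, hvt ⟨k, rfl⟩⟩ : t)).card := by
          rw [Finset.card_image_of_injective _ hinj]
          simp
      _ ≤ u₀.card := by
          refine Finset.card_le_card fun β hβ => ?_
          obtain ⟨k, -, rfl⟩ := Finset.mem_image.1 hβ
          simp [hu₀]
  have hPI : P u₀ ≤ likelihoodIdeal f := by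
    intro g hg
    refine mem_likelihoodIdeal_of_eval_eq_zero hne h0 fun p hp hpx => ?_
    rw [RingHom.mem_ker, AlgHom.comp_apply] at hg
    let w : Fin n ⊕ t → ℂ :=
      Sum.elim p.1 fun β => (eval p.1 h)⁻¹ * eval (Sum.elim p.1 p.2) (linForm β.1)
    have hw : ∀ β ∈ u₀, w (Sum.inr β) = 0 := by
      intro β hβ
      have : linForm β.1 ∈ likelihoodIdeal f :=
        hf (linForm_mem_preLikelihoodIdeal (Finset.mem_filter.1 hβ).2)
      simp only [w, Sum.elim_inr, this p hp, mul_zero]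
    have h1 : eval w (Φ g) = eval (Sum.elim p.1 p.2) g := by
      rw [eval_aeval]
      congr 2
      funext a
      rcases a with i | i
      · simp [w]
      · simp only [Sum.elim_inr, w, eval_linForm]
        simp only [Finset.mul_sum]
        rw [Finset.sum_comm]
        have : ∀ j, ∑ β : t, eval p.1 (D i β) * ((eval p.1 h)⁻¹ * (eval p.1 (β.1 j) * p.2 j)) =
            (eval p.1 h)⁻¹ * p.2 j * eval p.1 (∑ β : t, D i β * β.1 j) := by
          intro j
          rw [map_sum, Finset.mul_sum]
          refine Finset.sum_congr rfl fun β _ => ?_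
          rw [map_mul]
          ring
        simp only [this, hDB]
        rw [Finset.sum_eq_single i]
        · rw [if_pos rfl]
          field_simp
        · intro j _ hj
          simp [hj.symm]
        · simp
    have h2 : eval w (killVars n u₀ (Φ g)) = eval w (Φ g) := by
      rw [killVars, eval_aeval]
      congr 2
      funext a
      rcases a with i | β
      · simp
      · by_cases hβ : β ∈ u₀
        · simp [hβ, hw β hβ]
        · simp [hβ]
    rw [← h1, ← h2, hg, map_zero]
  refine le_iInf₂ fun Q hQ => ?_
  calc (Module.finrank (PolyR n) (logDer f) : ℕ∞) ≤ u₀.card := by exact_mod_cast hu₀c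
    _ ≤ (P u₀).height := card_le_height_of_lt_insert P hPp hlt u₀
    _ ≤ Q.asIdeal.height := Ideal.height_mono (hPI.trans hQ)
    _ = Order.height Q := PrimeSpectrum.height_eq_orderHeight Q

/-- The coefficients of the part of `g` that is linear in `s`. -/
def linPart (g : PolyRS n ι) : ι → PolyR n := fun i => specZero n ι (pderiv (Sum.inr i) g)

omit [Fintype ι] in
lemma linPart_add (g h : PolyRS n ι) : linPart (g + h) = linPart g + linPart h := by
  funext i
  simp [linPart]

omit [Fintype ι] in
lemma linPart_mul {g : PolyRS n ι} (hg : specZero n ι g = 0) (h : PolyRS n ι) :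
    linPart (h * g) = specZero n ι h • linPart g := by
  funext i
  simp [linPart, Derivation.leibniz, hg]

lemma linPart_linForm (a : ι → PolyR n) : linPart (linForm a) = a := by
  classical
  funext i
  have h1 : ∀ j, pderiv (Sum.inr i : Fin n ⊕ ι) (rename Sum.inl (a j)) = 0 := by
    intro j
    refine pderiv_eq_zero_of_notMem_vars fun h => ?_
    obtain ⟨_, _, h⟩ := Finset.mem_image.1 (vars_rename _ _ h)
    cases h
  simp only [linPart, linForm, map_sum, Derivation.leibniz, h1, smul_eq_mul, mul_zero, add_zero,
    pderiv_X, map_mul, specZero_rename]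
  rw [Finset.sum_eq_single i]
  · simp
  · intro j _ hj
    rw [Pi.single_eq_of_ne (by simpa using hj)]
    simp
  · simp

lemma specZero_eq_zero_of_mem {f : ι → PolyR n} {g : PolyRS n ι} (hg : g ∈ preLikelihoodIdeal f) :
    specZero n ι g = 0 := by
  have : preLikelihoodIdeal f ≤ RingHom.ker (specZero n ι) := by
    rw [preLikelihoodIdeal_eq, Ideal.span_le]
    rintro _ ⟨a, -, rfl⟩
    exact specZero_linForm a
  exact this hg

omit [Fintype ι] in
lemma linPart_mem_span {I : Set (PolyRS n ι)} (hI : ∀ g ∈ I, specZero n ι g = 0) {g : PolyRS n ι}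
    (hg : g ∈ Ideal.span I) : linPart g ∈ Submodule.span (PolyR n) (linPart '' I) := by
  induction hg using Submodule.span_induction with
  | mem g hg => exact Submodule.subset_span ⟨g, hg, rfl⟩
  | zero =>
    have : linPart (0 : PolyRS n ι) = 0 := by funext i; simp [linPart]
    rw [this]
    exact Submodule.zero_mem _
  | add g h _ _ ihg ihh => rw [linPart_add]; exact Submodule.add_mem _ ihg ihh
  | smul h g hg ih =>
    have hg0 : specZero n ι g = 0 := by
      have : Ideal.span I ≤ RingHom.ker (specZero n ι) := Ideal.span_le.2 hI
      exact this hg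
    rw [smul_eq_mul, linPart_mul hg0]
    exact Submodule.smul_mem _ _ ih

lemma logDer_eq_span_linPart {f : ι → PolyR n} {I : Set (PolyRS n ι)}
    (hI : Ideal.span I = preLikelihoodIdeal f) :
    logDer f = Submodule.span (PolyR n) (linPart '' I) := by
  have hI0 : ∀ g ∈ I, specZero n ι g = 0 := fun g hg =>
    specZero_eq_zero_of_mem (hI ▸ Ideal.subset_span hg)
  refine le_antisymm (fun a ha => ?_) (Submodule.span_le.2 ?_)
  · rw [← linPart_linForm a]
    exact linPart_mem_span hI0 (hI ▸ linForm_mem_preLikelihoodIdeal ha)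
  · rintro _ ⟨g, hg, rfl⟩
    have h1 : g ∈ Ideal.span (linForm '' (logDer f : Set (ι → PolyR n))) := by
      rw [← preLikelihoodIdeal_eq, ← hI]
      exact Ideal.subset_span hg
    have h2 := linPart_mem_span (by rintro _ ⟨a, -, rfl⟩; exact specZero_linForm a) h1
    refine Submodule.span_le.2 ?_ h2
    rintro _ ⟨_, ⟨a, ha, rfl⟩, rfl⟩
    rwa [linPart_linForm]

lemma idealHeight_likelihoodIdeal [DecidableEq ι] {f : ι → PolyR n} (hne : ∀ i, f i ≠ 0)
    (hf : IsGentle f) :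
    idealHeight (likelihoodIdeal f) = Module.finrank (PolyR n) (logDer f) := by
  refine le_antisymm ?_ (finrank_le_idealHeight hne (le_of_eq hf))
  rw [← show preLikelihoodIdeal f = likelihoodIdeal f from hf]
  exact idealHeight_preLikelihoodIdeal_le f

lemma free_of_span_card_le_finrank {R M : Type*} [CommRing R] [Nontrivial R] [AddCommGroup M]
    [Module R M] {N : Submodule R M} {s : Finset M} (hs : N = Submodule.span R (s : Set M))
    (hc : s.card ≤ Module.finrank R N) : Module.Free R N := by
  have hrange : Set.range (Subtype.val : s → M) = s := by simp
  have hli : LinearIndependent R (Subtype.val : s → M) := by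
    rw [linearIndependent_iff_card_le_finrank_span, Set.finrank, Fintype.card_coe, hrange, ← hs]
    exact hc
  rw [hs, ← hrange]
  exact Module.Free.of_basis (Module.Basis.span hli)

/-- For a gentle arrangement `A` of hypersurfaces (with `m > n`), `A`
is free — i.e. `logDer(A)` is a free `R`-module — if and only if the likelihood ideal
`I(A)` is a complete intersection, i.e. it can be generated by `c` elements where `c` is
the height of `I(A)` in `ℂ[x,s]`. -/
theorem statement13 {n m : ℕ} (hmn : n < m) (f : Fin m → PolyR n) (d : Fin m → ℕ)
    (hne : ∀ i, f i ≠ 0)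
    (hhom : ∀ i, (f i).IsHomogeneous (d i))
    (hd : ∀ i, 0 < d i)
    (hcop : ∀ i j, i ≠ j → IsRelPrime (f i) (f j))
    (hgentle : IsGentle f) :
    Module.Free (PolyR n) ↥(logDer f) ↔
      ∃ gs : Finset (PolyRS n (Fin m)),
        (gs.card : ℕ∞) = idealHeight (likelihoodIdeal f) ∧
        Ideal.span (gs : Set (PolyRS n (Fin m))) = likelihoodIdeal f := by
  classical
  rw [idealHeight_likelihoodIdeal hne hgentle]
  have hI : preLikelihoodIdeal f = likelihoodIdeal f := hgentle
  rw [← hI]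
  constructor
  · intro hfree
    let b := Module.finBasis (PolyR n) (logDer f)
    have hinj : Function.Injective fun k => linForm (b k).1 := by
      intro k l hkl
      have := congrArg linPart hkl
      simp only [linPart_linForm] at this
      exact b.injective (Subtype.ext this)
    refine ⟨Finset.univ.image fun k => linForm (b k).1, ?_, ?_⟩
    · rw [Finset.card_image_of_injective _ hinj]
      simp
    · rw [Finset.coe_image, Finset.coe_univ, Set.image_univ]
      refine le_antisymm (Ideal.span_le.2 ?_) ?_
      · rintro _ ⟨k, rfl⟩
        exact linForm_mem_preLikelihoodIdeal (b k).2
      · rw [preLikelihoodIdeal_eq, Ideal.span_le]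
        rintro _ ⟨a, ha, rfl⟩
        refine linForm_mem_of_mem_span (t := Set.range fun k => (b k).1) ?_ ?_
        · rintro _ ⟨k, rfl⟩
          exact Ideal.subset_span ⟨k, rfl⟩
        · have := Submodule.mem_map_of_mem (f := (logDer f).subtype) (b.mem_span ⟨a, ha⟩)
          rw [Submodule.map_span, ← Set.range_comp] at this
          exact this
  · rintro ⟨gs, hcard, hspan⟩
    refine free_of_span_card_le_finrank (s := gs.image linPart) ?_ ?_
    · rw [Finset.coe_image]
      exact logDer_eq_span_linPart hspan
    · rw [Nat.cast_inj] at hcard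
      exact Finset.card_image_le.trans hcard.le

end
end

section
/- The localization of a gentle hyperplane arrangement is gentle: let f_1,…,f_m ∈ ℂ[x_1,…,x_n] be pairwise non-proportional linear forms defining a gentle hyperplane arrangement A, let X be an element of the intersection lattice of A (an intersection of some of the hyperplanes {f_i = 0}), and let A_X be the subarrangement consisting of those f_i whose hyperplane contains X. Then A_X is gentle. -/
open MvPolynomial

noncomputable section

variable {n : ℕ} {ι : Type} [Fintype ι]

/-- A homogeneous polynomial of degree one is a linear form. -/
lemma MvPolynomial.IsHomogeneous.exists_eq_sum_C_mul_X {q : PolyR n} (h : q.IsHomogeneous 1) :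
    ∃ d : Fin n → ℂ, q = ∑ k, C (d k) * X k := by
  have hC : ∀ k, ∃ a : ℂ, pderiv k q = C a := fun k => by
    have h0 : (pderiv k q).IsHomogeneous 0 := h.pderiv
    rw [← totalDegree_zero_iff_isHomogeneous, totalDegree_eq_zero_iff_eq_C] at h0
    exact ⟨_, h0⟩
  choose d hd using hC
  refine ⟨d, ?_⟩
  have hE := h.sum_X_mul_pderiv
  rw [one_smul] at hE
  rw [← hE]
  exact Finset.sum_congr rfl fun k _ => by rw [hd, mul_comm]

lemma pderiv_sum_C_mul_X (d : Fin n → ℂ) (k : Fin n) :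
    pderiv k (∑ l, C (d l) * X l : PolyR n) = C (d k) := by
  simp [pderiv_X, Pi.single_apply]

/-- For linear forms, the critical locus is cut out by the equation `Σ_j s_j df_j / f_j = 0` on the
complement of the arrangement. -/
lemma mem_critLocus_iff_of_linear [DecidableEq ι] {f : ι → PolyR n} {d : ι → Fin n → ℂ}
    (hd : ∀ i, f i = ∑ k, C (d i k) * X k) (p : (Fin n → ℂ) × (ι → ℂ)) :
    p ∈ critLocus f ↔
      (∀ j, eval p.1 (f j) ≠ 0) ∧ ∀ k, ∑ j, p.2 j / eval p.1 (f j) * d j k = 0 := by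
  have hp : ∀ i k, pderiv k (f i) = C (d i k) := fun i k => by rw [hd, pderiv_sum_C_mul_X]
  have hrank : (jacAt f p.1).rank = jacMaxRank f := by
    have hconst : ∀ x, (jacAt f x).rank = (jacAt f p.1).rank := fun x => by
      simp only [jacAt, hp, eval_C]
    simp only [jacMaxRank, hconst, ciSup_const]
  change (_ ∧ _ ∧ _) ↔ _
  refine and_congr_right fun hne => ?_
  simp only [hrank, true_and]
  refine forall_congr' fun k => ?_
  have hfac : ∑ j, p.2 j * eval p.1 (pderiv k (f j)) *
      ∏ l ∈ Finset.univ.erase j, eval p.1 (f l) =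
      (∏ l, eval p.1 (f l)) * ∑ j, p.2 j / eval p.1 (f j) * d j k := by
    rw [Finset.mul_sum]
    refine Finset.sum_congr rfl fun j _ => ?_
    rw [← Finset.mul_prod_erase _ _ (Finset.mem_univ j), hp, eval_C]
    field_simp [hne j]
  rw [hfac, mul_eq_zero, or_iff_right (Finset.prod_ne_zero_iff.mpr fun j _ => hne j)]

lemma preLikelihoodIdeal_le_likelihoodIdeal_of_linear [DecidableEq ι] {f : ι → PolyR n}
    {d : ι → Fin n → ℂ} (hd : ∀ i, f i = ∑ k, C (d i k) * X k) :
    preLikelihoodIdeal f ≤ likelihoodIdeal f := by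
  refine Ideal.span_le.mpr ?_
  rintro _ ⟨a, ⟨b, hb⟩, rfl⟩ p hp
  obtain ⟨hne, hcrit⟩ := (mem_critLocus_iff_of_linear hd p).mp hp
  have ha : ∀ j, eval p.1 (a j) * p.2 j =
      -∑ k, eval p.1 (b k) * (p.2 j / eval p.1 (f j) * d j k) := fun j => by
    have h := congrArg (eval p.1) (hb j)
    simp only [map_add, map_mul, map_sum, map_zero] at h
    have hs : ∑ k, eval p.1 (b k) * (p.2 j / eval p.1 (f j) * d j k) =
        p.2 j / eval p.1 (f j) * ∑ k, eval p.1 (b k) * eval p.1 (pderiv k (f j)) := by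
      rw [Finset.mul_sum]
      refine Finset.sum_congr rfl fun k _ => ?_
      rw [show pderiv k (f j) = C (d j k) by rw [hd, pderiv_sum_C_mul_X], eval_C]
      ring
    rw [hs, eq_neg_of_add_eq_zero_right h]
    field_simp [hne j]
  have hcomp : Sum.elim p.1 p.2 ∘ Sum.inl = p.1 := Sum.elim_comp_inl _ _
  simp only [map_sum, map_mul, eval_rename, eval_X, Sum.elim_inr, hcomp, ha]
  rw [Finset.sum_neg_distrib, Finset.sum_comm]
  simp [← Finset.mul_sum, hcrit]

/-- The derivative of polynomials in `x` and `s` along a vector `v` in `x`-space. -/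
def dirDeriv (ι : Type) (v : Fin n → ℂ) : Derivation ℂ (PolyRS n ι) (PolyRS n ι) :=
  mkDerivation ℂ (Sum.elim (fun k => C (v k)) 0)

lemma dirDeriv_rename (ι : Type) (v : Fin n → ℂ) (q : PolyR n) :
    dirDeriv ι v (rename Sum.inl q) =
      rename Sum.inl (mkDerivation ℂ (fun k => (C (v k) : PolyR n)) q) := by
  induction q using MvPolynomial.induction_on with
  | C a => simp [derivation_C]
  | add p q hp hq => simp [hp, hq]
  | mul_X p k hp =>
    have hX : dirDeriv ι v (X (Sum.inl k)) = C (v k) := by simp [dirDeriv, mkDerivation_X]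
    simp [hp, hX, mkDerivation_X]

lemma dirDeriv_linear (ι : Type) {d v : Fin n → ℂ} {q : PolyR n}
    (hd : q = ∑ k, C (d k) * X k) :
    dirDeriv ι v (rename Sum.inl q) = C (eval v q) := by
  rw [dirDeriv_rename, hd]
  simp [mkDerivation_X]

/-- The iterated Leibniz rule for a factor whose derivative is constant. -/
lemma MvPolynomial.iterate_derivation_mul {σ : Type*}
    (D : Derivation ℂ (MvPolynomial σ ℂ) (MvPolynomial σ ℂ)) {g : MvPolynomial σ ℂ} {a : ℂ}
    (hg : D g = C a) (h : MvPolynomial σ ℂ) (k : ℕ) :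
    D^[k + 1] (g * h) = g * D^[k + 1] h + C ((k + 1 : ℂ) * a) * D^[k] h := by
  induction k with
  | zero =>
    simp only [zero_add, Function.iterate_one, Derivation.leibniz, hg, smul_eq_mul,
      Function.iterate_zero, id, Nat.cast_zero, one_mul]
    ring
  | succ k ih =>
    rw [Function.iterate_succ_apply', ih]
    simp only [map_add, Derivation.leibniz, hg, smul_eq_mul, derivation_C,
      Function.iterate_succ_apply', Nat.cast_succ, C_mul, C_1, Derivation.map_one_eq_zero]
    ring

lemma exists_iterate_dirDeriv_eq_zero {κ : Type} (v : Fin n → ℂ) (h : PolyRS n κ) :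
    ∃ N, (dirDeriv κ v)^[N] h = 0 := by
  induction h using MvPolynomial.induction_on with
  | C a => exact ⟨1, derivation_C _ _⟩
  | add p q hp hq =>
    obtain ⟨N, hN⟩ := hp
    obtain ⟨M, hM⟩ := hq
    refine ⟨N + M, ?_⟩
    rw [iterate_map_add, add_comm N M, Function.iterate_add_apply, hN, add_comm M N,
      Function.iterate_add_apply, hM, iterate_map_zero, iterate_map_zero, add_zero]
  | mul_X p i hp =>
    obtain ⟨N, hN⟩ := hp
    have hX : dirDeriv κ v (X i) = C (Sum.elim v 0 i) := by
      rcases i with k | j <;> simp [dirDeriv, mkDerivation_X]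
    refine ⟨N + 1, ?_⟩
    rw [mul_comm, iterate_derivation_mul _ hX, Function.iterate_succ_apply', hN]
    simp

/-- The pre-likelihood ideal is stable under derivatives along directions contained in every
hyperplane of the arrangement. -/
lemma dirDeriv_mem_preLikelihoodIdeal {f : ι → PolyR n} {d : ι → Fin n → ℂ}
    (hd : ∀ i, f i = ∑ k, C (d i k) * X k) {v : Fin n → ℂ} (hv : ∀ i, eval v (f i) = 0)
    {h : PolyRS n ι} (hh : h ∈ preLikelihoodIdeal f) :
    dirDeriv ι v h ∈ preLikelihoodIdeal f := by
  have hp : ∀ i k, pderiv k (f i) = C (d i k) := fun i k => by rw [hd, pderiv_sum_C_mul_X]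
  induction hh using Submodule.span_induction with
  | zero => simp
  | add x y _ _ hx hy => simpa using Ideal.add_mem _ hx hy
  | smul r x hx hDx =>
    rw [smul_eq_mul, Derivation.leibniz]
    exact Ideal.add_mem _ (Ideal.mul_mem_left _ _ hDx) (Ideal.mul_mem_right _ _ hx)
  | mem x hx =>
    obtain ⟨a, ⟨b, hb⟩, rfl⟩ := hx
    let D : Derivation ℂ (PolyR n) (PolyR n) := mkDerivation ℂ fun k => C (v k)
    refine Ideal.subset_span ⟨fun i => D (a i), ⟨fun k => D (b k), fun i => ?_⟩, ?_⟩
    · have hDf : D (f i) = 0 := by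
        have h := dirDeriv_linear ι (v := v) (hd i)
        rw [dirDeriv_rename, hv, C_0] at h
        exact rename_injective _ Sum.inl_injective (h.trans (map_zero _).symm)
      have h := congrArg D (hb i)
      simp only [hp, map_add, map_sum, map_zero, Derivation.leibniz, hDf, derivation_C,
        smul_eq_mul] at h ⊢
      simpa only [mul_comm, mul_zero, zero_add] using h
    · rw [map_sum]
      refine Finset.sum_congr rfl fun i _ => ?_
      have hX : dirDeriv ι v (X (Sum.inr i)) = 0 := by simp [dirDeriv, mkDerivation_X]
      rw [Derivation.leibniz, hX, dirDeriv_rename, smul_zero, zero_add, smul_eq_mul, mul_comm]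

lemma mem_preLikelihoodIdeal_of_mul_mem {f : ι → PolyR n} {d : ι → Fin n → ℂ}
    (hd : ∀ i, f i = ∑ k, C (d i k) * X k) {e : Fin n → ℂ} {g : PolyR n}
    (hg : g = ∑ k, C (e k) * X k) {v : Fin n → ℂ} (hv : ∀ i, eval v (f i) = 0)
    (hgv : eval v g ≠ 0) {h : PolyRS n ι} (hh : rename Sum.inl g * h ∈ preLikelihoodIdeal f) :
    h ∈ preLikelihoodIdeal f := by
  set D := dirDeriv ι v
  have hDg : D (rename Sum.inl g) = C (eval v g) := dirDeriv_linear ι hg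
  have hmem : ∀ k, D^[k] (rename Sum.inl g * h) ∈ preLikelihoodIdeal f := fun k => by
    induction k with
    | zero => exact hh
    | succ k ih =>
      rw [Function.iterate_succ_apply']
      exact dirDeriv_mem_preLikelihoodIdeal hd hv ih
  have hstep : ∀ k, D^[k + 1] h ∈ preLikelihoodIdeal f → D^[k] h ∈ preLikelihoodIdeal f := by
    intro k hk
    have h1 := Ideal.sub_mem _ (hmem (k + 1)) (Ideal.mul_mem_left _ (rename Sum.inl g) hk)
    rw [iterate_derivation_mul D hDg, add_sub_cancel_left] at h1
    have hc : ((k : ℂ) + 1) * eval v g ≠ 0 := mul_ne_zero (Nat.cast_add_one_ne_zero k) hgv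
    have h2 := Ideal.mul_mem_left _ (C (((k : ℂ) + 1) * eval v g)⁻¹) h1
    rwa [← mul_assoc, ← C_mul, inv_mul_cancel₀ hc, C_1, one_mul] at h2
  obtain ⟨N, hN⟩ := exists_iterate_dirDeriv_eq_zero v h
  have hall : ∀ k, D^[k] h ∈ preLikelihoodIdeal f → h ∈ preLikelihoodIdeal f := fun k => by
    induction k with
    | zero => exact id
    | succ k ih => exact fun hk => ih (hstep k hk)
  exact hall N (by rw [hN]; exact Ideal.zero_mem _)

/-- Clearing denominators in the substitution `s_j ↦ Q_j / G`. -/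
lemma exists_clear_denominators {σ τ κ : Type} (G : MvPolynomial (σ ⊕ τ) ℂ)
    (Q : κ → MvPolynomial (σ ⊕ τ) ℂ) (h : MvPolynomial (σ ⊕ κ) ℂ) :
    ∃ (N : ℕ) (H : MvPolynomial (σ ⊕ τ) ℂ), ∀ (A : Type) [CommRing A] [Algebra ℂ A]
      (φ : MvPolynomial (σ ⊕ τ) ℂ →ₐ[ℂ] A) (ψ : MvPolynomial (σ ⊕ κ) ℂ →ₐ[ℂ] A),
      (∀ k, φ (X (Sum.inl k)) = ψ (X (Sum.inl k))) →
      (∀ j, φ (Q j) = φ G * ψ (X (Sum.inr j))) → φ H = φ G ^ N * ψ h := by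
  induction h using MvPolynomial.induction_on with
  | C a =>
    refine ⟨0, C a, fun A _ _ φ ψ _ _ => ?_⟩
    simp [← algebraMap_eq]
  | add p q hp hq =>
    obtain ⟨N, H, hH⟩ := hp
    obtain ⟨M, K, hK⟩ := hq
    refine ⟨N + M, G ^ M * H + G ^ N * K, fun A _ _ φ ψ h1 h2 => ?_⟩
    simp only [map_add, map_mul, map_pow, hH A φ ψ h1 h2, hK A φ ψ h1 h2]
    ring
  | mul_X p i hp =>
    obtain ⟨N, H, hH⟩ := hp
    rcases i with k | j
    · refine ⟨N, H * X (Sum.inl k), fun A _ _ φ ψ h1 h2 => ?_⟩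
      rw [map_mul, map_mul, hH A φ ψ h1 h2, h1]
      ring
    · refine ⟨N + 1, H * Q j, fun A _ _ φ ψ h1 h2 => ?_⟩
      rw [map_mul, map_mul, hH A φ ψ h1 h2, h2]
      ring

lemma Fintype.sum_eq_sum_subtype_add_sum_subtype_not {M : Type*} [AddCommMonoid M] (p : ι → Prop)
    [Fintype {i // p i}] [Fintype {i // ¬ p i}] (g : ι → M) :
    ∑ i, g i = ∑ i : {i // p i}, g i + ∑ i : {i // ¬ p i}, g i := by
  classical
  convert! (Fintype.sum_subtype_add_sum_subtype p g).symm

/-- The linear forms `df_i` project onto the span of the `df_j` with `p j`, compatibly with all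
linear relations. -/
lemma exists_projection_coeffs (d : ι → Fin n → ℂ) (p : ι → Prop) [Fintype {i // p i}]
    [Fintype {i // ¬ p i}] :
    ∃ c : {i // ¬ p i} → {i // p i} → ℂ, ∀ t : ι → ℂ, (∀ k, ∑ i, t i * d i k = 0) →
      ∀ k, ∑ j : {i // p i}, (t j + ∑ i : {i // ¬ p i}, c i j * t i) * d j k = 0 := by
  classical
  let U := Submodule.span ℂ (Set.range fun j : {i // p i} => d j)
  obtain ⟨π, hπ⟩ := LinearMap.exists_leftInverse_of_injective U.subtype U.ker_subtype
  have hU : ∀ w, ∃ c : {i // p i} → ℂ, ∑ j, c j • d j = (π w : Fin n → ℂ) := fun w =>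
    (Submodule.mem_span_range_iff_exists_fun ℂ).mp (π w).2
  choose c hc using fun i : {i // ¬ p i} => hU (d i)
  refine ⟨c, fun t ht k => ?_⟩
  have hfix : ∀ j : {i // p i}, (π (d j) : Fin n → ℂ) = d j := fun j =>
    congrArg Subtype.val (LinearMap.congr_fun hπ ⟨d j, Submodule.subset_span ⟨j, rfl⟩⟩)
  have hsum : ∑ i, t i • d i = 0 := by
    ext k
    simpa using ht k
  have h0 := congrArg (fun w => (π w : Fin n → ℂ)) hsum
  simp only [map_sum, map_smul, map_zero, Submodule.coe_sum, Submodule.coe_smul,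
    Submodule.coe_zero] at h0
  rw [Fintype.sum_eq_sum_subtype_add_sum_subtype_not p] at h0
  simp only [hfix, ← hc] at h0
  have h1 := congrFun h0 k
  simp only [Pi.add_apply, Finset.sum_apply, Pi.smul_apply, smul_eq_mul, Pi.zero_apply] at h1
  rw [← h1]
  simp only [add_mul, Finset.sum_add_distrib, Finset.sum_mul, Finset.mul_sum]
  congr 1
  rw [Finset.sum_comm]
  exact Finset.sum_congr rfl fun i _ => Finset.sum_congr rfl fun j _ => by ring

/-- The substitution `s_i = 0` for the indices `i` outside of `p`. -/
def restrictS (n : ℕ) (p : ι → Prop) [DecidablePred p] :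
    PolyRS n ι →ₐ[ℂ] PolyRS n {i // p i} :=
  aeval (Sum.elim (fun k => X (Sum.inl k)) fun i => if h : p i then X (Sum.inr ⟨i, h⟩) else 0)

lemma restrictS_rename {κ : Type} (p : κ → Prop) [DecidablePred p] (q : PolyR n) :
    restrictS n p (rename Sum.inl q) = rename Sum.inl q := by
  rw [restrictS, aeval_rename, rename_eq_aeval]
  rfl

lemma restrictS_mem_preLikelihoodIdeal (f : ι → PolyR n) (p : ι → Prop) [DecidablePred p]
    [Fintype {i // p i}] {h : PolyRS n ι} (hh : h ∈ preLikelihoodIdeal f) :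
    restrictS n p h ∈ preLikelihoodIdeal fun i : {i // p i} => f i := by
  suffices preLikelihoodIdeal f ≤
      (preLikelihoodIdeal fun i : {i // p i} => f i).comap (restrictS n p) from this hh
  refine Ideal.span_le.mpr ?_
  rintro _ ⟨a, ⟨b, hb⟩, rfl⟩
  refine Ideal.subset_span ⟨fun i => a i, ⟨b, fun i => hb i⟩, ?_⟩
  simp only [map_sum, map_mul, restrictS_rename]
  have hX : ∀ i, restrictS n p (X (Sum.inr i)) = if h : p i then X (Sum.inr ⟨i, h⟩) else 0 :=
    fun i => by simp [restrictS]
  rw [Fintype.sum_eq_sum_subtype_add_sum_subtype_not p]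
  have h0 : ∀ i : {i // ¬ p i}, restrictS n p (X (Sum.inr i.1)) = 0 := fun i => by
    rw [hX, dif_neg i.2]
  simp only [h0, mul_zero, Finset.sum_const_zero, add_zero]
  exact Finset.sum_congr rfl fun i _ => by rw [hX, dif_pos i.2]

lemma mem_likelihoodIdeal_iff [DecidableEq ι] {f : ι → PolyR n} {g : PolyRS n ι} :
    g ∈ likelihoodIdeal f ↔ ∀ p ∈ critLocus f, eval (Sum.elim p.1 p.2) g = 0 :=
  Iff.rfl

/-- Up to a power of the product of the remaining linear forms, every element of the likelihood
ideal of a subarrangement is the restriction of an element of the likelihood ideal of the whole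
arrangement. -/
lemma exists_mem_likelihoodIdeal_restrictS_eq [DecidableEq ι] {f : ι → PolyR n}
    {d : ι → Fin n → ℂ} (hd : ∀ i, f i = ∑ k, C (d i k) * X k) (p : ι → Prop) [DecidablePred p]
    [Fintype {i // p i}] [DecidableEq {i // p i}] [Fintype {i // ¬ p i}]
    {h : PolyRS n {i // p i}} (hh : h ∈ likelihoodIdeal fun i : {i // p i} => f i) :
    ∃ (N : ℕ) (H : PolyRS n ι), H ∈ likelihoodIdeal f ∧
      restrictS n p H = rename Sum.inl (∏ i : {i // ¬ p i}, f i) ^ N * h := by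
  obtain ⟨c, hc⟩ := exists_projection_coeffs d p
  let G : PolyR n := ∏ i : {i // ¬ p i}, f i
  let Q : {i // p i} → PolyRS n ι := fun j =>
    rename Sum.inl G * X (Sum.inr j.1) + rename Sum.inl (f j) * ∑ i : {i // ¬ p i},
      C (c i j) * rename Sum.inl (∏ l ∈ Finset.univ.erase i, f l) * X (Sum.inr i.1)
  obtain ⟨N, H, hH⟩ := exists_clear_denominators (rename Sum.inl G : PolyRS n ι) Q h
  refine ⟨N, H, ?_, ?_⟩
  · rintro ⟨x, s⟩ hxs
    obtain ⟨hne, hcrit⟩ := (mem_critLocus_iff_of_linear hd _).mp hxs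
    let s' : {i // p i} → ℂ := fun j =>
      eval x (f j) * (s j / eval x (f j) +
        ∑ i : {i // ¬ p i}, c i j * (s i / eval x (f i)))
    have hcrit' : (x, s') ∈ critLocus fun i : {i // p i} => f i := by
      refine (mem_critLocus_iff_of_linear (f := fun i : {i // p i} => f i)
        (fun i => hd i) _).mpr ⟨fun j => hne j, fun k => ?_⟩
      simpa only [s', mul_div_cancel_left₀ _ (hne _)] using
        hc (fun i => s i / eval x (f i)) hcrit k
    have h1 := hH ℂ (aeval (Sum.elim x s)) (aeval (Sum.elim x s')) (by simp) fun j => by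
      have hG : ∀ i : {i // ¬ p i}, ∏ l ∈ Finset.univ.erase i, eval x (f l) =
          eval x G / eval x (f i) := fun i => by
        rw [eq_div_iff (hne i), Finset.prod_erase_mul _ _ (Finset.mem_univ i), map_prod]
      have hx : ∀ q : PolyR n, aeval (Sum.elim x s) (rename Sum.inl q) = eval x q := fun q => by
        rw [aeval_rename, Sum.elim_comp_inl, aeval_eq_eval]
      have hC : ∀ a : ℂ, aeval (Sum.elim x s) (C a : PolyRS n ι) = a := fun a => aeval_C _ a
      simp only [Q, s', map_add, map_mul, map_sum, hx, hC, aeval_X, Sum.elim_inr]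
      rw [mul_add, mul_div_cancel₀ _ (hne _), mul_add, mul_left_comm (eval x G)]
      congr 2
      rw [Finset.mul_sum]
      refine Finset.sum_congr rfl fun i _ => ?_
      rw [map_prod, hG]
      ring
    have h2 : aeval (Sum.elim x s') h = 0 := by
      have h3 := mem_likelihoodIdeal_iff.mp hh (x, s') hcrit'
      rw [aeval_eq_eval]
      exact h3
    change eval (Sum.elim x s) _ = 0
    rw [← aeval_eq_eval, h1, h2, mul_zero]
  · have h1 := hH _ (restrictS n p) (AlgHom.id ℂ _) (by simp [restrictS]) fun j => by
      have h0 : ∀ i : {i // ¬ p i}, restrictS n p (X (Sum.inr i.1)) = 0 := fun i => by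
        simp [restrictS, i.2]
      have h1 : restrictS n p (X (Sum.inr j.1)) = X (Sum.inr j) := by simp [restrictS, j.2]
      simp only [Q, map_add, map_mul, map_sum, restrictS_rename]
      simp [h0, h1]
    rw [h1, restrictS_rename]
    rfl

/-- Gentleness passes to the subarrangement of all hyperplanes containing a given flat. -/
theorem IsGentle.subtype_of_linear [DecidableEq ι] {f : ι → PolyR n} {d : ι → Fin n → ℂ}
    (hd : ∀ i, f i = ∑ k, C (d i k) * X k) (p : ι → Prop) [Fintype {i // p i}]
    [DecidableEq {i // p i}]
    (hflat : ∀ i, ¬ p i → ∃ v, (∀ j, p j → eval v (f j) = 0) ∧ eval v (f i) ≠ 0)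
    (hf : IsGentle f) : IsGentle fun i : {i // p i} => f i := by
  classical
  refine le_antisymm (preLikelihoodIdeal_le_likelihoodIdeal_of_linear fun i => hd i)
    fun h hh => ?_
  obtain ⟨N, H, hH, hHh⟩ := exists_mem_likelihoodIdeal_restrictS_eq hd p hh
  rw [← hf] at hH
  have hGh := restrictS_mem_preLikelihoodIdeal f p hH
  rw [hHh] at hGh
  have hcancel : ∀ (s : Finset {i // ¬ p i}) (g : PolyRS n {i // p i}),
      rename Sum.inl (∏ i ∈ s, f i.1) * g ∈ preLikelihoodIdeal (fun i : {i // p i} => f i) →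
      g ∈ preLikelihoodIdeal fun i : {i // p i} => f i := by
    intro s
    induction s using Finset.induction_on with
    | empty => simp
    | insert i s hi ih =>
      intro g hg
      obtain ⟨v, hv, hvi⟩ := hflat i i.2
      rw [Finset.prod_insert hi, map_mul, mul_assoc] at hg
      exact ih g (mem_preLikelihoodIdeal_of_mul_mem (f := fun i : {i // p i} => f i)
        (fun j => hd j) (hd i) (fun j => hv j j.2) hvi hg)
  have hpow : ∀ k, rename Sum.inl (∏ i : {i // ¬ p i}, f i) ^ k * h ∈
      preLikelihoodIdeal (fun i : {i // p i} => f i) →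
      h ∈ preLikelihoodIdeal fun i : {i // p i} => f i := fun k => by
    induction k with
    | zero => simp
    | succ k ih => exact fun hk => ih (hcancel Finset.univ _ (by rwa [← mul_assoc, ← pow_succ']))
  exact hpow N hGh

attribute [local instance] Fintype.ofFinite

/-- The localization of a gentle hyperplane arrangement is gentle: if
`A` is a gentle arrangement of pairwise non-proportional linear forms, `X` is the
intersection of the hyperplanes `{f_j = 0}` for `j ∈ T`, and `A_X` is the subarrangement
of those `f_i` whose hyperplane contains `X`, then `A_X` is gentle. -/
theorem statement16 {n : ℕ} {ι : Type} [Fintype ι] [DecidableEq ι] (f : ι → PolyR n)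
    (hlin : ∀ i, (f i).IsHomogeneous 1)
    (hne : ∀ i, f i ≠ 0)
    (hprop : ∀ i j, i ≠ j → ∀ c : ℂ, f i ≠ c • f j)
    (T : Set ι)
    (hgentle : IsGentle f) :
    IsGentle (fun i : {i : ι //
        ∀ x : Fin n → ℂ, (∀ j ∈ T, eval x (f j) = 0) → eval x (f i) = 0} => f i.1) := by
  choose d hd using fun i => (hlin i).exists_eq_sum_C_mul_X
  refine hgentle.subtype_of_linear hd _ fun i hi => ?_
  push Not at hi
  obtain ⟨v, hvT, hvi⟩ := hi
  exact ⟨v, fun j hj => hj v hvT, hvi⟩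

end
end

section
/- The 4-dimensional resonance arrangement is not gentle: the hyperplane arrangement A in ℂ[x_1,x_2,x_3,x_4] consisting of the 15 linear forms Σ_{i∈T} x_i, where T ranges over the nonempty subsets of {1,2,3,4}, satisfies I_0(A) ≠ I(A). Consequently, restrictions of gentle hyperplane arrangements need not be gentle. -/
open MvPolynomial

noncomputable section

variable {n : ℕ} {ι : Type} [Fintype ι]

attribute [local instance] Fintype.ofFinite

/-- A sparse integer table, sending a decimal code `abcd` to the coefficient attached to the
exponent vector `(a, b, c, d)`. -/
def tableCoeff (l : List (ℕ × ℤ)) (a b c d : ℕ) : ℤ :=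
  (l.lookup (1000 * a + 100 * b + 10 * c + d)).getD 0

/-- The coefficients of a functional on sextic forms in four variables. -/
def sexticTable : List (ℕ × ℤ) :=
  [(6000, 1), (5100, 5), (5001, -1), (4200, 1), (4101, -1), (4002, -2), (3300, 1), (3201, -1),
    (3102, 2), (2400, 1), (2301, 1), (1500, -3), (1401, 1), (1302, -2), (600, 1), (501, 1),
    (402, 2)]

/-- The coefficients of functionals on septic forms in four variables, indexed by the binary codes
of the subsets of `Fin 4`. -/
def septicTable : ℕ → List (ℕ × ℤ)
  | 1 => [(601, -4), (511, 4), (412, -2), (403, -2), (313, 1)]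
  | 2 => [(5011, -4), (5002, -2), (4012, 2), (3013, -1)]
  | 3 => [(6010, -1), (6001, -1), (5110, 1), (5101, 1), (5011, -1), (4210, -1), (4201, -1),
    (4111, 1), (3310, 1), (3301, 1), (3211, -1), (3013, -1), (2410, -1), (2401, -1), (2311, 1),
    (2113, 1), (1510, 1), (1501, 1), (1411, -1), (1213, -1), (610, -1), (601, -1), (511, 1),
    (313, 1)]
  | 4 => [(6100, -8), (6001, -6), (5101, 3), (4102, -2), (3301, 1), (2500, 2), (2401, -2),
    (1501, -3), (1402, 2), (403, -2)]
  | 5 => [(1501, 4), (1402, -2), (1303, 1), (601, -4), (511, -4), (502, 2), (412, 2), (313, -1)]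
  | 6 => [(6001, 8), (5101, -4), (5011, 4), (4102, 2), (4012, -2), (4003, 2), (3103, -1), (3013,
    1)]
  | 7 => [(6001, -2), (5101, 1), (5011, 1), (4111, -1), (4003, -2), (3301, -1), (3211, 1),
    (3103, 1), (3013, 1), (2401, 2), (2311, -1), (2113, -1), (1501, -3), (1411, 1), (1303, -1),
    (1213, 1), (601, 4), (511, -1), (403, 2), (313, -1)]
  | 8 => [(6100, -8), (6010, 3), (5110, 2), (4210, -1), (3310, 1), (2410, -1), (610, -5)]
  | 9 => [(3310, 1), (2500, 2), (2311, -1), (1510, 2), (1501, -2), (1312, 1), (511, -2), (502,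
    2), (313, -1)]
  | 10 => [(5110, -2), (5011, 2), (3310, -1), (3211, 1), (3112, -1), (3013, 1)]
  | 11 => [(6010, -3), (5011, 3), (4210, 1), (4111, -1), (4012, -2), (3310, -1), (3112, 1),
    (3013, 1), (2410, 1), (2113, -1), (1510, -2), (1411, 1), (1312, -1), (1213, 1), (610, 5),
    (511, -3), (412, 2), (313, -1)]
  | 12 => [(6010, -4), (6001, 4), (5200, -2), (5110, -1), (5101, 1), (4300, -2), (1600, 6),
    (1510, 1), (1501, -1), (700, -2), (610, 4), (601, -4)]
  | 13 => [(6100, 8), (6001, 1), (5200, 2), (5101, -3), (5002, -2), (4300, 2), (4201, -1),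
    (4102, 2), (3310, -1), (2500, -2), (2401, 1), (2311, 1), (1600, -6), (1510, -2), (1501, 1),
    (1312, -1), (1303, -1), (700, 2), (601, 7), (511, 2), (502, -2), (403, 2), (313, 1)]
  | 14 => [(6100, 8), (6001, -7), (5200, 2), (5110, 2), (5101, 1), (5011, -2), (4300, 2), (4201,
    -1), (4003, -2), (3310, 1), (3211, -1), (3112, 1), (3103, 1), (3013, -1), (2401, 1), (1600,
    -6), (1501, 3), (1402, -2), (700, 2), (601, -1), (502, 2)]
  | 15 => [(6100, -8), (6010, 4), (6001, 2), (5200, -2), (5110, -1), (5101, 1), (5011, -3),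
    (5002, 2), (4300, -2), (4201, 2), (4111, 1), (4102, -2), (4012, 2), (4003, 2), (3112, -1),
    (3103, -1), (3013, -1), (2401, -2), (2113, 1), (1600, 6), (1510, 1), (1501, -1), (1411, -1),
    (1402, 2), (1312, 1), (1303, 1), (1213, -1), (700, -2), (610, -4), (601, -2), (511, 3),
    (502, -2), (412, -2), (403, -2), (313, 1)]
  | _ => []

/-- The binary code of a subset of `Fin 4`. -/
def binCode (T : Finset (Fin 4)) : ℕ := ∑ i ∈ T, 2 ^ (i : ℕ)

/-- The values of the parameters `s_T` at which the likelihood ideal is specialised. -/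
def weight (T : Finset (Fin 4)) : ℤ :=
  if T = {0, 2, 3} ∨ T = {1, 2, 3} then 1 else if T = Finset.univ then -2 else 0

/-- Coefficients of a functional on `ℂ[x]` supported in degree `6`. -/
def sexticCoeff (a b c d : ℕ) : ℤ :=
  if a + b + c + d = 6 then tableCoeff sexticTable a b c d else 0

/-- Coefficients of functionals on `ℂ[x]` supported in degree `7`. -/
def septicCoeff (T : Finset (Fin 4)) (a b c d : ℕ) : ℤ :=
  if a + b + c + d = 7 then tableCoeff (septicTable (binCode T)) a b c d else 0

lemma septicCoeff_shift_of_lt : ∀ T : Finset (Fin 4), T.Nonempty →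
    ∀ a < 7, ∀ b < 7 - a, ∀ c < 7 - a - b,
    (if 0 ∈ T then septicCoeff T (a + 1) b c (6 - a - b - c) else 0) +
    (if 1 ∈ T then septicCoeff T a (b + 1) c (6 - a - b - c) else 0) +
    (if 2 ∈ T then septicCoeff T a b (c + 1) (6 - a - b - c) else 0) +
    (if 3 ∈ T then septicCoeff T a b c (6 - a - b - c + 1) else 0) =
      weight T * sexticCoeff a b c (6 - a - b - c) := by
  decide +kernel

lemma sum_septicCoeff_of_lt : ∀ i : Fin 4, ∀ a < 8, ∀ b < 8 - a, ∀ c < 8 - a - b,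
    ∑ T : Finset (Fin 4), (if i ∈ T then septicCoeff T a b c (7 - a - b - c) else 0) = 0 := by
  decide +kernel

/-- The linear functional on `ℂ[x_1,…,x_4]` with prescribed integer values on monomials. -/
def coeffFunctional (w : ℕ → ℕ → ℕ → ℕ → ℤ) : PolyR 4 →ₗ[ℂ] ℂ :=
  (basisMonomials (Fin 4) ℂ).constr ℂ fun m => (w (m 0) (m 1) (m 2) (m 3) : ℂ)

lemma coeffFunctional_monomial (w : ℕ → ℕ → ℕ → ℕ → ℤ) (m : Fin 4 →₀ ℕ) (c : ℂ) :
    coeffFunctional w (monomial m c) = c * w (m 0) (m 1) (m 2) (m 3) := by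
  have h : monomial m c = c • basisMonomials (Fin 4) ℂ m := by
    simp [coe_basisMonomials, smul_monomial]
  rw [h, map_smul, coeffFunctional, Module.Basis.constr_basis, smul_eq_mul]

/-- The monomial `x_1 ^ a x_2 ^ b x_3 ^ c x_4 ^ d`. -/
def monom (a b c d : ℕ) : PolyR 4 := X 0 ^ a * X 1 ^ b * X 2 ^ c * X 3 ^ d

lemma coeffFunctional_C_mul_monom (w : ℕ → ℕ → ℕ → ℕ → ℤ) (z : ℂ) (a b c d : ℕ) :
    coeffFunctional w (C z * monom a b c d) = z * w a b c d := by
  have h : C z * monom a b c d =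
      monomial (Finsupp.equivFunOnFinite.symm ![a, b, c, d]) z := by
    rw [monomial_eq, Finsupp.prod_fintype _ _ (by simp)]
    simp [monom, Fin.prod_univ_four]
  rw [h, coeffFunctional_monomial]
  simp

lemma septicCoeff_shift (T : Finset (Fin 4)) (hT : T.Nonempty) (a b c d : ℕ) :
    (if 0 ∈ T then septicCoeff T (a + 1) b c d else 0) +
    (if 1 ∈ T then septicCoeff T a (b + 1) c d else 0) +
    (if 2 ∈ T then septicCoeff T a b (c + 1) d else 0) +
    (if 3 ∈ T then septicCoeff T a b c (d + 1) else 0) =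
      weight T * sexticCoeff a b c d := by
  by_cases h : a + b + c + d = 6
  · obtain rfl : d = 6 - a - b - c := by lia
    exact septicCoeff_shift_of_lt T hT a (by lia) b (by lia) c (by lia)
  · unfold septicCoeff sexticCoeff
    rw [if_neg h, if_neg (by lia : ¬ a + 1 + b + c + d = 7),
      if_neg (by lia : ¬ a + (b + 1) + c + d = 7), if_neg (by lia : ¬ a + b + (c + 1) + d = 7),
      if_neg (by lia : ¬ a + b + c + (d + 1) = 7)]
    simp

lemma sum_septicCoeff (i : Fin 4) (a b c d : ℕ) :
    ∑ T : Finset (Fin 4), (if i ∈ T then septicCoeff T a b c d else 0) = 0 := by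
  by_cases h : a + b + c + d = 7
  · obtain rfl : d = 7 - a - b - c := by lia
    exact sum_septicCoeff_of_lt i a (by lia) b (by lia) c (by lia)
  · simp [septicCoeff, h]

lemma coeffFunctional_septic_mul (T : Finset (Fin 4)) (hT : T.Nonempty) (p : PolyR 4) :
    coeffFunctional (septicCoeff T) (p * ∑ i ∈ T, X i) =
      weight T * coeffFunctional sexticCoeff p := by
  induction p using MvPolynomial.induction_on' with
  | add p q hp hq => rw [add_mul, map_add, map_add, hp, hq, mul_add]
  | monomial m c =>
    have hX : ∀ i : Fin 4, (monomial m c * X i : PolyR 4) = monomial (m + Finsupp.single i 1) c :=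
      fun i => by rw [X, monomial_mul, mul_one]
    have h := congrArg (fun z : ℤ => c * (z : ℂ))
      (septicCoeff_shift T hT (m 0) (m 1) (m 2) (m 3))
    rw [Finset.mul_sum, map_sum, ← Finset.univ_inter T, ← Finset.sum_ite_mem, Finset.univ_inter]
    simp only [Fin.sum_univ_four, hX, coeffFunctional_monomial]
    simp [mul_add] at h ⊢
    linear_combination h

lemma sum_coeffFunctional_septic (i : Fin 4) (p : PolyR 4) :
    ∑ T : Finset (Fin 4), (if i ∈ T then coeffFunctional (septicCoeff T) p else 0) = 0 := by
  induction p using MvPolynomial.induction_on' with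
  | add p q hp hq =>
    simp only [map_add, ite_add_zero, Finset.sum_add_distrib, hp, hq, add_zero]
  | monomial m c =>
    have h := congrArg (fun z : ℤ => c * (z : ℂ)) (sum_septicCoeff i (m 0) (m 1) (m 2) (m 3))
    simpa [coeffFunctional_monomial, Finset.mul_sum] using h

lemma pderiv_sum_X (T : Finset (Fin 4)) (j : Fin 4) :
    pderiv j (∑ i ∈ T, X i : PolyR 4) = if j ∈ T then 1 else 0 := by
  simp [pderiv_X, Pi.single_apply]

lemma sum_weight_mul_coeffFunctional_of_mem_logDer
    {a : {T : Finset (Fin 4) // T.Nonempty} → PolyR 4}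
    (ha : a ∈ logDer (fun T : {T : Finset (Fin 4) // T.Nonempty} => ∑ i ∈ T.1, (X i : PolyR 4))) :
    ∑ T, (weight T.1 : ℂ) * coeffFunctional sexticCoeff (a T) = 0 := by
  obtain ⟨b, hb⟩ := ha
  have hT : ∀ T : {T : Finset (Fin 4) // T.Nonempty},
      (weight T.1 : ℂ) * coeffFunctional sexticCoeff (a T) =
        -∑ j, if j ∈ T.1 then coeffFunctional (septicCoeff T.1) (b j) else 0 := by
    intro T
    rw [← coeffFunctional_septic_mul T.1 T.2, eq_neg_of_add_eq_zero_left (hb T), map_neg, map_sum]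
    simp only [pderiv_sum_X, mul_one, mul_zero, apply_ite, map_zero]
  have hj : ∀ j : Fin 4, ∑ T : {T : Finset (Fin 4) // T.Nonempty},
      (if j ∈ T.1 then coeffFunctional (septicCoeff T.1) (b j) else 0) = 0 := by
    intro j
    refine (Fintype.sum_of_injective Subtype.val Subtype.val_injective _ _ (fun T hT => ?_)
      fun _ => rfl).trans (sum_coeffFunctional_septic j (b j))
    exact if_neg fun hj => hT ⟨⟨T, j, hj⟩, rfl⟩
  rw [Finset.sum_congr rfl fun T _ => hT T, Finset.sum_neg_distrib, Finset.sum_comm,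
    Finset.sum_congr rfl fun j _ => hj j]
  simp

/-- The polynomial `x_k (x_k - (x_1 + ⋯ + x_4)) ∏_{m ≠ k} (x_k + x_m)`. -/
def polarQuintic (k : Fin 4) : PolyR 4 :=
  X k * (X k - ∑ m, X m) * ∏ m ∈ Finset.univ.erase k, (X k + X m)

/-- The coefficients of four quintic logarithmic vector fields of the resonance arrangement. -/
def resonanceField (k i : Fin 4) : PolyR 4 :=
  (X k ^ 2 - (∑ m, X m) ^ 2) * X i ^ 3 - (if i = k then 3 * polarQuintic k else 0) -
    (if k = 0 then 3 * (∑ m, X m) * X 1 * X 2 * X 3 else 0) * X i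

lemma prod_erase_fin_four (k : Fin 4) (g : Fin 4 → PolyR 4) :
    ∏ m ∈ Finset.univ.erase k, g m =
      ![g 1 * g 2 * g 3, g 0 * g 2 * g 3, g 0 * g 1 * g 3, g 0 * g 1 * g 2] k := by
  fin_cases k
  · rw [show (Finset.univ.erase _ : Finset (Fin 4)) = {1, 2, 3} by decide]
    simp [mul_assoc]
  · rw [show (Finset.univ.erase _ : Finset (Fin 4)) = {0, 2, 3} by decide]
    simp [mul_assoc]
  · rw [show (Finset.univ.erase _ : Finset (Fin 4)) = {0, 1, 3} by decide]
    simp [mul_assoc]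
  · rw [show (Finset.univ.erase _ : Finset (Fin 4)) = {0, 1, 2} by decide]
    simp [mul_assoc]

lemma sum_X_mul_resonanceField (i : Fin 4) : ∑ k, X k * resonanceField k i = 0 := by
  fin_cases i <;>
  · simp [resonanceField, polarQuintic, prod_erase_fin_four, Fin.sum_univ_four]
    ring

lemma dvd_sub_bind₁ (f : PolyR 4) (i : Fin 4) (p : PolyR 4) :
    f ∣ p - bind₁ (fun j => X j - if j = i then f else 0) p := by
  have h : (Ideal.Quotient.mkₐ ℂ (Ideal.span {f})).comp
      (bind₁ fun j => X j - if j = i then f else 0) = Ideal.Quotient.mkₐ ℂ (Ideal.span {f}) := by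
    refine MvPolynomial.algHom_ext fun j => ?_
    rw [AlgHom.comp_apply, bind₁_X_right, Ideal.Quotient.mkₐ_eq_mk,
      Ideal.Quotient.mk_eq_mk_iff_sub_mem, Ideal.mem_span_singleton]
    split_ifs <;> simp
  rw [← Ideal.mem_span_singleton, ← Ideal.Quotient.mk_eq_mk_iff_sub_mem]
  exact (DFunLike.congr_fun h p).symm

set_option maxHeartbeats 2000000 in
lemma dvd_sum_resonanceField (k : Fin 4) (T : Finset (Fin 4)) (hT : T.Nonempty) :
    (∑ i ∈ T, X i) ∣ ∑ i ∈ T, resonanceField k i := by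
  obtain ⟨i, hi⟩ := hT
  have h := dvd_sub_bind₁ (∑ i ∈ T, X i) i (∑ i ∈ T, resonanceField k i)
  suffices h0 : bind₁ (fun j => X j - if j = i then (∑ i ∈ T, X i) else 0)
      (∑ i ∈ T, resonanceField k i) = 0 by rwa [h0, sub_zero] at h
  clear h
  have hS : ∀ g : Fin 4 → PolyR 4, ∑ j ∈ T, g j = ∑ j, if j ∈ T then g j else 0 := by simp
  simp only [hS, resonanceField, polarQuintic, prod_erase_fin_four, Fin.sum_univ_four]
  clear hS
  fin_cases i <;> by_cases h0 : 0 ∈ T <;> by_cases h1 : 1 ∈ T <;> by_cases h2 : 2 ∈ T <;>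
    by_cases h3 : 3 ∈ T <;>
    first
    | exact absurd hi h0
    | exact absurd hi h1
    | exact absurd hi h2
    | exact absurd hi h3
    | fin_cases k <;>
      · simp [h0, h1, h2, h3, map_ofNat]
        try ring

lemma sum_X_ne_zero {T : Finset (Fin 4)} (hT : T.Nonempty) : (∑ i ∈ T, X i : PolyR 4) ≠ 0 := by
  obtain ⟨j, hj⟩ := hT
  intro h
  simpa [pderiv_sum_X, hj] using congrArg (pderiv j) h

/-- Four quartic elements of the log-derivation module of the resonance arrangement. -/
def resonanceLogDer (k : Fin 4) (T : {T : Finset (Fin 4) // T.Nonempty}) : PolyR 4 :=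
  (dvd_sum_resonanceField k T.1 T.2).choose

lemma sum_X_mul_resonanceLogDer (k : Fin 4) (T : {T : Finset (Fin 4) // T.Nonempty}) :
    (∑ i ∈ T.1, X i) * resonanceLogDer k T = ∑ i ∈ T.1, resonanceField k i :=
  (dvd_sum_resonanceField k T.1 T.2).choose_spec.symm

lemma resonanceLogDer_mem_logDer (k : Fin 4) :
    resonanceLogDer k ∈
      logDer (fun T : {T : Finset (Fin 4) // T.Nonempty} => ∑ i ∈ T.1, (X i : PolyR 4)) := by
  refine ⟨fun i => -resonanceField k i, fun T => ?_⟩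
  have h := sum_X_mul_resonanceLogDer k T
  simp only [pderiv_sum_X]
  simp
  linear_combination h

lemma sum_X_mul_resonanceLogDer_eq_zero (T : {T : Finset (Fin 4) // T.Nonempty}) :
    ∑ k, X k * resonanceLogDer k T = 0 := by
  refine mul_left_cancel₀ (sum_X_ne_zero T.2) ?_
  simp only [Finset.mul_sum, mul_left_comm _ (X _), sum_X_mul_resonanceLogDer]
  rw [Finset.sum_comm]
  simp [sum_X_mul_resonanceField]

lemma sum_X_mul_pderiv_resonanceField (k i : Fin 4) :
    ∑ j, X j * pderiv j (resonanceField k i) = 5 * resonanceField k i := by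
  have h : ∑ j : Fin 4, (X j : PolyR 4) • (pderiv j : Derivation ℂ (PolyR 4) (PolyR 4)) =
      mkDerivation ℂ X := by
    ext i : 1
    fin_cases i <;> simp [Fin.sum_univ_four, mkDerivation_X, pderiv_X]
  have h3 : (mkDerivation ℂ X : Derivation ℂ (PolyR 4) (PolyR 4)) 3 = 0 :=
    Derivation.map_natCast _ 3
  have h' := DFunLike.congr_fun h (resonanceField k i)
  simp only [Fin.sum_univ_four, Derivation.add_apply, Derivation.smul_apply, smul_eq_mul] at h' ⊢
  rw [h']
  simp only [resonanceField, polarQuintic, prod_erase_fin_four, Fin.sum_univ_four]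
  fin_cases k <;> fin_cases i <;>
  · simp [mkDerivation_X, h3]
    ring

lemma sum_X_mul_pderiv_resonanceLogDer (k : Fin 4) (T : {T : Finset (Fin 4) // T.Nonempty}) :
    ∑ j, X j * pderiv j (resonanceLogDer k T) = 4 * resonanceLogDer k T := by
  refine mul_left_cancel₀ (sum_X_ne_zero T.2) ?_
  have h : ∑ j, X j * pderiv j (∑ i ∈ T.1, resonanceField k i) =
      5 * ∑ i ∈ T.1, resonanceField k i := by
    simp only [map_sum, Finset.mul_sum]
    rw [Finset.sum_comm]
    simp only [sum_X_mul_pderiv_resonanceField]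
  rw [← sum_X_mul_resonanceLogDer] at h
  simp only [Derivation.leibniz, smul_eq_mul, pderiv_sum_X, mul_add, Finset.sum_add_distrib] at h
  have h2 : ∑ j, X j * (resonanceLogDer k T * if j ∈ T.1 then 1 else 0) =
      (∑ i ∈ T.1, X i) * resonanceLogDer k T := by
    simp [Finset.sum_mul]
  rw [h2] at h
  simp only [mul_left_comm (X _), ← Finset.mul_sum] at h
  linear_combination h

/-- The components of the curl of the family `resonanceLogDer`. -/
def resonanceCurl (k j : Fin 4) (T : {T : Finset (Fin 4) // T.Nonempty}) : PolyR 4 :=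
  pderiv j (resonanceLogDer k T) - pderiv k (resonanceLogDer j T)

lemma sum_X_mul_resonanceCurl (k : Fin 4) (T : {T : Finset (Fin 4) // T.Nonempty}) :
    ∑ j, X j * resonanceCurl k j T = 5 * resonanceLogDer k T := by
  have h := congrArg (pderiv k) (sum_X_mul_resonanceLogDer_eq_zero T)
  have h1 := sum_X_mul_pderiv_resonanceLogDer k T
  simp only [map_sum, Derivation.leibniz, pderiv_X, smul_eq_mul, Finset.sum_add_distrib,
    Pi.single_apply] at h
  simp [resonanceCurl, mul_sub] at h ⊢
  linear_combination h1 - h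

/-- The polynomials `∑ T, s_T a_T` for `a = resonanceLogDer k`, at the parameters `s = weight`. -/
def specializedForm {R : Type*} [CommRing R] (x y z w : R) : Fin 4 → R :=
  ![
    -x ^ 3 * y - x ^ 3 * z - x ^ 3 * w - x ^ 2 * y * z - x ^ 2 * y * w
      - x ^ 2 * z ^ 2 - 2 * x ^ 2 * z * w - x ^ 2 * w ^ 2 + x * y ^ 2 * z
      + x * y ^ 2 * w - 3 * x * y * z * w - x * z ^ 3 - x * w ^ 3 + y ^ 4
      + y ^ 3 * z + y ^ 3 * w - y ^ 2 * z ^ 2 + y ^ 2 * z * w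
      - y ^ 2 * w ^ 2 - y * z ^ 3 - y * w ^ 3,
    x ^ 4 + x ^ 3 * z + x ^ 3 * w + x ^ 2 * y * z + x ^ 2 * y * w
      - x ^ 2 * z ^ 2 + x ^ 2 * z * w - x ^ 2 * w ^ 2 - x * y ^ 3
      - x * y ^ 2 * z - x * y ^ 2 * w - 3 * x * y * z * w - x * z ^ 3
      - x * w ^ 3 - y ^ 3 * z - y ^ 3 * w - y ^ 2 * z ^ 2
      - 2 * y ^ 2 * z * w - y ^ 2 * w ^ 2 - y * z ^ 3 - y * w ^ 3,
    x ^ 4 + x ^ 3 * z + x ^ 3 * w - 2 * x ^ 2 * y ^ 2 + x ^ 2 * y * z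
      + x ^ 2 * y * w + x ^ 2 * z ^ 2 + x ^ 2 * z * w - x ^ 2 * w ^ 2
      + x * y ^ 2 * z + x * y ^ 2 * w + 2 * x * y * z ^ 2 + x * z ^ 2 * w
      - x * w ^ 3 + y ^ 4 + y ^ 3 * z + y ^ 3 * w + y ^ 2 * z ^ 2
      + y ^ 2 * z * w - y ^ 2 * w ^ 2 + y * z ^ 2 * w - y * w ^ 3,
    x ^ 4 + x ^ 3 * z + x ^ 3 * w - 2 * x ^ 2 * y ^ 2 + x ^ 2 * y * z
      + x ^ 2 * y * w - x ^ 2 * z ^ 2 + x ^ 2 * z * w + x ^ 2 * w ^ 2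
      + x * y ^ 2 * z + x * y ^ 2 * w + 2 * x * y * w ^ 2 - x * z ^ 3
      + x * z * w ^ 2 + y ^ 4 + y ^ 3 * z + y ^ 3 * w - y ^ 2 * z ^ 2
      + y ^ 2 * z * w + y ^ 2 * w ^ 2 - y * z ^ 3 + y * z * w ^ 2]

lemma sum_mul_weight (F : {T : Finset (Fin 4) // T.Nonempty} → PolyR 4) :
    ∑ T, F T * C (weight T.1 : ℂ) = F ⟨{0, 2, 3}, by decide⟩ + F ⟨{1, 2, 3}, by decide⟩ -
      2 * F ⟨Finset.univ, by decide⟩ := by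
  rw [← Finset.sum_subset (Finset.subset_univ {⟨{0, 2, 3}, by decide⟩, ⟨{1, 2, 3}, by decide⟩,
    ⟨Finset.univ, by decide⟩})]
  · rw [Finset.sum_insert, Finset.sum_insert, Finset.sum_singleton]
    · have h1 : weight {0, 2, 3} = 1 := by decide
      have h2 : weight {1, 2, 3} = 1 := by decide
      have h3 : weight Finset.univ = -2 := by decide
      simp only [h1, h2, h3, Int.cast_one, Int.cast_neg, Int.cast_ofNat, map_one, map_neg,
        map_ofNat]
      ring
    · simp [Subtype.ext_iff]
      decide
    · simp [Subtype.ext_iff]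
      decide
  · intro T _ hT
    have h : weight T.1 = 0 := by
      simp only [Finset.mem_insert, Finset.mem_singleton, Subtype.ext_iff, not_or] at hT
      simp [weight, hT]
    rw [h, Int.cast_zero, map_zero, mul_zero]

lemma sum_resonanceLogDer_mul_weight (k : Fin 4) :
    ∑ T, resonanceLogDer k T * C (weight T.1 : ℂ) = specializedForm (X 0) (X 1) (X 2) (X 3) k := by
  rw [sum_mul_weight]
  have h0 := sum_X_mul_resonanceLogDer k ⟨{0, 2, 3}, by decide⟩
  have h1 := sum_X_mul_resonanceLogDer k ⟨{1, 2, 3}, by decide⟩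
  have h2 := sum_X_mul_resonanceLogDer k ⟨Finset.univ, by decide⟩
  have n0 := sum_X_ne_zero (T := {0, 2, 3}) (by decide)
  have n1 := sum_X_ne_zero (T := {1, 2, 3}) (by decide)
  have n2 := sum_X_ne_zero (T := Finset.univ) (by decide)
  generalize resonanceLogDer k _ = a0 at h0 ⊢
  generalize resonanceLogDer k _ = a1 at h1 ⊢
  generalize resonanceLogDer k _ = a2 at h2 ⊢
  have e0 : ∀ g : Fin 4 → PolyR 4, ∑ i ∈ {0, 2, 3}, g i = g 0 + g 2 + g 3 := fun g => by
    simp [add_assoc]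
  have e1 : ∀ g : Fin 4 → PolyR 4, ∑ i ∈ {1, 2, 3}, g i = g 1 + g 2 + g 3 := fun g => by
    simp [add_assoc]
  simp only [e0, e1, Fin.sum_univ_four, resonanceField, polarQuintic, prod_erase_fin_four]
    at h0 h1 h2 n0 n1 n2
  fin_cases k <;>
  · simp [specializedForm] at h0 h1 h2 ⊢
    refine mul_left_cancel₀ (mul_ne_zero (mul_ne_zero n0 n1) n2) ?_
    linear_combination (X 1 + X 2 + X 3) * (X 0 + X 1 + X 2 + X 3) * h0 +
      (X 0 + X 2 + X 3) * (X 0 + X 1 + X 2 + X 3) * h1 -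
      2 * (X 0 + X 2 + X 3) * (X 1 + X 2 + X 3) * h2

lemma sum_resonanceCurl_mul_weight (k j : Fin 4) :
    ∑ T, resonanceCurl k j T * C (weight T.1 : ℂ) =
      pderiv j (specializedForm (X 0) (X 1) (X 2) (X 3) k) -
        pderiv k (specializedForm (X 0) (X 1) (X 2) (X 3) j) := by
  rw [← sum_resonanceLogDer_mul_weight, ← sum_resonanceLogDer_mul_weight, map_sum, map_sum,
    ← Finset.sum_sub_distrib]
  refine Finset.sum_congr rfl fun T _ => ?_
  simp [resonanceCurl, Derivation.leibniz]
  ring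

/-- The Pfaffian `h₀₁ h₂₃ - h₀₂ h₁₃ + h₀₃ h₁₂` of an alternating `4 × 4` matrix `h`. -/
def pfaffian {R : Type*} [CommRing R] (h : Fin 4 → Fin 4 → R) : R :=
  h 0 1 * h 2 3 - h 0 2 * h 1 3 + h 0 3 * h 1 2

lemma coeffFunctional_pfaffian_specializedForm :
    coeffFunctional sexticCoeff (pfaffian fun k j =>
      pderiv j (specializedForm (X 0) (X 1) (X 2) (X 3) k) -
        pderiv k (specializedForm (X 0) (X 1) (X 2) (X 3) j)) = -300 := by
  have h : (pfaffian fun k j => pderiv j (specializedForm (X 0) (X 1) (X 2) (X 3) k) -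
      pderiv k (specializedForm (X 0) (X 1) (X 2) (X 3) j)) =
      C (-15) * monom 4 1 1 0 + C 15 * monom 4 1 0 1 + C 15 * monom 4 0 2 0
        + C (-15) * monom 4 0 0 2 + C (-45) * monom 3 2 1 0 + C 45 * monom 3 2 0 1
        + C 60 * monom 3 1 2 0 + C (-60) * monom 3 1 0 2 + C 15 * monom 3 0 3 0
        + C (-15) * monom 3 0 2 1 + C 15 * monom 3 0 1 2 + C (-15) * monom 3 0 0 3
        + C 45 * monom 2 3 1 0 + C (-45) * monom 2 3 0 1 + C 15 * monom 2 1 3 0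
        + C 15 * monom 2 1 2 1 + C (-15) * monom 2 1 1 2 + C (-15) * monom 2 1 0 3
        + C 15 * monom 1 4 1 0 + C (-15) * monom 1 4 0 1 + C (-60) * monom 1 3 2 0
        + C 60 * monom 1 3 0 2 + C (-15) * monom 1 2 3 0 + C (-15) * monom 1 2 2 1
        + C 15 * monom 1 2 1 2 + C 15 * monom 1 2 0 3 + C (-15) * monom 0 4 2 0
        + C 15 * monom 0 4 0 2 + C (-15) * monom 0 3 3 0 + C 15 * monom 0 3 2 1
        + C (-15) * monom 0 3 1 2 + C 15 * monom 0 3 0 3 := by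
    have d2 : ∀ i : Fin 4, pderiv i (2 : PolyR 4) = 0 := fun i => Derivation.map_natCast _ 2
    have d3 : ∀ i : Fin 4, pderiv i (3 : PolyR 4) = 0 := fun i => Derivation.map_natCast _ 3
    simp [monom, pfaffian, specializedForm, pderiv_X, d2, d3, map_ofNat]
    ring
  rw [h]
  simp only [map_add, coeffFunctional_C_mul_monom]
  simp [sexticCoeff, tableCoeff, sexticTable, List.lookup]
  norm_num

/-- The specialisation `ℂ[x, s] → ℂ[x]` at the parameters `s = weight`. -/
def specialization : PolyRS 4 {T : Finset (Fin 4) // T.Nonempty} →ₐ[ℂ] PolyR 4 :=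
  aeval (Sum.elim X fun T => C (weight T.1 : ℂ))

lemma specialization_rename_mul_X (p : PolyR 4) (T : {T : Finset (Fin 4) // T.Nonempty}) :
    specialization (rename Sum.inl p * X (Sum.inr T)) = p * C (weight T.1 : ℂ) := by
  rw [specialization, map_mul, aeval_rename, aeval_X, Sum.elim_comp_inl, aeval_X_left,
    AlgHom.id_apply, Sum.elim_inr]

lemma coeffFunctional_mul_specialization_of_mem_preLikelihoodIdeal
    {g : PolyRS 4 {T : Finset (Fin 4) // T.Nonempty}}
    (hg : g ∈ preLikelihoodIdeal
      (fun T : {T : Finset (Fin 4) // T.Nonempty} => ∑ i ∈ T.1, (X i : PolyR 4))) (r : PolyR 4) :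
    coeffFunctional sexticCoeff (r * specialization g) = 0 := by
  induction hg using Submodule.span_induction generalizing r with
  | mem g hg =>
    obtain ⟨a, ha, rfl⟩ := hg
    have h := sum_weight_mul_coeffFunctional_of_mem_logDer (Submodule.smul_mem _ r ha)
    rw [← h, map_sum, Finset.mul_sum, map_sum]
    refine Finset.sum_congr rfl fun T _ => ?_
    rw [specialization_rename_mul_X, ← mul_assoc, mul_comm, ← smul_eq_C_mul, map_smul,
      smul_eq_mul, Pi.smul_apply, smul_eq_mul]
  | zero => simp
  | add g g' _ _ h h' => rw [map_add, mul_add, map_add, h, h', add_zero]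
  | smul c g _ h => rw [smul_eq_mul, map_mul specialization, ← mul_assoc, h]

/-- The polynomials `∑ T, s_T a_T` of `ℂ[x, s]` for `a = resonanceLogDer k`. -/
def logForm (k : Fin 4) : PolyRS 4 {T : Finset (Fin 4) // T.Nonempty} :=
  ∑ T, rename Sum.inl (resonanceLogDer k T) * X (Sum.inr T)

/-- The polynomials `∑ T, s_T h_T` of `ℂ[x, s]` for `h = resonanceCurl k j`. -/
def curlForm (k j : Fin 4) : PolyRS 4 {T : Finset (Fin 4) // T.Nonempty} :=
  ∑ T, rename Sum.inl (resonanceCurl k j T) * X (Sum.inr T)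

lemma curlForm_swap (k j : Fin 4) : curlForm k j = -curlForm j k := by
  simp [curlForm, resonanceCurl, sub_mul]

lemma sum_X_mul_curlForm (k : Fin 4) :
    ∑ j, X (Sum.inl j) * curlForm k j = 5 * logForm k := by
  simp only [curlForm, logForm, Finset.mul_sum]
  rw [Finset.sum_comm]
  refine Finset.sum_congr rfl fun T _ => ?_
  have h := congrArg (rename (Sum.inl : Fin 4 → Fin 4 ⊕ {T : Finset (Fin 4) // T.Nonempty}))
    (sum_X_mul_resonanceCurl k T)
  simp only [map_sum, map_mul, rename_X, map_ofNat] at h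
  rw [← mul_assoc, ← h, Finset.sum_mul]
  simp only [mul_assoc]

lemma X_mul_pfaffian_curlForm_mem :
    X (Sum.inl 0) * pfaffian curlForm ∈ preLikelihoodIdeal
      (fun T : {T : Finset (Fin 4) // T.Nonempty} => ∑ i ∈ T.1, (X i : PolyR 4)) := by
  have hmem : ∀ k, logForm k ∈ preLikelihoodIdeal
      (fun T : {T : Finset (Fin 4) // T.Nonempty} => ∑ i ∈ T.1, (X i : PolyR 4)) := fun k =>
    Ideal.subset_span ⟨resonanceLogDer k, resonanceLogDer_mem_logDer k, rfl⟩
  have hdiag : ∀ k, curlForm k k = 0 := fun k => by simp [curlForm, resonanceCurl]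
  have h1 := sum_X_mul_curlForm 1
  have h2 := sum_X_mul_curlForm 2
  have h3 := sum_X_mul_curlForm 3
  rw [Fin.sum_univ_four, hdiag, curlForm_swap 1 0] at h1
  rw [Fin.sum_univ_four, hdiag, curlForm_swap 2 0, curlForm_swap 2 1] at h2
  rw [Fin.sum_univ_four, hdiag, curlForm_swap 3 0, curlForm_swap 3 1, curlForm_swap 3 2] at h3
  have h : X (Sum.inl 0) * pfaffian curlForm =
      (-5 * curlForm 2 3) * logForm 1 + (5 * curlForm 1 3) * logForm 2 +
        (-5 * curlForm 1 2) * logForm 3 := by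
    unfold pfaffian
    linear_combination -curlForm 2 3 * h1 + curlForm 1 3 * h2 - curlForm 1 2 * h3
  rw [h]
  exact add_mem (add_mem (Ideal.mul_mem_left _ _ (hmem 1)) (Ideal.mul_mem_left _ _ (hmem 2)))
    (Ideal.mul_mem_left _ _ (hmem 3))

lemma specialization_pfaffian_curlForm :
    specialization (pfaffian curlForm) =
      pfaffian fun k j => pderiv j (specializedForm (X 0) (X 1) (X 2) (X 3) k) -
        pderiv k (specializedForm (X 0 : PolyR 4) (X 1) (X 2) (X 3) j) := by
  have h : ∀ k j, specialization (curlForm k j) =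
      pderiv j (specializedForm (X 0) (X 1) (X 2) (X 3) k) -
        pderiv k (specializedForm (X 0 : PolyR 4) (X 1) (X 2) (X 3) j) := by
    intro k j
    rw [← sum_resonanceCurl_mul_weight, curlForm, map_sum]
    exact Finset.sum_congr rfl fun T _ => specialization_rename_mul_X _ T
  simp only [pfaffian, map_add, map_sub, map_mul, h]

/-- The 4-dimensional resonance arrangement — the arrangement in
`ℂ[x_1,…,x_4]` consisting of the 15 linear forms `Σ_{i∈T} x_i` for nonempty subsets
`T ⊆ {1,2,3,4}` — is not gentle: `I₀(A) ≠ I(A)`. -/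
theorem statement18 :
    ¬ IsGentle (fun T : {T : Finset (Fin 4) // T.Nonempty} =>
        ∑ i ∈ T.1, (X i : PolyR 4)) := by
  intro h
  rw [IsGentle] at h
  have hmem : pfaffian curlForm ∈ likelihoodIdeal
      (fun T : {T : Finset (Fin 4) // T.Nonempty} => ∑ i ∈ T.1, (X i : PolyR 4)) := by
    intro p hp
    have h0 := X_mul_pfaffian_curlForm_mem
    rw [h] at h0
    have h1 := h0 p hp
    rw [map_mul, eval_X, Sum.elim_inl] at h1
    refine (mul_eq_zero.mp h1).resolve_left ?_
    simpa using hp.1 ⟨{0}, Finset.singleton_nonempty 0⟩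
  rw [← h] at hmem
  have h2 := coeffFunctional_mul_specialization_of_mem_preLikelihoodIdeal hmem 1
  rw [one_mul, specialization_pfaffian_curlForm, coeffFunctional_pfaffian_specializedForm] at h2
  norm_num at h2

end
end
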